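/- arXiv:cond-mat/0608397 — 10 statements merged into one kernel-verified Lean document; each statement's English description precedes it below -/
import Mathlib

section
/- Let p > 0, μ = -1/(6p²) and θ = (3p-1)(1-2p)/(6p²). Then the function u(z) = (1 + (1/2) z^{-p})^{-2} is twice differentiable on (0,∞) and satisfies the ordinary differential equation μ z² u''(z) + (1+θ) z u'(z) + u(z)(u(z) - 1) = 0 for every z > 0. -/
theorem hasDerivAt_rpow_neg_div (p : ℝ) {z : ℝ} (hz : 0 < z) :
    HasDerivAt (fun x : ℝ => x ^ (-p)) (-p * z ^ (-p) / z) z := by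
  have h := Real.hasDerivAt_rpow_const (x := z) (p := -p) (Or.inl hz.ne')
  rwa [Real.rpow_sub_one hz.ne', ← mul_div_assoc] at h

theorem one_add_half_rpow_pos (p : ℝ) {z : ℝ} (hz : 0 < z) :
    0 < 1 + (1 / 2) * z ^ (-p) := by
  positivity

theorem hasDerivAt_one_add_half_rpow (p : ℝ) {z : ℝ} (hz : 0 < z) :
    HasDerivAt (fun x : ℝ => 1 + (1 / 2) * x ^ (-p)) ((1 / 2) * (-p * z ^ (-p) / z)) z :=
  ((hasDerivAt_rpow_neg_div p hz).const_mul _).const_add _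

theorem hasDerivAt_profile (p : ℝ) {z : ℝ} (hz : 0 < z) :
    HasDerivAt (fun x : ℝ => (1 + (1 / 2) * x ^ (-p)) ^ (-2 : ℤ))
      (p * z ^ (-p) / (z * (1 + (1 / 2) * z ^ (-p)) ^ 3)) z := by
  have hA := (one_add_half_rpow_pos p hz).ne'
  have h := (hasDerivAt_zpow (-2) _ (Or.inl hA)).comp z (hasDerivAt_one_add_half_rpow p hz)
  refine h.congr_deriv ?_
  have e : (-2 - 1 : ℤ) = -(3 : ℕ) := by norm_num
  rw [e, zpow_neg, zpow_natCast]
  generalize 1 + (1 / 2) * z ^ (-p) = A at hA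
  push_cast
  field_simp

theorem hasDerivAt_deriv_profile (p : ℝ) {z : ℝ} (hz : 0 < z) :
    HasDerivAt (fun x : ℝ => p * x ^ (-p) / (x * (1 + (1 / 2) * x ^ (-p)) ^ 3))
      (p * z ^ (-p) * (p * (z ^ (-p) - 1) - (1 + (1 / 2) * z ^ (-p))) /
        (z ^ 2 * (1 + (1 / 2) * z ^ (-p)) ^ 4)) z := by
  have hA := (one_add_half_rpow_pos p hz).ne'
  have h := ((hasDerivAt_rpow_neg_div p hz).const_mul p).div
    ((hasDerivAt_id z).mul ((hasDerivAt_one_add_half_rpow p hz).pow 3))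
    (mul_ne_zero hz.ne' (pow_ne_zero 3 hA))
  refine h.congr_deriv ?_
  simp only [id, Pi.mul_apply, Pi.pow_apply]
  generalize z ^ (-p) = w at hA
  obtain ⟨A, hw⟩ : ∃ A, A = 1 + (1 / 2) * w := ⟨_, rfl⟩
  rw [← hw] at hA ⊢
  obtain rfl : w = 2 * (A - 1) := by linarith
  have hz' := hz.ne'
  push_cast
  field_simp
  ring


/-- Case 1 of Proposition 5.1: for `p > 0`, `μ = -1/(6p²)` and
`θ = (3p-1)(1-2p)/(6p²)`, the function `u(z) = (1 + (1/2) z^{-p})^{-2}` is twice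
differentiable on `(0,∞)` and satisfies `μ z² u'' + (1+θ) z u' + u(u-1) = 0` there. -/
theorem stmt0 (p : ℝ) (hp : 0 < p)
    (μ θ : ℝ) (hμ : μ = -1 / (6 * p ^ 2))
    (hθ : θ = (3 * p - 1) * (1 - 2 * p) / (6 * p ^ 2))
    (u : ℝ → ℝ) (hu : ∀ z : ℝ, u z = (1 + (1 / 2) * z ^ (-p)) ^ (-2 : ℤ)) :
    ∀ z : ℝ, 0 < z →
      DifferentiableAt ℝ u z ∧ DifferentiableAt ℝ (deriv u) z ∧
      μ * z ^ 2 * deriv (deriv u) z + (1 + θ) * z * deriv u z + u z * (u z - 1) = 0 := by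
  obtain rfl : u = fun z => (1 + (1 / 2) * z ^ (-p)) ^ (-2 : ℤ) := funext hu
  intro z hz
  have h1 := hasDerivAt_profile p hz
  have heq : deriv (fun x : ℝ => (1 + (1 / 2) * x ^ (-p)) ^ (-2 : ℤ)) =ᶠ[nhds z]
      fun x => p * x ^ (-p) / (x * (1 + (1 / 2) * x ^ (-p)) ^ 3) := by
    filter_upwards [lt_mem_nhds hz] with x hx using (hasDerivAt_profile p hx).deriv
  have h2 := (hasDerivAt_deriv_profile p hz).congr_of_eventuallyEq heq
  refine ⟨h1.differentiableAt, h2.differentiableAt, ?_⟩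
  rw [h2.deriv, h1.deriv, hμ, hθ]
  have hA := (one_add_half_rpow_pos p hz).ne'
  have e : (-2 : ℤ) = -(2 : ℕ) := by norm_num
  simp only [e, zpow_neg, zpow_natCast]
  generalize z ^ (-p) = w at hA
  obtain ⟨A, hw⟩ : ∃ A, A = 1 + (1 / 2) * w := ⟨_, rfl⟩
  rw [← hw] at hA ⊢
  obtain rfl : w = 2 * (A - 1) := by linarith
  field_simp
  ring
end

section
/- Let p > 0, μ = 2/(3p²) and θ = (3p+1)(2-p)/(3p²). Then the function u(z) = 1 - (1 + z^{p/2})^{-2} is twice differentiable on (0,∞) and satisfies the ordinary differential equation μ z² u''(z) + (1+θ) z u'(z) + u(z)(u(z) - 1) = 0 for every z > 0. -/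
theorem hasDerivAt_rpow_const_of_pos (a : ℝ) {z : ℝ} (hz : 0 < z) :
    HasDerivAt (fun x : ℝ => x ^ a) (a * z ^ a / z) z := by
  have h := Real.hasDerivAt_rpow_const (p := a) (Or.inl hz.ne')
  rwa [Real.rpow_sub_one hz.ne', ← mul_div_assoc] at h

theorem hasDerivAt_one_sub_one_add_rpow_zpow (a : ℝ) {z : ℝ} (hz : 0 < z) :
    HasDerivAt (fun x : ℝ => 1 - (1 + x ^ a) ^ (-2 : ℤ))
      (2 * a * z ^ a / (z * (1 + z ^ a) ^ 3)) z := by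
  have hw : 1 + z ^ a ≠ 0 := by positivity
  have h := ((hasDerivAt_zpow (-2) (1 + z ^ a) (Or.inl hw)).comp z
    ((hasDerivAt_rpow_const_of_pos a hz).const_add 1)).const_sub 1
  refine h.congr_deriv ?_
  norm_num [zpow_neg]
  field_simp

theorem hasDerivAt_rpow_div_mul_one_add_rpow_pow (a : ℝ) {z : ℝ} (hz : 0 < z) :
    HasDerivAt (fun x : ℝ => 2 * a * x ^ a / (x * (1 + x ^ a) ^ 3))
      (2 * a * z ^ a * (a * (1 - 2 * z ^ a) - (1 + z ^ a)) / (z ^ 2 * (1 + z ^ a) ^ 4)) z := by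
  have hw : 1 + z ^ a ≠ 0 := by positivity
  have hd := hasDerivAt_rpow_const_of_pos a hz
  have h := (hd.const_mul (2 * a)).fun_div ((hasDerivAt_id' z).fun_mul ((hd.const_add 1).fun_pow 3))
    (mul_ne_zero hz.ne' (pow_ne_zero 3 hw))
  refine h.congr_deriv ?_
  field_simp
  push_cast
  ring

/-- Case 2 of Proposition 5.1: for `p > 0`, `μ = 2/(3p²)` and
`θ = (3p+1)(2-p)/(3p²)`, the function `u(z) = 1 - (1 + z^{p/2})^{-2}` is twice
differentiable on `(0,∞)` and satisfies `μ z² u'' + (1+θ) z u' + u(u-1) = 0` there. -/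
theorem stmt1 (p : ℝ) (hp : 0 < p)
    (μ θ : ℝ) (hμ : μ = 2 / (3 * p ^ 2))
    (hθ : θ = (3 * p + 1) * (2 - p) / (3 * p ^ 2))
    (u : ℝ → ℝ) (hu : ∀ z : ℝ, u z = 1 - (1 + z ^ (p / 2)) ^ (-2 : ℤ)) :
    ∀ z : ℝ, 0 < z →
      DifferentiableAt ℝ u z ∧ DifferentiableAt ℝ (deriv u) z ∧
      μ * z ^ 2 * deriv (deriv u) z + (1 + θ) * z * deriv u z + u z * (u z - 1) = 0 := by
  intro z hz
  obtain rfl : u = fun x => 1 - (1 + x ^ (p / 2)) ^ (-2 : ℤ) := funext hu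
  have h₁ := hasDerivAt_one_sub_one_add_rpow_zpow (p / 2) hz
  have h₂ := (hasDerivAt_rpow_div_mul_one_add_rpow_pow (p / 2) hz).congr_of_eventuallyEq
    (f₁ := deriv fun x : ℝ => 1 - (1 + x ^ (p / 2)) ^ (-2 : ℤ)) <| by
      filter_upwards [lt_mem_nhds hz] with x hx
      exact (hasDerivAt_one_sub_one_add_rpow_zpow (p / 2) hx).deriv
  refine ⟨h₁.differentiableAt, h₂.differentiableAt, ?_⟩
  rw [h₂.deriv, h₁.deriv, hμ, hθ]
  have hw : 1 + z ^ (p / 2) ≠ 0 := by positivity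
  have hz' := hz.ne'
  have hp' := hp.ne'
  have hzpow : (1 + z ^ (p / 2)) ^ (-2 : ℤ) = 1 / (1 + z ^ (p / 2)) ^ 2 := by
    rw [zpow_neg, one_div]; norm_cast
  simp only [hzpow]
  generalize z ^ (p / 2) = w at hw ⊢
  field_simp
  ring
end

section
/- Let μ ≠ 0, θ ∈ ℝ, set q = -(1+θ-μ)/(5μ) and assume q ≠ 0, and set B = (6μq² + 1)/2. Suppose u : (0,∞) → ℝ is twice differentiable and satisfies μ z² u''(z) + (1+θ) z u'(z) + u(z)(u(z)-1) = 0 for all z > 0. Then the function y(z) = (u(z^{1/q}) - B)/z² is twice differentiable on (0,∞) and satisfies μ q² y''(z) + y(z)² + B(B-1)/z⁴ = 0 for all z > 0. -/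
/-- The derivative of a real power, written with the power itself. -/
theorem hasDerivAt_rpow_self_mul_div (p : ℝ) {z : ℝ} (hz : 0 < z) :
    HasDerivAt (fun x : ℝ => x ^ p) (p * z ^ p / z) z := by
  have h := Real.hasDerivAt_rpow_const (p := p) (Or.inl hz.ne')
  rwa [Real.rpow_sub_one hz.ne', ← mul_div_assoc] at h


/-- Change of variables reducing the profile ODE `μ z² u'' + (1+θ) z u' + u(u-1) = 0`
to the normal form `μ q² y'' + y² + B(B-1) z^{-4} = 0`, where `q = -(1+θ-μ)/(5μ)`,
`B = (6μq²+1)/2` and `y(z) = (u(z^{1/q}) - B)/z²`. -/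
theorem stmt3 (μ θ : ℝ) (hμ : μ ≠ 0)
    (q B : ℝ) (hq : q = -(1 + θ - μ) / (5 * μ)) (hq0 : q ≠ 0)
    (hB : B = (6 * μ * q ^ 2 + 1) / 2)
    (u : ℝ → ℝ)
    (hu : ∀ z : ℝ, 0 < z → DifferentiableAt ℝ u z ∧ DifferentiableAt ℝ (deriv u) z)
    (hode : ∀ z : ℝ, 0 < z →
      μ * z ^ 2 * deriv (deriv u) z + (1 + θ) * z * deriv u z + u z * (u z - 1) = 0)
    (y : ℝ → ℝ) (hy : ∀ z : ℝ, y z = (u (z ^ (1 / q)) - B) / z ^ 2) :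
    ∀ z : ℝ, 0 < z →
      DifferentiableAt ℝ y z ∧ DifferentiableAt ℝ (deriv y) z ∧
      μ * q ^ 2 * deriv (deriv y) z + (y z) ^ 2 + B * (B - 1) / z ^ 4 = 0 := by
  have hderiv : ∀ z : ℝ, 0 < z → HasDerivAt y
      ((1 / q * z ^ (1 / q) * deriv u (z ^ (1 / q)) - 2 * (u (z ^ (1 / q)) - B)) / z ^ 3) z := by
    intro z hz
    have hs := hasDerivAt_rpow_self_mul_div (1 / q) hz
    have hu₁ := (hu _ (Real.rpow_pos_of_pos hz (1 / q))).1.hasDerivAt.comp z hs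
    have h := (hu₁.sub_const B).div (hasDerivAt_pow 2 z) (pow_ne_zero 2 hz.ne')
    rw [funext hy]
    refine h.congr_deriv ?_
    simp only [Function.comp_apply]
    field_simp
    ring
  intro z hz
  have hspos := Real.rpow_pos_of_pos hz (1 / q)
  have hs := hasDerivAt_rpow_self_mul_div (1 / q) hz
  have hu₁ := (hu _ hspos).1.hasDerivAt.comp z hs
  have hu₂ := (hu _ hspos).2.hasDerivAt.comp z hs
  have hderiv₂ := ((((hs.const_mul (1 / q)).mul hu₂).sub
    ((hu₁.sub_const B).const_mul 2)).div (hasDerivAt_pow 3 z) (pow_ne_zero 3 hz.ne'))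
  have heq : deriv y =ᶠ[nhds z] fun x =>
      (1 / q * x ^ (1 / q) * deriv u (x ^ (1 / q)) - 2 * (u (x ^ (1 / q)) - B)) / x ^ 3 := by
    filter_upwards [lt_mem_nhds hz] with x hx using (hderiv x hx).deriv
  have hy₂ := hderiv₂.congr_of_eventuallyEq heq
  refine ⟨(hderiv z hz).differentiableAt, hy₂.differentiableAt, ?_⟩
  have hθ : 1 + θ = μ - 5 * μ * q := by
    rw [hq]
    field_simp
    ring
  have hode' := hode _ hspos
  rw [hy₂.deriv, hy z]
  rw [hθ] at hode'
  simp only [Function.comp_apply, Pi.mul_apply, Pi.sub_apply]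
  generalize deriv (deriv u) (z ^ (1 / q)) = c at *
  generalize deriv u (z ^ (1 / q)) = b at *
  generalize u (z ^ (1 / q)) = a at *
  generalize z ^ (1 / q) = s at *
  clear hq hθ
  subst hB
  field_simp
  linear_combination 4 * z ^ 2 * hode'
end

section
/- Let μ, θ ∈ ℝ, A > 0, z₀ > 0, and let ψ : [0,∞) → ℝ be continuous and differentiable on (0,∞) with |ψ(x)| ≤ A e^{z₀ x} for all x ≥ 0, ψ(0) = 1, and satisfying μ x ψ'(x) - (1+θ) ψ(x) + (1/x) ∫₀^x ψ(y)(ψ(x-y) + θ) dy = 0 for all x > 0. Define u(z) = z ∫₀^∞ ψ(x) e^{-zx} dx for z > z₀. Then u is twice differentiable on (z₀,∞) and satisfies μ z² u''(z) + (1+θ) z u'(z) + u(z)(u(z) - 1) = 0 for all z > z₀. -/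
open MeasureTheory

open Set Filter Topology Asymptotics

theorem isBigO_id_mul_exp_of_lt {f : ℝ → ℝ} {a b : ℝ}
    (hf : f =O[atTop] fun x => Real.exp (a * x)) (hab : a < b) :
    (fun x => x * f x) =O[atTop] fun x => Real.exp (b * x) := by
  have h := (isLittleO_pow_exp_pos_mul_atTop 1 (sub_pos.2 hab)).isBigO.mul hf
  refine (h.congr_left fun x => by rw [pow_one]).congr_right fun x => ?_
  rw [← Real.exp_add]
  ring_nf

theorem isBigO_mul_exp_neg {f : ℝ → ℝ} {a : ℝ}
    (hf : f =O[atTop] fun x => Real.exp (a * x)) (z : ℝ) :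
    (fun x => f x * Real.exp (-(z * x))) =O[atTop] fun x => Real.exp (-(z - a) * x) := by
  refine (hf.mul (isBigO_refl (fun x : ℝ => Real.exp (-(z * x))) atTop)).congr_right fun x => ?_
  rw [← Real.exp_add]
  ring_nf

theorem integrableOn_laplace_of_isBigO_exp {f : ℝ → ℝ} {a z : ℝ} (hc : ContinuousOn f (Ici 0))
    (hf : f =O[atTop] fun x => Real.exp (a * x)) (haz : a < z) :
    IntegrableOn (fun x => f x * Real.exp (-(z * x))) (Ioi 0) :=
  integrable_of_isBigO_exp_neg (sub_pos.2 haz) (hc.mul (by fun_prop)) (isBigO_mul_exp_neg hf z)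

theorem tendsto_mul_exp_neg_of_isBigO_exp {f : ℝ → ℝ} {a z : ℝ}
    (hf : f =O[atTop] fun x => Real.exp (a * x)) (haz : a < z) :
    Tendsto (fun x => f x * Real.exp (-(z * x))) atTop (𝓝 0) := by
  refine (isBigO_mul_exp_neg hf z).trans_tendsto ?_
  refine Real.tendsto_exp_atBot.comp ?_
  exact tendsto_id.const_mul_atTop_of_neg (by linarith)

/-- The Laplace transform may be differentiated under the integral sign. -/
theorem hasDerivAt_laplace_of_isBigO_exp {f : ℝ → ℝ} {a z : ℝ} (hc : ContinuousOn f (Ici 0))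
    (hf : f =O[atTop] fun x => Real.exp (a * x)) (haz : a < z) :
    HasDerivAt (fun s => ∫ x in Ioi (0 : ℝ), f x * Real.exp (-(s * x)))
      (-∫ x in Ioi (0 : ℝ), x * f x * Real.exp (-(z * x))) z := by
  obtain ⟨b, hab, hbz⟩ := exists_between haz
  obtain ⟨c, hbc, hcz⟩ := exists_between hbz
  have hc' : ContinuousOn (fun x => x * f x) (Ici 0) := continuousOn_id.mul hc
  have hf' := isBigO_id_mul_exp_of_lt hf hab
  have key := hasDerivAt_integral_of_dominated_loc_of_deriv_le (μ := volume.restrict (Ioi 0))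
    (F := fun s x => f x * Real.exp (-(s * x)))
    (F' := fun s x => -(x * f x * Real.exp (-(s * x))))
    (bound := fun x => ‖x * f x * Real.exp (-(c * x))‖)
    (Ioi_mem_nhds hcz) ?_ (integrableOn_laplace_of_isBigO_exp hc hf haz)
    (integrableOn_laplace_of_isBigO_exp hc' hf' hbz).neg.aestronglyMeasurable ?_
    (integrableOn_laplace_of_isBigO_exp hc' hf' hbc).norm ?_
  · simpa only [integral_neg] using key.2
  · filter_upwards [Ioi_mem_nhds haz] with s hs
    exact (integrableOn_laplace_of_isBigO_exp hc hf hs).aestronglyMeasurable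
  · filter_upwards [ae_restrict_mem measurableSet_Ioi] with x (hx : 0 < x) s (hs : c < s)
    rw [norm_neg, norm_mul _ (Real.exp _), norm_mul _ (Real.exp _)]
    simp only [Real.norm_eq_abs, Real.abs_exp]
    gcongr
  · refine ae_of_all _ fun x s _ => ?_
    have h : HasDerivAt (fun s : ℝ => -(s * x)) (-x) s := by
      exact ((hasDerivAt_id s).mul_const x).neg.congr_deriv (by ring)
    exact (h.exp.const_mul (f x)).congr_deriv (by ring)

theorem laplace_const {z : ℝ} (hz : 0 < z) (c : ℝ) :
    ∫ x in Ioi (0 : ℝ), c * Real.exp (-(z * x)) = c / z := by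
  have h := integral_exp_mul_Ioi (neg_neg_of_pos hz) 0
  simp only [neg_mul, mul_zero, Real.exp_zero] at h
  rw [integral_const_mul, h]
  field_simp

theorem intervalIntegral_convolution_exp_neg (f g : ℝ → ℝ) (z x : ℝ) :
    ∫ y in (0 : ℝ)..x, (f y * Real.exp (-(z * y))) * (g (x - y) * Real.exp (-(z * (x - y))))
      = (∫ y in (0 : ℝ)..x, f y * g (x - y)) * Real.exp (-(z * x)) := by
  rw [← intervalIntegral.integral_mul_const]
  congr 1 with y
  rw [show -(z * x) = -(z * y) + -(z * (x - y)) by ring, Real.exp_add]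
  ring

theorem laplace_convolution {f g : ℝ → ℝ} {z : ℝ}
    (hf : IntegrableOn (fun x => f x * Real.exp (-(z * x))) (Ioi 0))
    (hg : IntegrableOn (fun x => g x * Real.exp (-(z * x))) (Ioi 0)) :
    IntegrableOn (fun x => (∫ y in (0 : ℝ)..x, f y * g (x - y)) * Real.exp (-(z * x))) (Ioi 0) ∧
    ∫ x in Ioi (0 : ℝ), (∫ y in (0 : ℝ)..x, f y * g (x - y)) * Real.exp (-(z * x))
      = (∫ x in Ioi (0 : ℝ), f x * Real.exp (-(z * x))) *
        ∫ x in Ioi (0 : ℝ), g x * Real.exp (-(z * x)) := by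
  have h₁ := integrable_posConvolution hf hg (ContinuousLinearMap.mul ℝ ℝ)
  have h₂ := integral_posConvolution hf hg (ContinuousLinearMap.mul ℝ ℝ)
  simp only [posConvolution, ContinuousLinearMap.mul_apply',
    intervalIntegral_convolution_exp_neg] at h₁ h₂
  exact ⟨(integrable_indicator_iff measurableSet_Ioi).1 h₁, h₂⟩

/-- The Laplace-transformed profile equation, obtained by integrating the derivative of
`μ x² ψ(x) e^{-zx}` over the half-line. -/
theorem laplace_profile_equation {μ θ z₀ z : ℝ} {ψ : ℝ → ℝ} (hz₀ : 0 < z₀) (hz : z₀ < z)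
    (hcont : ContinuousOn ψ (Ici 0)) (hdiff : ∀ x : ℝ, 0 < x → DifferentiableAt ℝ ψ x)
    (hO : ψ =O[atTop] fun x => Real.exp (z₀ * x))
    (hψ : ∀ x : ℝ, 0 < x →
      μ * x * deriv ψ x - (1 + θ) * ψ x
        + (1 / x) * ∫ y in (0 : ℝ)..x, ψ y * (ψ (x - y) + θ) = 0) :
    μ * (2 * (∫ x in Ioi (0 : ℝ), x * ψ x * Real.exp (-(z * x)))
        - z * ∫ x in Ioi (0 : ℝ), x * (x * ψ x) * Real.exp (-(z * x)))
      + (1 + θ) * (∫ x in Ioi (0 : ℝ), x * ψ x * Real.exp (-(z * x)))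
      - (∫ x in Ioi (0 : ℝ), ψ x * Real.exp (-(z * x)))
        * ((∫ x in Ioi (0 : ℝ), ψ x * Real.exp (-(z * x))) + θ / z) = 0 := by
  obtain ⟨a, ha, haz⟩ := exists_between hz
  obtain ⟨b, hab, hbz⟩ := exists_between haz
  have hO₁ := isBigO_id_mul_exp_of_lt hO ha
  have hO₂ := isBigO_id_mul_exp_of_lt hO₁ hab
  have hc₁ : ContinuousOn (fun x => x * ψ x) (Ici 0) := continuousOn_id.mul hcont
  have hc₂ : ContinuousOn (fun x => x * (x * ψ x)) (Ici 0) := continuousOn_id.mul hc₁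
  have hi₀ := integrableOn_laplace_of_isBigO_exp hcont hO hz
  have hi₁ := integrableOn_laplace_of_isBigO_exp hc₁ hO₁ haz
  have hi₂ := integrableOn_laplace_of_isBigO_exp hc₂ hO₂ hbz
  have hiθ : IntegrableOn (fun x => θ * Real.exp (-(z * x))) (Ioi 0) := by
    have h := (integrableOn_exp_mul_Ioi (neg_neg_of_pos (hz₀.trans hz)) 0).const_mul θ
    simp only [neg_mul] at h
    exact h
  have hig : IntegrableOn (fun x => (ψ x + θ) * Real.exp (-(z * x))) (Ioi 0) := by
    simp only [add_mul]
    exact hi₀.add hiθ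
  have hLg : ∫ x in Ioi (0 : ℝ), (ψ x + θ) * Real.exp (-(z * x))
      = (∫ x in Ioi (0 : ℝ), ψ x * Real.exp (-(z * x))) + θ / z := by
    simp only [add_mul]
    rw [integral_add hi₀ hiθ, laplace_const (hz₀.trans hz)]
  obtain ⟨hiC, hLC⟩ := laplace_convolution (g := fun x => ψ x + θ) hi₀ hig
  have hi₁₂ : IntegrableOn (fun x => μ * (2 * (x * ψ x * Real.exp (-(z * x)))
      - z * (x * (x * ψ x) * Real.exp (-(z * x))))) (Ioi 0) :=
    ((hi₁.const_mul 2).sub (hi₂.const_mul z)).const_mul μ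
  have hi₁₂₁ : IntegrableOn (fun x => μ * (2 * (x * ψ x * Real.exp (-(z * x)))
      - z * (x * (x * ψ x) * Real.exp (-(z * x)))) + (1 + θ) * (x * ψ x * Real.exp (-(z * x))))
      (Ioi 0) :=
    hi₁₂.add (hi₁.const_mul (1 + θ))
  have hderiv : ∀ x ∈ Ioi (0 : ℝ),
      HasDerivAt (fun x => μ * (x * (x * ψ x) * Real.exp (-(z * x))))
        (μ * (2 * (x * ψ x * Real.exp (-(z * x))) - z * (x * (x * ψ x) * Real.exp (-(z * x))))
          + (1 + θ) * (x * ψ x * Real.exp (-(z * x)))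
          - (∫ y in (0 : ℝ)..x, ψ y * (ψ (x - y) + θ)) * Real.exp (-(z * x))) x := by
    intro x (hx : 0 < x)
    have he : HasDerivAt (fun x : ℝ => -(z * x)) (-z) x := by
      exact ((hasDerivAt_id x).const_mul z).neg.congr_deriv (by ring)
    have hd := ((((hasDerivAt_id x).mul ((hasDerivAt_id x).mul
      (hdiff x hx).hasDerivAt)).mul he.exp).const_mul μ)
    refine hd.congr_deriv ?_
    have h := hψ x hx
    field_simp at h
    simp only [id, Pi.mul_apply]
    linear_combination Real.exp (-(z * x)) * h
  have hint := integral_Ioi_of_hasDerivAt_of_tendsto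
    ((continuousOn_const.mul (hc₂.mul (by fun_prop))) 0 self_mem_Ici) hderiv
    (hi₁₂₁.sub hiC) ((tendsto_mul_exp_neg_of_isBigO_exp hO₂ hbz).const_mul μ)
  rw [integral_sub hi₁₂₁ hiC, integral_add hi₁₂ (hi₁.const_mul (1 + θ)), integral_const_mul,
    integral_sub (hi₁.const_mul 2) (hi₂.const_mul z), integral_const_mul, integral_const_mul,
    integral_const_mul, hLC, hLg] at hint
  simpa using hint

/-- The Laplace transform reduction: if `ψ` solves the self-similar profile equation
and has at most exponential growth, then `u(z) = z ∫₀^∞ ψ(x) e^{-zx} dx` satisfies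
the ODE `μ z² u'' + (1+θ) z u' + u(u-1) = 0` for `z > z₀`. -/
theorem stmt5 (μ θ A z₀ : ℝ) (hA : 0 < A) (hz₀ : 0 < z₀)
    (ψ : ℝ → ℝ)
    (hcont : ContinuousOn ψ (Set.Ici 0))
    (hdiff : ∀ x : ℝ, 0 < x → DifferentiableAt ℝ ψ x)
    (hbound : ∀ x : ℝ, 0 ≤ x → |ψ x| ≤ A * Real.exp (z₀ * x))
    (hψ0 : ψ 0 = 1)
    (hψ : ∀ x : ℝ, 0 < x →
      μ * x * deriv ψ x - (1 + θ) * ψ x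
        + (1 / x) * ∫ y in (0 : ℝ)..x, ψ y * (ψ (x - y) + θ) = 0)
    (u : ℝ → ℝ)
    (hu : ∀ z : ℝ, u z = z * ∫ x in Set.Ioi (0 : ℝ), ψ x * Real.exp (-(z * x))) :
    ∀ z : ℝ, z₀ < z →
      DifferentiableAt ℝ u z ∧ DifferentiableAt ℝ (deriv u) z ∧
      μ * z ^ 2 * deriv (deriv u) z + (1 + θ) * z * deriv u z + u z * (u z - 1) = 0 := by
  have hO : ψ =O[atTop] fun x => Real.exp (z₀ * x) := by
    refine IsBigO.of_bound A ?_
    filter_upwards [eventually_ge_atTop 0] with x hx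
    simpa only [Real.norm_eq_abs, Real.abs_exp] using hbound x hx
  have hw : ∀ z, z₀ < z → HasDerivAt (fun s => ∫ x in Ioi (0 : ℝ), ψ x * Real.exp (-(s * x)))
      (-∫ x in Ioi (0 : ℝ), x * ψ x * Real.exp (-(z * x))) z :=
    fun z hz => hasDerivAt_laplace_of_isBigO_exp hcont hO hz
  have hu' : ∀ z, z₀ < z → HasDerivAt u ((∫ x in Ioi (0 : ℝ), ψ x * Real.exp (-(z * x)))
      - z * ∫ x in Ioi (0 : ℝ), x * ψ x * Real.exp (-(z * x))) z := by
    intro z hz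
    rw [funext hu]
    exact ((hasDerivAt_id z).mul (hw z hz)).congr_deriv (by simp only [id]; ring)
  intro z hz
  obtain ⟨a, ha, haz⟩ := exists_between hz
  have hw₁ := hasDerivAt_laplace_of_isBigO_exp (continuousOn_id.mul hcont)
    (isBigO_id_mul_exp_of_lt hO ha) haz
  have hu'' : HasDerivAt (deriv u)
      (-2 * (∫ x in Ioi (0 : ℝ), x * ψ x * Real.exp (-(z * x)))
        + z * ∫ x in Ioi (0 : ℝ), x * (x * ψ x) * Real.exp (-(z * x))) z := by
    have h := ((hw z hz).sub ((hasDerivAt_id z).mul hw₁)).congr_deriv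
      (g' := -2 * (∫ x in Ioi (0 : ℝ), x * ψ x * Real.exp (-(z * x)))
        + z * ∫ x in Ioi (0 : ℝ), x * (x * ψ x) * Real.exp (-(z * x)))
      (by simp only [id, Pi.mul_apply]; ring)
    refine h.congr_of_eventuallyEq ?_
    filter_upwards [Ioi_mem_nhds hz] with s hs
    exact (hu' s hs).deriv
  refine ⟨(hu' z hz).differentiableAt, hu''.differentiableAt, ?_⟩
  have h := laplace_profile_equation hz₀ hz hcont hdiff hO hψ
  have hz0 : z ≠ 0 := (hz₀.trans hz).ne'
  rw [hu''.deriv, (hu' z hz).deriv, hu z]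
  generalize (∫ x in Ioi (0 : ℝ), ψ x * Real.exp (-(z * x))) = w₀ at h ⊢
  have hθ : θ / z * z = θ := div_mul_cancel₀ θ hz0
  linear_combination -z ^ 2 * h - z * w₀ * hθ
end

section
/- Let 0 < p < 1 and define Φ(x) = (2 sin(pπ)/(pπ)) ∫₀^∞ e^{-x s^{-1/p}} (1 + s cos(pπ)) / (1 + s² + 2s cos(pπ))² ds for x > 0. Then for every z > 0, ∫₀^∞ Φ(x) e^{-zx} dx = (1/z)(1 + z^{-p})^{-2}. -/
open Real MeasureTheory

section StripIntegral

open Filter Topology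

lemma one_add_mul_cexp_ne_zero {p b : ℝ} (hb : 0 < b) {w : ℂ} (hw : |p * w.im| < π) :
    1 + (b : ℂ) * Complex.exp (-(p * w)) ≠ 0 := by
  intro h
  have hre := congrArg Complex.re h
  have him := congrArg Complex.im h
  simp [Complex.exp_re, Complex.exp_im, hb.ne', Real.exp_ne_zero] at hre him
  obtain ⟨h1, h2⟩ := abs_lt.mp hw
  have h0 := (Real.sin_eq_zero_iff_of_lt_of_lt h1 h2).mp him
  rw [h0, Real.cos_zero] at hre
  have : 0 < b * Real.exp (-(p * w.re)) := by positivity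
  linarith

lemma cexp_ne_one {w : ℂ} (h0 : w ≠ 0) (hw : |w.im| < 2 * π) : Complex.exp w ≠ 1 := by
  intro h
  obtain ⟨n, hn⟩ := Complex.exp_eq_one_iff.mp h
  have him : w.im = n * (2 * π) := by simp [hn]
  rw [him, abs_mul, abs_of_pos (by positivity : (0 : ℝ) < 2 * π)] at hw
  have hn1 : |(n : ℝ)| < 1 := by
    by_contra! hc
    nlinarith [Real.pi_pos]
  have hn0 : n = 0 := by
    rw [← Int.abs_lt_one_iff]; exact_mod_cast hn1
  exact h0 (by simp [hn, hn0])

/-- The numerator `(1 + b e^{-pw})⁻² - (1 + b)⁻² e^{w/2}`, which vanishes at `w = 0`. -/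
noncomputable def stripNumerator (p b : ℝ) (w : ℂ) : ℂ :=
  ((1 + (b : ℂ) * Complex.exp (-(p * w))) ^ 2)⁻¹ - ((1 + (b : ℂ)) ^ 2)⁻¹ * Complex.exp (w / 2)

/-- The analytic extension of `stripNumerator p b w / (e^w - 1)` across `w = 0`. -/
noncomputable def stripFun (p b : ℝ) (w : ℂ) : ℂ :=
  dslope (stripNumerator p b) 0 w / dslope Complex.exp 0 w

lemma stripFun_of_ne {p b : ℝ} {w : ℂ} (hw : w ≠ 0) :
    stripFun p b w = stripNumerator p b w / (Complex.exp w - 1) := by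
  have h0 : stripNumerator p b 0 = 0 := by simp [stripNumerator]
  rw [stripFun, dslope_of_ne _ hw, dslope_of_ne _ hw, slope_def_field, slope_def_field, h0]
  simp only [sub_zero, Complex.exp_zero]
  rw [div_div_div_cancel_right₀ hw]

lemma differentiableOn_stripFun {p b r : ℝ} (hp : 0 < p) (hb : 0 < b) (hr : 0 < r)
    (hr2 : r ≤ 2 * π) (hrp : p * r ≤ π) :
    DifferentiableOn ℂ (stripFun p b) {w : ℂ | |w.im| < r} := by
  have hopen : IsOpen {w : ℂ | |w.im| < r} :=
    isOpen_lt (by fun_prop) continuous_const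
  have hmem : {w : ℂ | |w.im| < r} ∈ nhds (0 : ℂ) := hopen.mem_nhds (by simpa using hr)
  refine DifferentiableOn.div ((Complex.differentiableOn_dslope hmem).2 ?_)
    ((Complex.differentiableOn_dslope hmem).2 Complex.differentiable_exp.differentiableOn) ?_
  · unfold stripNumerator
    refine DifferentiableOn.sub (DifferentiableOn.inv (by fun_prop) ?_) (by fun_prop)
    intro w hw
    refine pow_ne_zero 2 (one_add_mul_cexp_ne_zero hb ?_)
    rw [abs_mul, abs_of_pos hp]
    exact (mul_lt_mul_of_pos_left hw hp).trans_le hrp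
  · intro w hw
    by_cases h0 : w = 0
    · simp [h0, dslope_same]
    · rw [dslope_of_ne _ h0, slope_def_field]
      simp only [sub_zero, Complex.exp_zero]
      exact div_ne_zero (sub_ne_zero.2 (cexp_ne_one h0 (lt_of_lt_of_le hw hr2))) h0

lemma stripFun_sub_eq {p b t : ℝ} (hp : 0 < p) (hp1 : p < 1) (hb : 0 < b) :
    stripFun p b (t + (-π : ℝ) * Complex.I) - stripFun p b (t + (π : ℝ) * Complex.I) =
      ((2 * (2 * (b * rexp (-(p * t))) * sin (p * π) * (1 + b * rexp (-(p * t)) * cos (p * π)) /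
        (1 + (b * rexp (-(p * t))) ^ 2 + 2 * (b * rexp (-(p * t))) * cos (p * π)) ^ 2 /
          (rexp t + 1) - ((1 + b) ^ 2)⁻¹ * (rexp (t / 2) / (rexp t + 1))) : ℝ) : ℂ) *
        Complex.I := by
  have hne (y : ℝ) (hy : y ≠ 0) : (t : ℂ) + y * Complex.I ≠ 0 := by
    intro h
    have := congrArg Complex.im h
    simp at this
    exact hy this
  have hpi := Real.pi_pos
  have hden : (rexp t : ℂ) + 1 ≠ 0 := by
    have : 0 < rexp t + 1 := by positivity
    exact_mod_cast this.ne'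
  have hexp (e : ℝ) (he : e = 1 ∨ e = -1) :
      Complex.exp ((t : ℂ) + (e * π : ℝ) * Complex.I) = -(rexp t : ℂ) := by
    rw [Complex.exp_add, Complex.exp_mul_I, ← Complex.ofReal_cos, ← Complex.ofReal_sin]
    rcases he with rfl | rfl <;> simp
  have hhalf (e : ℝ) (he : e = 1 ∨ e = -1) :
      Complex.exp (((t : ℂ) + (e * π : ℝ) * Complex.I) / 2) =
        (rexp (t / 2) : ℂ) * (e * Complex.I) := by
    have : ((t : ℂ) + (e * π : ℝ) * Complex.I) / 2 =
        ((t / 2 : ℝ) : ℂ) + ((e * π / 2 : ℝ) : ℂ) * Complex.I := by push_cast; ring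
    rw [this, Complex.exp_add, Complex.exp_mul_I, ← Complex.ofReal_cos, ← Complex.ofReal_sin]
    rcases he with rfl | rfl <;> simp [neg_div]
  have hpow (e : ℝ) (he : e = 1 ∨ e = -1) :
      (b : ℂ) * Complex.exp (-(p * ((t : ℂ) + (e * π : ℝ) * Complex.I))) =
        ((b * rexp (-(p * t)) : ℝ) : ℂ) *
          ((cos (p * π) : ℂ) - e * sin (p * π) * Complex.I) := by
    have : -((p : ℂ) * ((t : ℂ) + (e * π : ℝ) * Complex.I)) =
        ((-(p * t) : ℝ) : ℂ) + ((-(e * (p * π)) : ℝ) : ℂ) * Complex.I := by push_cast; ring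
    rw [this, Complex.exp_add, Complex.exp_mul_I, ← Complex.ofReal_cos, ← Complex.ofReal_sin]
    rcases he with rfl | rfl <;> simp <;> ring
  have hu := one_add_mul_cexp_ne_zero (p := p) hb (w := (t : ℂ) + (1 * π : ℝ) * Complex.I)
    (by simp [abs_of_pos, hp, hpi]; nlinarith)
  have hv := one_add_mul_cexp_ne_zero (p := p) hb (w := (t : ℂ) + (-1 * π : ℝ) * Complex.I)
    (by simp [abs_of_pos, hp, hpi]; nlinarith)
  rw [hpow 1 (by simp)] at hu
  rw [hpow (-1) (by simp)] at hv
  rw [show -π = -1 * π by ring, show (t : ℂ) + (π : ℝ) * Complex.I =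
    (t : ℂ) + (1 * π : ℝ) * Complex.I by simp]
  rw [stripFun_of_ne (hne _ (by simp [hpi.ne'])), stripFun_of_ne (hne _ (by simp [hpi.ne']))]
  unfold stripNumerator
  rw [hexp 1 (by simp), hexp (-1) (by simp), hhalf 1 (by simp), hhalf (-1) (by simp),
    hpow 1 (by simp), hpow (-1) (by simp)]
  have hcs : (sin (p * π) : ℂ) ^ 2 + (cos (p * π) : ℂ) ^ 2 = 1 := by
    exact_mod_cast Real.sin_sq_add_cos_sq (p * π)
  generalize b * rexp (-(p * t)) = σ at *
  push_cast [-Complex.ofReal_exp, -Complex.ofReal_sin, -Complex.ofReal_cos] at *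
  generalize (sin (p * π) : ℂ) = S at *
  generalize (cos (p * π) : ℂ) = c at *
  generalize (rexp t : ℂ) = E at *
  generalize (rexp (t / 2) : ℂ) = H at *
  generalize ((1 + (b : ℂ)) ^ 2)⁻¹ = A at *
  generalize (σ : ℂ) = σ at *
  have hI := Complex.I_sq
  have hD : 1 + σ ^ 2 + 2 * σ * c =
      (1 + σ * (c - 1 * S * Complex.I)) * (1 + σ * (c - -1 * S * Complex.I)) := by
    linear_combination (-σ ^ 2) * hcs + (σ ^ 2 * S ^ 2) * hI
  have hE : -E - 1 = -(E + 1) := by ring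
  rw [hD, hE]
  set u := 1 + σ * (c - 1 * S * Complex.I) with hu'
  set v := 1 + σ * (c - -1 * S * Complex.I) with hv'
  have key : u ^ 2 - v ^ 2 = -(4 * σ * S * (1 + σ * c) * Complex.I) := by
    rw [hu', hv']; ring
  field_simp
  linear_combination (-1 : ℂ) * key

lemma norm_stripFun_le {p b : ℝ} (hb : 0 < b) {w : ℂ} (hw : w.re ≠ 0)
    (hw2 : b * rexp (-(p * w.re)) ≠ 1) :
    ‖stripFun p b w‖ ≤ (((1 - b * rexp (-(p * w.re))) ^ 2)⁻¹ +
      ((1 + b) ^ 2)⁻¹ * rexp (w.re / 2)) / |rexp w.re - 1| := by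
  have h0 : w ≠ 0 := fun h => hw (by simp [h])
  rw [stripFun_of_ne h0, norm_div]
  have h1 : |rexp w.re - 1| ≤ ‖Complex.exp w - 1‖ := by
    simpa [Complex.norm_exp] using abs_norm_sub_norm_le (Complex.exp w) 1
  have h2 : |1 - b * rexp (-(p * w.re))| ≤ ‖1 + (b : ℂ) * Complex.exp (-(p * w))‖ := by
    simpa [Complex.norm_exp, abs_of_pos hb] using
      abs_norm_sub_norm_le (1 : ℂ) (-((b : ℂ) * Complex.exp (-(p * w))))
  have h3 : 0 < |rexp w.re - 1| := by
    rw [abs_pos, sub_ne_zero]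
    simpa using hw
  have h4 : 0 < |1 - b * rexp (-(p * w.re))| := by
    rw [abs_pos, sub_ne_zero]
    exact hw2.symm
  have h5 : ‖((1 + (b : ℂ)) ^ 2)⁻¹ * Complex.exp (w / 2)‖ =
      ((1 + b) ^ 2)⁻¹ * rexp (w.re / 2) := by
    have h6 : ‖1 + (b : ℂ)‖ = 1 + b := by
      have : (1 + (b : ℂ)) = ((1 + b : ℝ) : ℂ) := by push_cast; ring
      rw [this, Complex.norm_real, Real.norm_eq_abs, abs_of_pos (by positivity)]
    rw [norm_mul, norm_inv, norm_pow, h6, Complex.norm_exp]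
    simp
  gcongr
  refine (norm_sub_le _ _).trans ?_
  rw [h5, norm_inv, norm_pow, ← sq_abs (1 - b * rexp (-(p * w.re)))]
  gcongr

lemma tendsto_stripBound_atTop {p b : ℝ} (hp : 0 < p) :
    Tendsto (fun x : ℝ => (((1 - b * rexp (-(p * x))) ^ 2)⁻¹ +
      ((1 + b) ^ 2)⁻¹ * rexp (x / 2)) / |rexp x - 1|) atTop (𝓝 0) := by
  have e (a : ℝ) (ha : 0 < a) : Tendsto (fun x : ℝ => rexp (-(a * x))) atTop (𝓝 0) :=
    tendsto_exp_neg_atTop_nhds_zero.comp (tendsto_id.const_mul_atTop ha)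
  have h1 : Tendsto (fun x : ℝ => ((1 - b * rexp (-(p * x))) ^ 2)⁻¹) atTop
      (𝓝 ((1 - b * 0) ^ 2)⁻¹) :=
    (((tendsto_const_nhds.sub ((e p hp).const_mul b)).pow 2)).inv₀ (by simp)
  have h2 : Tendsto (fun x : ℝ => |1 - rexp (-(1 * x))|) atTop (𝓝 |1 - 0|) :=
    (tendsto_const_nhds.sub (e 1 one_pos)).abs
  have h3 := ((h1.mul (e 1 one_pos)).add
    ((e (1 / 2) (by norm_num)).const_mul ((1 + b) ^ 2)⁻¹)).div h2 (by simp)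
  simp only [mul_zero, add_zero, zero_div] at h3
  refine h3.congr fun x => ?_
  have h4 : |1 - rexp (-(1 * x))| = |rexp x - 1| * rexp (-x) := by
    calc |1 - rexp (-(1 * x))| = |(rexp x - 1) * rexp (-x)| := by
          rw [sub_mul, ← Real.exp_add]; simp
      _ = |rexp x - 1| * rexp (-x) := by rw [abs_mul, abs_of_pos (Real.exp_pos (-x))]
  have h5 : rexp (-(1 / 2 * x)) = rexp (x / 2) * rexp (-x) := by
    rw [← Real.exp_add]; congr 1; ring
  simp only [Pi.div_apply]
  rw [h4, h5, one_mul, ← mul_assoc, ← add_mul, mul_div_mul_right _ _ (Real.exp_ne_zero _)]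

lemma tendsto_stripBound_atBot {p b : ℝ} (hp : 0 < p) (hb : 0 < b) :
    Tendsto (fun x : ℝ => (((1 - b * rexp (-(p * x))) ^ 2)⁻¹ +
      ((1 + b) ^ 2)⁻¹ * rexp (x / 2)) / |rexp x - 1|) atBot (𝓝 0) := by
  have h1 : Tendsto (fun x : ℝ => b * rexp (-(p * x))) atBot atTop :=
    (Real.tendsto_exp_atTop.comp
      (tendsto_neg_atBot_atTop.comp (tendsto_id.const_mul_atBot hp))).const_mul_atTop hb
  have h2 : Tendsto (fun x : ℝ => ((1 - b * rexp (-(p * x))) ^ 2)⁻¹) atBot (𝓝 0) := by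
    refine tendsto_inv_atTop_zero.comp ?_
    have := (tendsto_pow_atTop (two_ne_zero)).comp (tendsto_atTop_add_const_right _ (-1) h1)
    exact this.congr fun x => by simp only [Function.comp_apply]; ring
  have h3 : Tendsto (fun x : ℝ => rexp (x / 2)) atBot (𝓝 0) :=
    Real.tendsto_exp_atBot.comp (tendsto_id.atBot_div_const two_pos)
  have h4 : Tendsto (fun x : ℝ => |rexp x - 1|) atBot (𝓝 |0 - 1|) :=
    (Real.tendsto_exp_atBot.sub_const 1).abs
  have h5 := (h2.add (h3.const_mul ((1 + b) ^ 2)⁻¹)).div h4 (by simp)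
  simp only [mul_zero, add_zero, zero_div] at h5
  exact h5

lemma tendsto_integral_stripFun_vertical {p b : ℝ} (hp : 0 < p) (hb : 0 < b) (a c : ℝ)
    {l : Filter ℝ} (hl : l = atTop ∨ l = atBot) :
    Tendsto (fun x : ℝ => ∫ y in a..c, stripFun p b (x + y * Complex.I)) l (𝓝 0) := by
  have hB : Tendsto (fun x : ℝ => (((1 - b * rexp (-(p * x))) ^ 2)⁻¹ +
      ((1 + b) ^ 2)⁻¹ * rexp (x / 2)) / |rexp x - 1|) l (𝓝 0) := by
    rcases hl with rfl | rfl
    · exact tendsto_stripBound_atTop hp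
    · exact tendsto_stripBound_atBot hp hb
  have hne : ∀ᶠ x in l, x ≠ 0 ∧ b * rexp (-(p * x)) ≠ 1 := by
    have h1 (u : ℝ) : ∀ᶠ x in l, x ≠ u := by
      rcases hl with rfl | rfl
      · exact eventually_ne_atTop u
      · exact eventually_ne_atBot u
    filter_upwards [h1 0, h1 (Real.log b / p)] with x hx hx'
    refine ⟨hx, fun h => hx' ?_⟩
    have := congrArg Real.log h
    rw [Real.log_mul hb.ne' (Real.exp_ne_zero _), Real.log_exp, Real.log_one] at this
    rw [eq_div_iff hp.ne']
    linarith
  refine squeeze_zero_norm' ?_ (by simpa using hB.mul_const |c - a|)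
  filter_upwards [hne] with x hx
  refine intervalIntegral.norm_integral_le_of_norm_le_const fun y _ => ?_
  simpa using norm_stripFun_le (p := p) hb (w := x + y * Complex.I)
    (by simpa using hx.1) (by simpa using hx.2)

lemma tendsto_integral_exp_half_div :
    Tendsto (fun T : ℝ => ∫ t in (-T)..T, rexp (t / 2) / (rexp t + 1)) atTop (𝓝 π) := by
  have hd (t : ℝ) : HasDerivAt (fun t => 2 * arctan (rexp (t / 2)))
      (rexp (t / 2) / (rexp t + 1)) t := by
    have h := ((((hasDerivAt_id t).div_const 2).exp).arctan).const_mul 2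
    refine h.congr_deriv ?_
    have : rexp t = rexp (t / 2) ^ 2 := by rw [← Real.exp_nat_mul]; congr 1; push_cast; ring
    simp only [id, this]
    field_simp
    ring
  have heq (T : ℝ) : ∫ t in (-T)..T, rexp (t / 2) / (rexp t + 1) =
      2 * arctan (rexp (T / 2)) - 2 * arctan (rexp (-T / 2)) := by
    refine intervalIntegral.integral_eq_sub_of_hasDerivAt (fun t _ => hd t)
      (Continuous.intervalIntegrable ?_ _ _)
    exact Continuous.div (by fun_prop) (by fun_prop) fun t => by positivity
  simp only [heq]
  have h1 : Tendsto (fun T : ℝ => arctan (rexp (T / 2))) atTop (𝓝 (π / 2)) :=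
    (tendsto_arctan_atTop.mono_right nhdsWithin_le_nhds).comp
      (Real.tendsto_exp_atTop.comp (tendsto_id.atTop_div_const two_pos))
  have h2 : Tendsto (fun T : ℝ => arctan (rexp (-T / 2))) atTop (𝓝 (arctan 0)) :=
    (continuous_arctan.tendsto 0).comp
      (Real.tendsto_exp_atBot.comp (tendsto_neg_atTop_atBot.atBot_div_const two_pos))
  have := (h1.const_mul 2).sub (h2.const_mul 2)
  simp only [arctan_zero, mul_zero, sub_zero] at this
  rwa [mul_div_cancel₀ _ two_ne_zero] at this

lemma one_sub_abs_cos_pos {p : ℝ} (hp : 0 < p) (hp1 : p < 1) : 0 < 1 - |cos (p * π)| := by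
  have hs : 0 < sin (p * π) := sin_pos_of_pos_of_lt_pi (by positivity) (by nlinarith [pi_pos])
  have := sin_sq_add_cos_sq (p * π)
  have h : |cos (p * π)| ^ 2 < 1 ^ 2 := by rw [sq_abs]; nlinarith
  have := lt_of_pow_lt_pow_left₀ 2 (by norm_num) h
  linarith

lemma mul_one_add_sq_le {c : ℝ} (s : ℝ) :
    (1 - |c|) * (1 + s ^ 2) ≤ 1 + s ^ 2 + 2 * s * c := by
  have h1 : -(|s| * |c|) ≤ s * c := by rw [← abs_mul]; exact neg_abs_le _
  have h2 : 2 * |s| ≤ 1 + s ^ 2 := by nlinarith [sq_nonneg (|s| - 1), sq_abs s]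
  nlinarith [abs_nonneg c]

lemma denom_pos {p : ℝ} (hp : 0 < p) (hp1 : p < 1) (s : ℝ) :
    0 < 1 + s ^ 2 + 2 * s * cos (p * π) :=
  lt_of_lt_of_le (mul_pos (one_sub_abs_cos_pos hp hp1) (by positivity)) (mul_one_add_sq_le s)

lemma tendsto_integral_stripDensity {p b : ℝ} (hp : 0 < p) (hp1 : p < 1) (hb : 0 < b) :
    Tendsto (fun T : ℝ => ∫ t in (-T)..T,
      2 * (b * rexp (-(p * t))) * sin (p * π) * (1 + b * rexp (-(p * t)) * cos (p * π)) /
        (1 + (b * rexp (-(p * t))) ^ 2 + 2 * (b * rexp (-(p * t))) * cos (p * π)) ^ 2 /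
          (rexp t + 1)) atTop (𝓝 (((1 + b) ^ 2)⁻¹ * π)) := by
  set h : ℝ → ℝ := fun t =>
      2 * (b * rexp (-(p * t))) * sin (p * π) * (1 + b * rexp (-(p * t)) * cos (p * π)) /
        (1 + (b * rexp (-(p * t))) ^ 2 + 2 * (b * rexp (-(p * t))) * cos (p * π)) ^ 2 /
          (rexp t + 1)
  set g : ℝ → ℝ := fun t => rexp (t / 2) / (rexp t + 1)
  have hpi := pi_pos
  obtain ⟨r, hr, hr2, hrp⟩ : ∃ r, π < r ∧ r ≤ 2 * π ∧ p * r ≤ π := by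
    refine ⟨min (2 * π) (π / p), lt_min (by linarith) ?_, min_le_left _ _, ?_⟩
    · rw [lt_div_iff₀ hp]; nlinarith
    · calc p * min (2 * π) (π / p) ≤ p * (π / p) := by gcongr; exact min_le_right _ _
        _ = π := by field_simp
  have hdiff := differentiableOn_stripFun hp hb (hpi.trans hr) hr2 hrp
  have hch : Continuous h := by
    refine Continuous.div (Continuous.div (by fun_prop) (by fun_prop) fun t => ?_)
      (by fun_prop) fun t => by positivity
    exact pow_ne_zero 2 (denom_pos hp hp1 _).ne'
  have hcg : Continuous g :=
    Continuous.div (by fun_prop) (by fun_prop) fun t => by positivity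
  have hline (y : ℝ) (hy : |y| < r) :
      Continuous fun t : ℝ => stripFun p b (t + y * Complex.I) :=
    hdiff.continuousOn.comp_continuous (by fun_prop) fun t => by simpa using hy
  have hrect (T : ℝ) :
      (((∫ t in (-T)..T, h t) - ((1 + b) ^ 2)⁻¹ * ∫ t in (-T)..T, g t : ℝ) : ℂ) =
        ((∫ y in (-π)..π, stripFun p b ((-T : ℝ) + y * Complex.I)) -
          ∫ y in (-π)..π, stripFun p b (T + y * Complex.I)) / 2 := by
    have key := Complex.integral_boundary_rect_eq_zero_of_differentiableOn (stripFun p b)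
      ⟨-T, -π⟩ ⟨T, π⟩ (hdiff.mono fun w hw => by
        have := (Set.mem_preimage.1 hw.2)
        rw [Set.uIcc_of_le (by linarith)] at this
        exact lt_of_le_of_lt (abs_le.2 this) hr)
    simp only at key
    rw [← intervalIntegral.integral_sub
      ((hline _ (by rwa [abs_neg, abs_of_pos hpi])).intervalIntegrable _ _)
      ((hline _ (by rwa [abs_of_pos hpi])).intervalIntegrable _ _)] at key
    simp only [stripFun_sub_eq hp hp1 hb] at key
    rw [intervalIntegral.integral_mul_const, intervalIntegral.integral_ofReal,
      intervalIntegral.integral_const_mul, intervalIntegral.integral_sub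
      (hch.intervalIntegrable _ _) ((hcg.const_mul _).intervalIntegrable _ _),
      intervalIntegral.integral_const_mul] at key
    simp only [smul_eq_mul] at key
    push_cast at key ⊢
    refine mul_left_cancel₀ Complex.I_ne_zero ?_
    linear_combination (1 / 2) * key
  have hvert : Tendsto (fun T : ℝ =>
      (((∫ t in (-T)..T, h t) - ((1 + b) ^ 2)⁻¹ * ∫ t in (-T)..T, g t : ℝ) : ℂ))
      atTop (𝓝 ((0 : ℝ) : ℂ)) := by
    simp only [hrect]
    have h1 := (tendsto_integral_stripFun_vertical hp hb (-π) π (.inr rfl)).comp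
      tendsto_neg_atTop_atBot
    have h2 := tendsto_integral_stripFun_vertical hp hb (-π) π (.inl rfl)
    simpa using (h1.sub h2).div_const 2
  have hre := (Complex.continuous_re.tendsto _).comp hvert
  simp only [Function.comp_def, Complex.ofReal_re] at hre
  have hsum := hre.add (tendsto_integral_exp_half_div.const_mul ((1 + b) ^ 2)⁻¹)
  rw [zero_add] at hsum
  exact hsum.congr fun T => sub_add_cancel _ _

lemma integrableOn_stieltjesDensity {p : ℝ} (hp : 0 < p) (hp1 : p < 1) :
    IntegrableOn (fun s : ℝ => (1 + s * cos (p * π)) / (1 + s ^ 2 + 2 * s * cos (p * π)) ^ 2)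
      (Set.Ioi 0) := by
  set δ := 1 - |cos (p * π)| with hδ
  have hδ0 : 0 < δ := one_sub_abs_cos_pos hp hp1
  refine Integrable.mono' ((integrable_inv_one_add_sq.const_mul (2 / δ ^ 2)).integrableOn)
    (Measurable.aestronglyMeasurable (by fun_prop)) ?_
  refine (ae_restrict_iff' measurableSet_Ioi).2 (.of_forall fun s hs => ?_)
  have hs : 0 < s := hs
  have h1 := mul_one_add_sq_le (c := cos (p * π)) s
  rw [← hδ] at h1
  have h2 : |1 + s * cos (p * π)| ≤ 2 * (1 + s ^ 2) := by
    have hc := abs_le.1 (abs_cos_le_one (p * π))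
    rw [abs_le]
    constructor <;> nlinarith [sq_nonneg (s - 1)]
  have hD := denom_pos hp hp1 s
  rw [norm_div, norm_pow, Real.norm_eq_abs, Real.norm_eq_abs, abs_of_pos hD]
  calc |1 + s * cos (p * π)| / (1 + s ^ 2 + 2 * s * cos (p * π)) ^ 2
      ≤ (2 * (1 + s ^ 2)) / (δ * (1 + s ^ 2)) ^ 2 := by gcongr
    _ = 2 / δ ^ 2 * (1 + s ^ 2)⁻¹ := by field_simp

lemma integral_stieltjesDensity_div {p z : ℝ} (hp : 0 < p) (hp1 : p < 1) (hz : 0 < z) :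
    ∫ s in Set.Ioi (0 : ℝ), (1 + s * cos (p * π)) / (1 + s ^ 2 + 2 * s * cos (p * π)) ^ 2 *
      (z + s ^ (-(1 / p)))⁻¹ = p * π / (2 * sin (p * π)) * (z⁻¹ * ((1 + z ^ (-p)) ^ 2)⁻¹) := by
  have hS : 0 < sin (p * π) := sin_pos_of_pos_of_lt_pi (by positivity) (by nlinarith [pi_pos])
  set b := z ^ (-p) with hbdef
  have hb : 0 < b := rpow_pos_of_pos hz _
  set g : ℝ → ℝ := fun s => (1 + s * cos (p * π)) / (1 + s ^ 2 + 2 * s * cos (p * π)) ^ 2 *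
      (z + s ^ (-(1 / p)))⁻¹ with hg
  set h : ℝ → ℝ := fun t =>
      2 * (b * rexp (-(p * t))) * sin (p * π) * (1 + b * rexp (-(p * t)) * cos (p * π)) /
        (1 + (b * rexp (-(p * t))) ^ 2 + 2 * (b * rexp (-(p * t))) * cos (p * π)) ^ 2 /
          (rexp t + 1) with hh
  have hgint : IntegrableOn g (Set.Ioi 0) := by
    refine (integrableOn_stieltjesDensity hp hp1).mul_bdd (c := z⁻¹)
      (Measurable.aestronglyMeasurable (by fun_prop)) ?_
    refine (ae_restrict_iff' measurableSet_Ioi).2 (.of_forall fun s hs => ?_)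
    have hs' : 0 < s ^ (-(1 / p)) := rpow_pos_of_pos hs _
    rw [norm_inv, Real.norm_eq_abs, abs_of_pos (by positivity)]
    gcongr
    linarith
  have himage : Set.image (fun t : ℝ => b * rexp (-(p * t))) Set.univ = Set.Ioi 0 := by
    ext s
    simp only [Set.image_univ, Set.mem_range, Set.mem_Ioi]
    constructor
    · rintro ⟨t, rfl⟩
      positivity
    · intro hs
      refine ⟨-(Real.log (s / b) / p), ?_⟩
      rw [mul_neg, neg_neg, mul_div_cancel₀ _ hp.ne', Real.exp_log (by positivity)]
      field_simp
  have hderiv (t : ℝ) (_ : t ∈ Set.univ) : HasDerivWithinAt (fun t : ℝ => b * rexp (-(p * t)))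
      (-(p * (b * rexp (-(p * t))))) Set.univ t := by
    have := ((((hasDerivAt_id t).const_mul p).neg).exp).const_mul b
    refine (this.congr_deriv ?_).hasDerivWithinAt
    simp
    ring
  have hinj : Set.InjOn (fun t : ℝ => b * rexp (-(p * t))) Set.univ := by
    intro x _ y _ hxy
    have := Real.exp_injective (mul_left_cancel₀ hb.ne' hxy)
    exact mul_left_cancel₀ hp.ne' (neg_injective this)
  have hcomp (t : ℝ) : |-(p * (b * rexp (-(p * t))))| • g (b * rexp (-(p * t))) =
      p / (2 * sin (p * π) * z) * h t := by
    have hpow : (b * rexp (-(p * t))) ^ (-(1 / p)) = z * rexp t := by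
      rw [mul_rpow hb.le (Real.exp_pos _).le, hbdef, ← rpow_mul hz.le, ← Real.exp_mul]
      have h1 : -p * -(1 / p) = 1 := by field_simp
      have h2 : -(p * t) * -(1 / p) = t := by field_simp
      rw [h1, h2, rpow_one]
    have hD := denom_pos hp hp1 (b * rexp (-(p * t)))
    rw [abs_neg, abs_of_pos (by positivity), smul_eq_mul]
    simp only [hg, hh, hpow]
    have h3 : z + z * rexp t = z * (rexp t + 1) := by ring
    rw [h3]
    have h4 : rexp t + 1 ≠ 0 := by positivity
    generalize b * rexp (-(p * t)) = σ at *
    field_simp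
  rw [← himage, integrableOn_image_iff_integrableOn_abs_deriv_smul .univ hderiv hinj] at hgint
  simp only [hcomp, integrableOn_univ] at hgint
  have hhint : Integrable h := by
    refine (hgint.const_mul (p / (2 * sin (p * π) * z))⁻¹).congr (.of_forall fun t => ?_)
    exact inv_mul_cancel_left₀ (by positivity) _
  have hval : ∫ t, h t = ((1 + b) ^ 2)⁻¹ * π :=
    tendsto_nhds_unique
      (intervalIntegral_tendsto_integral hhint tendsto_neg_atTop_atBot tendsto_id)
      (tendsto_integral_stripDensity hp hp1 hb)
  rw [← himage, integral_image_eq_integral_abs_deriv_smul .univ hderiv hinj,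
    Measure.restrict_univ, integral_congr_ae (.of_forall hcomp), integral_const_mul, hval]
  field_simp

/-- The Laplace transform of `x ↦ ∫ e^{-x a(s)} k(s) ds` with `a > 0` is the integral of `k(s)`
against `1 / (z + a(s))`. -/
lemma laplace_integral_exp_mul {k a : ℝ → ℝ} (hk : IntegrableOn k (Set.Ioi 0))
    (ha : Measurable a) (ha0 : ∀ s, 0 < s → 0 < a s) {z : ℝ} (hz : 0 < z) :
    ∫ x in Set.Ioi (0 : ℝ), (∫ s in Set.Ioi (0 : ℝ), rexp (-(x * a s)) * k s) * rexp (-(z * x)) =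
      ∫ s in Set.Ioi (0 : ℝ), k s * (z + a s)⁻¹ := by
  have hexp (c : ℝ) (hc : 0 < c) : IntegrableOn (fun x => rexp (-(c * x))) (Set.Ioi 0) := by
    simpa using exp_neg_integrableOn_Ioi 0 hc
  have hprod : Integrable (Function.uncurry fun x s => rexp (-(x * a s)) * k s * rexp (-(z * x)))
      ((volume.restrict (Set.Ioi (0 : ℝ))).prod (volume.restrict (Set.Ioi (0 : ℝ)))) := by
    have h1 := ((hexp z hz).mul_prod hk).bdd_mul (c := 1)
      (f := fun q : ℝ × ℝ => rexp (-(q.1 * a q.2)))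
      (Measurable.aestronglyMeasurable (by fun_prop)) (by
        rw [Measure.prod_restrict]
        refine (ae_restrict_iff' (measurableSet_Ioi.prod measurableSet_Ioi)).2
          (.of_forall fun q hq => ?_)
        have := mul_pos hq.1 (ha0 q.2 hq.2)
        rw [Real.norm_eq_abs, abs_of_pos (Real.exp_pos _), Real.exp_le_one_iff]
        linarith)
    refine h1.congr (.of_forall fun q => ?_)
    simp only [Function.uncurry]
    ring
  simp only [← integral_mul_const]
  rw [integral_integral_swap hprod]
  refine setIntegral_congr_fun measurableSet_Ioi fun s hs => ?_
  have hpos : 0 < z + a s := add_pos hz (ha0 s hs)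
  have h2 (x : ℝ) : rexp (-(x * a s)) * k s * rexp (-(z * x)) =
      k s * rexp (-(z + a s) * x) := by
    rw [mul_right_comm, ← Real.exp_add, mul_comm]
    congr 2
    ring
  simp only [h2]
  rw [integral_const_mul, integral_exp_mul_Ioi (by linarith)]
  rw [mul_zero, Real.exp_zero, neg_div_neg_eq, one_div]

end StripIntegral

/-- The explicit inverse Laplace transform for Case 1: for `0 < p < 1`, the function
`Φ(x) = (2 sin pπ/(pπ)) ∫₀^∞ e^{-x s^{-1/p}} (1+s cos pπ)/(1+s²+2s cos pπ)² ds`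
satisfies `∫₀^∞ Φ(x) e^{-zx} dx = (1/z)(1+z^{-p})^{-2}` for every `z > 0`. -/
theorem stmt6 (p : ℝ) (hp : 0 < p) (hp1 : p < 1)
    (Φ : ℝ → ℝ)
    (hΦ : ∀ x : ℝ, 0 < x →
      Φ x = (2 * Real.sin (p * Real.pi) / (p * Real.pi)) *
        ∫ s in Set.Ioi (0 : ℝ),
          Real.exp (-(x * s ^ (-(1 / p)))) * (1 + s * Real.cos (p * Real.pi))
            / (1 + s ^ 2 + 2 * s * Real.cos (p * Real.pi)) ^ 2) :
    ∀ z : ℝ, 0 < z →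
      (∫ x in Set.Ioi (0 : ℝ), Φ x * Real.exp (-(z * x)))
        = (1 / z) * (1 + z ^ (-p)) ^ (-2 : ℤ) := by
  intro z hz
  have hS : 0 < sin (p * π) := sin_pos_of_pos_of_lt_pi (by positivity) (by nlinarith [pi_pos])
  have h1 : ∀ x ∈ Set.Ioi (0 : ℝ), Φ x * rexp (-(z * x)) =
      2 * sin (p * π) / (p * π) * ((∫ s in Set.Ioi (0 : ℝ), rexp (-(x * s ^ (-(1 / p)))) *
        ((1 + s * cos (p * π)) / (1 + s ^ 2 + 2 * s * cos (p * π)) ^ 2)) * rexp (-(z * x))) := by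
    intro x hx
    rw [hΦ x hx, mul_assoc]
    simp only [mul_div_assoc]
  rw [setIntegral_congr_fun measurableSet_Ioi h1, integral_const_mul,
    laplace_integral_exp_mul (integrableOn_stieltjesDensity hp hp1) (by fun_prop)
      (fun s hs => rpow_pos_of_pos hs _) hz, integral_stieltjesDensity_div hp hp1 hz,
    zpow_neg, ← mul_assoc, one_div]
  have h2 : 2 * sin (p * π) / (p * π) * (p * π / (2 * sin (p * π))) = 1 := by
    field_simp
  rw [h2, one_mul]
  norm_cast
end

section
/- Let 0 < p < 2 and define ψ₂(x) = (4 sin(pπ/2)/(pπ)) ∫₀^∞ (1 + s cos(pπ/2)) / (1 + s² + 2s cos(pπ/2))² · e^{-x s^{2/p}} ds for x ≥ 0. Then for every z > 0, ∫₀^∞ ψ₂(x) e^{-zx} dx = (1/z)(1 - (1 + z^{p/2})^{-2}). -/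
open Real MeasureTheory

section LaplaceInversion

open Set Filter Topology Complex

theorem one_add_exp_ne_zero_of_abs_im_lt_pi {w : ℂ} (hw : |w.im| < π) :
    1 + Complex.exp w ≠ 0 := by
  intro h
  have h1 : Complex.exp w = Complex.exp (π * I) := by
    rw [Complex.exp_pi_mul_I]; linear_combination h
  obtain ⟨n, hn⟩ := Complex.exp_eq_exp_iff_exists_int.1 h1
  have him : w.im = (1 + 2 * n : ℤ) * π := by
    rw [hn]; simp; ring
  rw [him, abs_mul, abs_of_pos Real.pi_pos] at hw
  have h2 : |((1 + 2 * n : ℤ) : ℝ)| < 1 := by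
    by_contra! h3
    nlinarith [Real.pi_pos]
  rw [← Int.cast_abs] at h2
  have h3 : |1 + 2 * n| < 1 := by exact_mod_cast h2
  rw [abs_lt] at h3
  omega

theorem eq_of_exp_eq_exp_of_abs_im_lt {w c : ℂ} (hw : |w.im - c.im| < 2 * π)
    (h : Complex.exp w = Complex.exp c) : w = c := by
  obtain ⟨n, hn⟩ := Complex.exp_eq_exp_iff_exists_int.1 h
  have him : w.im - c.im = n * (2 * π) := by
    rw [hn]; simp
  rw [him, abs_mul, abs_of_pos Real.two_pi_pos] at hw
  have h2 : |(n : ℝ)| < 1 := by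
    by_contra! h3
    nlinarith [Real.pi_pos]
  have hn0 : n = 0 := by
    rw [← Int.cast_abs] at h2
    exact Int.abs_lt_one_iff.1 (by exact_mod_cast h2)
  simpa [hn0] using hn

theorem differentiableOn_dslope_div_dslope_exp {f : ℂ → ℂ} {c : ℂ} {U : Set ℂ} (hU : U ∈ 𝓝 c)
    (hf : DifferentiableOn ℂ f U) (him : ∀ w ∈ U, |w.im - c.im| < 2 * π) :
    DifferentiableOn ℂ (fun w => dslope f c w / dslope Complex.exp c w) U := by
  refine ((Complex.differentiableOn_dslope hU).2 hf).div
    ((Complex.differentiableOn_dslope hU).2 Complex.differentiable_exp.differentiableOn) ?_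
  intro w hw
  by_cases h : w = c
  · subst h
    rw [dslope_same, Complex.deriv_exp]
    exact Complex.exp_ne_zero _
  · rw [dslope_of_ne _ h, slope_def_field]
    exact div_ne_zero (sub_ne_zero.2 fun h' => h (eq_of_exp_eq_exp_of_abs_im_lt (him w hw) h'))
      (sub_ne_zero.2 h)

theorem dslope_div_dslope_exp_of_ne (f : ℂ → ℂ) {c w : ℂ} (h : w ≠ c) :
    dslope f c w / dslope Complex.exp c w = (f w - f c) / (Complex.exp w - Complex.exp c) := by
  rw [dslope_of_ne _ h, dslope_of_ne _ h, slope_def_field, slope_def_field]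
  exact div_div_div_cancel_right₀ (sub_ne_zero.2 h) _ _

/-- Convergence of `G` as `re w → l`, uniformly in the imaginary part, gives convergence of the
integrals over vertical segments. -/
theorem tendsto_integral_vertical {G : ℂ → ℂ} {l : Filter ℝ} [l.IsCountablyGenerated] {L : ℂ}
    (hG : Measurable G) (h : Tendsto G (comap Complex.re l) (𝓝 L)) (a b : ℝ) :
    Tendsto (fun r : ℝ => ∫ y in a..b, G (r + y * I)) l (𝓝 (∫ _ in a..b, L)) := by
  refine intervalIntegral.tendsto_integral_filter_of_dominated_convergence (fun _ => ‖L‖ + 1)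
    ?_ ?_ intervalIntegrable_const ?_
  · exact Eventually.of_forall fun r => (hG.comp (by fun_prop)).aestronglyMeasurable
  · have hb : ∀ᶠ w in comap Complex.re l, ‖G w‖ ≤ ‖L‖ + 1 :=
      (h.norm.eventually_lt_const (lt_add_one _)).mono fun _ => le_of_lt
    rw [eventually_comap] at hb
    filter_upwards [hb] with r hr
    exact Eventually.of_forall fun y _ => hr _ (by simp)
  · refine Eventually.of_forall fun y _ => h.comp (tendsto_comap_iff.2 ?_)
    refine tendsto_id.congr fun r => ?_
    simp

/-- `u₂ = 1 - caseTwoProfile` in the logarithmic variable `w = log z`, with `a = p / 2`. -/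
noncomputable def caseTwoProfile (a : ℝ) (w : ℂ) : ℂ := ((1 + Complex.exp (a * w)) ^ 2)⁻¹

/-- The Cauchy kernel at `c` for the profile, in the logarithmic variable. -/
noncomputable def caseTwoKernel (a : ℝ) (c w : ℂ) : ℂ :=
  (caseTwoProfile a w - caseTwoProfile a c) / (Complex.exp w - Complex.exp c)

theorem measurable_caseTwoKernel (a : ℝ) (c : ℂ) : Measurable (caseTwoKernel a c) := by
  unfold caseTwoKernel caseTwoProfile
  fun_prop

theorem tendsto_ofReal_mul_comap_re {a : ℝ} {l : Filter ℝ} (hl : Tendsto (fun x => a * x) l l) :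
    Tendsto (fun w : ℂ => (a : ℂ) * w) (comap Complex.re l) (comap Complex.re l) := by
  refine tendsto_comap_iff.2 ((hl.comp tendsto_comap).congr fun w => ?_)
  simp

theorem tendsto_caseTwoKernel_atBot {a : ℝ} (ha : 0 < a) (c : ℂ) :
    Tendsto (caseTwoKernel a c) (comap Complex.re atBot)
      (𝓝 ((1 - caseTwoProfile a c) / (0 - Complex.exp c))) := by
  have h1 : Tendsto (fun w : ℂ => Complex.exp (a * w)) (comap Complex.re atBot) (𝓝 0) :=
    Complex.tendsto_exp_comap_re_atBot.comp
      (tendsto_ofReal_mul_comap_re (tendsto_id.const_mul_atBot ha))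
  have h2 : Tendsto (caseTwoProfile a) (comap Complex.re atBot) (𝓝 1) := by
    simpa [caseTwoProfile] using! ((h1.const_add 1).pow 2).inv₀ (by simp)
  exact (h2.sub_const _).div
    (Complex.tendsto_exp_comap_re_atBot.sub_const _) (by simp)

theorem tendsto_caseTwoKernel_atTop {a : ℝ} (ha : 0 < a) (c : ℂ) :
    Tendsto (caseTwoKernel a c) (comap Complex.re atTop) (𝓝 0) := by
  have h1 : Tendsto (fun w : ℂ => Complex.exp (a * w)) (comap Complex.re atTop)
      (Bornology.cobounded ℂ) :=
    Complex.tendsto_exp_comap_re_atTop.comp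
      (tendsto_ofReal_mul_comap_re (tendsto_id.const_mul_atTop ha))
  have h2 : Tendsto (caseTwoProfile a) (comap Complex.re atTop) (𝓝 0) := by
    have := (tendsto_inv₀_cobounded.comp (tendsto_const_add_cobounded (1 : ℂ) |>.comp h1)).pow 2
    simpa [caseTwoProfile, Function.comp_def] using! this
  have h3 : Tendsto (fun w : ℂ => (Complex.exp w - Complex.exp c)⁻¹) (comap Complex.re atTop)
      (𝓝 0) :=
    tendsto_inv₀_cobounded.comp
      ((tendsto_sub_const_cobounded (Complex.exp c)).comp Complex.tendsto_exp_comap_re_atTop)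
  simpa [caseTwoKernel, div_eq_mul_inv] using! (h2.sub_const (caseTwoProfile a c)).mul h3

theorem differentiableOn_caseTwoProfile {a : ℝ} (ha : 0 < a) :
    DifferentiableOn ℂ (caseTwoProfile a) {w | |w.im| < π / a} := by
  intro w hw
  have h : 1 + Complex.exp (a * w) ≠ 0 := by
    refine one_add_exp_ne_zero_of_abs_im_lt_pi ?_
    rw [Complex.im_ofReal_mul, abs_mul, abs_of_pos ha, mul_comm]
    exact (lt_div_iff₀ ha).1 hw
  have hd : DifferentiableAt ℂ (fun w : ℂ => (1 + Complex.exp (a * w)) ^ 2) w := by fun_prop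
  exact (hd.fun_inv (pow_ne_zero 2 h)).differentiableWithinAt

theorem integral_boundary_caseTwoKernel {a : ℝ} (ha : 0 < a) (ha1 : a < 1) {x R : ℝ}
    (hR : |x| < R) :
    (∫ t in -R..R, caseTwoKernel a x (t + (-π : ℝ) * I)) -
      (∫ t in -R..R, caseTwoKernel a x (t + π * I)) +
      I * (∫ y in -π..π, caseTwoKernel a x (R + y * I)) -
      I * (∫ y in -π..π, caseTwoKernel a x ((-R : ℝ) + y * I)) = 0 := by
  set U : Set ℂ := {w | |w.im| < min (π / a) (2 * π)} with hU
  have hpi : π < min (π / a) (2 * π) :=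
    lt_min ((lt_div_iff₀ ha).2 (by nlinarith [Real.pi_pos])) (by linarith [Real.pi_pos])
  have hUo : IsOpen U := isOpen_lt (by fun_prop) (by fun_prop)
  have hxU : U ∈ 𝓝 (x : ℂ) := hUo.mem_nhds (by
    simp only [hU, mem_ofPred_eq, Complex.ofReal_im, abs_zero]; exact Real.pi_pos.trans hpi)
  have hd := differentiableOn_dslope_div_dslope_exp hxU
    ((differentiableOn_caseTwoProfile ha).mono fun w hw => show |w.im| < π / a from lt_of_lt_of_le (show |w.im| < _ from hw) (min_le_left _ _))
    (fun w hw => by simpa using lt_of_lt_of_le (show |w.im| < _ from hw) (min_le_right _ _))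
  have hsub : uIcc ((-R : ℝ) + (-π : ℝ) * I : ℂ).re (R + π * I : ℂ).re ×ℂ
      uIcc ((-R : ℝ) + (-π : ℝ) * I : ℂ).im (R + π * I : ℂ).im ⊆ U := by
    intro w hw
    have h := hw.2
    simp only [Complex.add_im, Complex.ofReal_im, Complex.mul_I_im, Complex.ofReal_re, zero_add,
      mem_preimage] at h
    rw [uIcc_of_le (by linarith [Real.pi_pos])] at h
    exact (abs_le.2 h).trans_lt hpi
  have key := Complex.integral_boundary_rect_eq_zero_of_differentiableOn _ _ _ (hd.mono hsub)
  simp only [Complex.add_im, Complex.ofReal_im, Complex.mul_I_im, Complex.ofReal_re, zero_add,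
    Complex.add_re, Complex.mul_I_re, neg_zero, add_zero, smul_eq_mul] at key
  have hne {w : ℂ} (h : w ≠ x) := dslope_div_dslope_exp_of_ne (caseTwoProfile a) h
  have h1 (t : ℝ) : (t + (-π : ℝ) * I : ℂ) ≠ x := fun h => by
    have := congrArg Complex.im h
    simp [Real.pi_ne_zero] at this
  have h2 (t : ℝ) : (t + π * I : ℂ) ≠ x := fun h => by
    have := congrArg Complex.im h
    simp [Real.pi_ne_zero] at this
  have h3 (y : ℝ) : (R + y * I : ℂ) ≠ x := fun h => by
    have := congrArg Complex.re h
    simp at this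
    linarith [le_abs_self x]
  have h4 (y : ℝ) : ((-R : ℝ) + y * I : ℂ) ≠ x := fun h => by
    have := congrArg Complex.re h
    simp at this
    linarith [neg_abs_le x]
  simp only [hne (h1 _), hne (h2 _), hne (h3 _), hne (h4 _)] at key
  exact key

theorem one_add_sq_add_two_mul_cos_eq (θ s : ℝ) :
    1 + s ^ 2 + 2 * s * Real.cos θ = (1 + s * Real.cos θ) ^ 2 + (s * Real.sin θ) ^ 2 := by
  linear_combination (-s ^ 2) * Real.sin_sq_add_cos_sq θ

theorem one_add_sq_add_two_mul_cos_pos {θ : ℝ} (hθ : 0 < Real.sin θ) {s : ℝ} (hs : 0 < s) :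
    0 < 1 + s ^ 2 + 2 * s * Real.cos θ := by
  rw [one_add_sq_add_two_mul_cos_eq]
  positivity

/-- The density of the inverse Laplace transform in Case 2. -/
noncomputable def caseTwoDensity (θ s : ℝ) : ℝ :=
  (1 + s * Real.cos θ) / (1 + s ^ 2 + 2 * s * Real.cos θ) ^ 2

theorem measurable_caseTwoDensity (θ : ℝ) : Measurable (caseTwoDensity θ) := by
  unfold caseTwoDensity
  fun_prop

theorem one_sub_abs_cos_pos_s7 {θ : ℝ} (hθ : 0 < Real.sin θ) : 0 < 1 - |Real.cos θ| := by
  have h : |Real.cos θ| < 1 := by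
    rw [← sq_lt_one_iff_abs_lt_one]
    nlinarith [Real.sin_sq_add_cos_sq θ]
  linarith

theorem integrableOn_caseTwoDensity {θ : ℝ} (hθ : 0 < Real.sin θ) :
    IntegrableOn (caseTwoDensity θ) (Ioi 0) := by
  have hδ := one_sub_abs_cos_pos_s7 hθ
  set δ := 1 - |Real.cos θ| with hδ'
  refine (integrable_inv_one_add_sq.integrableOn.const_mul (2 / δ ^ 2)).mono'
    (measurable_caseTwoDensity θ).aestronglyMeasurable ?_
  filter_upwards [ae_restrict_mem measurableSet_Ioi] with s hs
  have hs : 0 < s := hs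
  have hD : δ * (1 + s ^ 2) ≤ 1 + s ^ 2 + 2 * s * Real.cos θ := by
    nlinarith [neg_abs_le (Real.cos θ), mul_nonneg (abs_nonneg (Real.cos θ)) (sq_nonneg (s - 1))]
  have hN : |1 + s * Real.cos θ| ≤ 2 * (1 + s ^ 2) := by
    rw [abs_le]
    constructor <;> nlinarith [Real.cos_le_one θ, Real.neg_one_le_cos θ, sq_nonneg (s - 1)]
  have hd : 0 < δ * (1 + s ^ 2) := by positivity
  rw [caseTwoDensity, norm_div, norm_pow, Real.norm_eq_abs, Real.norm_eq_abs, sq_abs]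
  calc _ ≤ 2 * (1 + s ^ 2) / (δ * (1 + s ^ 2)) ^ 2 := by gcongr
    _ = _ := by field_simp

theorem caseTwoKernel_sub_caseTwoKernel {a : ℝ} (hσ : 0 < Real.sin (a * π)) (x t : ℝ) :
    caseTwoKernel a x (t + (-π : ℝ) * I) - caseTwoKernel a x (t + π * I) =
      ((-4 * Real.sin (a * π) * (Real.exp (a * t) * (caseTwoDensity (a * π) (Real.exp (a * t)) /
        (Real.exp t + Real.exp x))) : ℝ) : ℂ) * I := by
  have hD := one_add_sq_add_two_mul_cos_pos hσ (Real.exp_pos (a * t))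
  have e1 : Complex.exp (t + (-π : ℝ) * I) = -(Real.exp t : ℂ) := by
    rw [Complex.exp_add, Complex.ofReal_neg, neg_mul, Complex.exp_neg, Complex.exp_pi_mul_I]
    push_cast; ring
  have e2 : Complex.exp (t + π * I) = -(Real.exp t : ℂ) := by
    rw [Complex.exp_add, Complex.exp_pi_mul_I]
    push_cast; ring
  have e3 : Complex.exp (a * (t + (-π : ℝ) * I)) =
      Real.exp (a * t) * (Real.cos (a * π) - Real.sin (a * π) * I) := by
    rw [show (a : ℂ) * (t + (-π : ℝ) * I) = (a * t : ℝ) + (-(a * π) : ℝ) * I by push_cast; ring,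
      Complex.exp_add, Complex.exp_mul_I, ← Complex.ofReal_exp, ← Complex.ofReal_cos,
      ← Complex.ofReal_sin, Real.cos_neg, Real.sin_neg]
    push_cast; ring
  have e4 : Complex.exp (a * (t + π * I)) =
      Real.exp (a * t) * (Real.cos (a * π) + Real.sin (a * π) * I) := by
    rw [show (a : ℂ) * (t + π * I) = (a * t : ℝ) + (a * π : ℝ) * I by push_cast; ring,
      Complex.exp_add, Complex.exp_mul_I, ← Complex.ofReal_exp, ← Complex.ofReal_cos,
      ← Complex.ofReal_sin]
  have hr : (Real.exp t : ℂ) + Real.exp x ≠ 0 := by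
    exact_mod_cast (add_pos (Real.exp_pos t) (Real.exp_pos x)).ne'
  simp only [caseTwoKernel, caseTwoProfile, caseTwoDensity, e1, e2, e3, e4, ← Complex.ofReal_exp x]
  generalize Real.exp (a * t) = s at *
  generalize Real.exp t = r at *
  generalize Real.exp x = z at *
  have hcs := Real.sin_sq_add_cos_sq (a * π)
  generalize Real.cos (a * π) = c at *
  generalize Real.sin (a * π) = σ at *
  have hcs' : (σ : ℂ) ^ 2 + (c : ℂ) ^ 2 = 1 := by exact_mod_cast hcs
  have hfac : (1 + s * (c - σ * I) : ℂ) * (1 + s * (c + σ * I)) = 1 + s ^ 2 + 2 * s * c := by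
    linear_combination s ^ 2 * hcs' - s ^ 2 * σ ^ 2 * Complex.I_sq
  have hD' : (1 + s ^ 2 + 2 * s * c : ℂ) ≠ 0 := by exact_mod_cast hD.ne'
  have hne := hD'
  rw [← hfac] at hne
  have hn1 := left_ne_zero_of_mul hne
  have hn2 := right_ne_zero_of_mul hne
  have hr' : (-r - z : ℂ) ≠ 0 := by
    rw [show (-r - z : ℂ) = -(r + z) by ring]; exact neg_ne_zero.2 hr
  push_cast
  rw [← hfac, ← sub_div, show (-r - z : ℂ) = -(r + z) by ring]
  field_simp
  ring
theorem image_univ_exp_mul {a : ℝ} (ha : 0 < a) :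
    (fun t : ℝ => Real.exp (a * t)) '' univ = Ioi 0 := by
  rw [image_univ]
  ext s
  refine ⟨?_, fun hs => ⟨Real.log s / a, ?_⟩⟩
  · rintro ⟨t, rfl⟩
    exact Real.exp_pos _
  · simp only [mul_div_cancel₀ _ ha.ne']
    exact Real.exp_log hs

theorem injOn_exp_mul {a : ℝ} (ha : 0 < a) : InjOn (fun t : ℝ => Real.exp (a * t)) univ :=
  fun _ _ _ _ h => mul_left_cancel₀ ha.ne' (Real.exp_injective h)

theorem hasDerivWithinAt_exp_mul (a t : ℝ) :
    HasDerivWithinAt (fun t : ℝ => Real.exp (a * t)) (a * Real.exp (a * t)) univ t := by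
  simpa [mul_comm] using ((hasDerivAt_id t).const_mul a).exp.hasDerivWithinAt (s := univ)

theorem integral_Ioi_eq_integral_exp_mul {a : ℝ} (ha : 0 < a) (g : ℝ → ℝ) :
    ∫ s in Ioi 0, g s = a * ∫ t : ℝ, Real.exp (a * t) * g (Real.exp (a * t)) := by
  rw [← image_univ_exp_mul ha, integral_image_eq_integral_abs_deriv_smul MeasurableSet.univ
    (fun t _ => hasDerivWithinAt_exp_mul a t) (injOn_exp_mul ha), setIntegral_univ,
    ← integral_const_mul]
  refine integral_congr_ae (Eventually.of_forall fun t => ?_)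
  simp only [abs_of_pos (mul_pos ha (Real.exp_pos _)), smul_eq_mul]
  ring

theorem integrable_exp_mul_comp {a : ℝ} (ha : 0 < a) {g : ℝ → ℝ} (hg : IntegrableOn g (Ioi 0)) :
    Integrable fun t : ℝ => Real.exp (a * t) * g (Real.exp (a * t)) := by
  rw [← image_univ_exp_mul ha, integrableOn_image_iff_integrableOn_abs_deriv_smul MeasurableSet.univ
    (fun t _ => hasDerivWithinAt_exp_mul a t) (injOn_exp_mul ha), integrableOn_univ] at hg
  refine (hg.const_mul a⁻¹).congr (Eventually.of_forall fun t => ?_)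
  simp only [abs_of_pos (mul_pos ha (Real.exp_pos _)), smul_eq_mul]
  field_simp

theorem continuous_caseTwoKernel_horizontal {a : ℝ} (ha : 0 < a) (ha1 : a < 1) (x : ℝ) {η : ℝ}
    (hη : |η| = π) : Continuous fun t : ℝ => caseTwoKernel a x (t + η * I) := by
  have h1 (t : ℝ) : 1 + Complex.exp (a * (t + η * I)) ≠ 0 := by
    refine one_add_exp_ne_zero_of_abs_im_lt_pi ?_
    simp only [Complex.im_ofReal_mul, Complex.add_im, Complex.ofReal_im, Complex.mul_I_im,
      Complex.ofReal_re, zero_add, abs_mul, abs_of_pos ha, hη]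
    nlinarith [Real.pi_pos]
  have h2 (t : ℝ) : Complex.exp (t + η * I) - Complex.exp x ≠ 0 := by
    rw [sub_ne_zero]
    intro h
    have h3 := congrArg Complex.im (eq_of_exp_eq_exp_of_abs_im_lt
      (by simp [hη, Real.pi_pos]) h)
    have h4 : η = 0 := by simpa using h3
    rw [h4, abs_zero] at hη
    exact Real.pi_ne_zero hη.symm
  unfold caseTwoKernel caseTwoProfile
  refine Continuous.div (Continuous.sub (Continuous.inv₀ (by fun_prop) fun t => ?_)
    continuous_const) (by fun_prop) h2
  exact pow_ne_zero 2 (h1 t)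

theorem integrableOn_caseTwoDensity_div {a z : ℝ} (hσ : 0 < Real.sin (a * π)) (hz : 0 < z) :
    IntegrableOn (fun s => caseTwoDensity (a * π) s / (s ^ a⁻¹ + z)) (Ioi 0) := by
  refine ((integrableOn_caseTwoDensity hσ).norm.mul_const z⁻¹).mono'
    ((measurable_caseTwoDensity _).div (by fun_prop)).aestronglyMeasurable ?_
  filter_upwards [ae_restrict_mem measurableSet_Ioi] with s hs
  have hs : 0 < s := hs
  have h : 0 ≤ s ^ a⁻¹ := by positivity
  rw [norm_div, div_eq_mul_inv, Real.norm_of_nonneg (by positivity : 0 ≤ s ^ a⁻¹ + z)]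
  gcongr
  linarith

/-- The Stieltjes transform of the density, obtained by Cauchy's theorem on the rectangles
`[-R, R] × [-π, π]` in the logarithmic variable. -/
theorem integral_caseTwoDensity_div {a z : ℝ} (ha : 0 < a) (ha1 : a < 1) (hz : 0 < z) :
    2 * Real.sin (a * π) / (a * π) *
      ∫ s in Ioi 0, caseTwoDensity (a * π) s / (s ^ a⁻¹ + z) =
        (1 - ((1 + z ^ a) ^ 2)⁻¹) / z := by
  have hσ : 0 < Real.sin (a * π) :=
    Real.sin_pos_of_pos_of_lt_pi (by positivity) (by nlinarith [Real.pi_pos])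
  obtain ⟨x, rfl⟩ : ∃ x, Real.exp x = z := ⟨_, Real.exp_log hz⟩
  have hpow (t : ℝ) : Real.exp (a * t) ^ a⁻¹ = Real.exp t := by
    rw [← Real.exp_mul, mul_right_comm, mul_inv_cancel₀ ha.ne', one_mul]
  have hint := integrable_exp_mul_comp ha (integrableOn_caseTwoDensity_div hσ hz)
  have hcv := integral_Ioi_eq_integral_exp_mul ha
    fun s => caseTwoDensity (a * π) s / (s ^ a⁻¹ + Real.exp x)
  simp only [hpow] at hint hcv
  have hbox : ∀ᶠ R : ℝ in atTop,
      ((∫ t in -R..R, -4 * Real.sin (a * π) * (Real.exp (a * t) *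
        (caseTwoDensity (a * π) (Real.exp (a * t)) / (Real.exp t + Real.exp x))) : ℝ) : ℂ) * I +
      I * (∫ y in -π..π, caseTwoKernel a x (R + y * I)) -
      I * (∫ y in -π..π, caseTwoKernel a x ((-R : ℝ) + y * I)) = 0 := by
    filter_upwards [eventually_gt_atTop |x|] with R hR
    rw [← integral_boundary_caseTwoKernel ha ha1 hR, ← intervalIntegral.integral_sub
      ((continuous_caseTwoKernel_horizontal ha ha1 x
        (by rw [abs_neg, abs_of_pos Real.pi_pos])).intervalIntegrable _ _)
      ((continuous_caseTwoKernel_horizontal ha ha1 x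
        (abs_of_pos Real.pi_pos)).intervalIntegrable _ _)]
    simp only [caseTwoKernel_sub_caseTwoKernel hσ, intervalIntegral.integral_mul_const,
      intervalIntegral.integral_ofReal]
  have hH := (Complex.continuous_ofReal.tendsto _).comp (intervalIntegral_tendsto_integral
    (hint.const_mul (-4 * Real.sin (a * π))) tendsto_neg_atTop_atBot tendsto_id)
  have hT := tendsto_integral_vertical (measurable_caseTwoKernel a x)
    (tendsto_caseTwoKernel_atTop ha x) (-π) π
  have hB := (tendsto_integral_vertical (measurable_caseTwoKernel a x)
    (tendsto_caseTwoKernel_atBot ha x) (-π) π).comp tendsto_neg_atTop_atBot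
  have hlim := ((hH.mul_const I).add (hT.const_mul I)).sub (hB.const_mul I)
  have hzero := tendsto_nhds_unique (hlim.congr' hbox) tendsto_const_nhds
  have hprof : caseTwoProfile a x = (((1 + Real.exp x ^ a) ^ 2)⁻¹ : ℝ) := by
    rw [caseTwoProfile, ← Real.exp_mul, mul_comm x a]
    push_cast; rfl
  rw [hcv]
  rw [integral_const_mul, hprof, ← Complex.ofReal_exp] at hzero
  simp only [intervalIntegral.integral_const, smul_zero, mul_zero, add_zero] at hzero
  generalize (∫ t : ℝ, Real.exp (a * t) * _) = J at *
  generalize ((1 + Real.exp x ^ a) ^ 2)⁻¹ = q at *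
  have hre : -4 * Real.sin (a * π) * J + 2 * π * ((1 - q) / Real.exp x) = 0 := by
    have := congrArg Complex.im hzero
    rw [show (1 - (q : ℂ)) / (0 - (Real.exp x : ℂ)) = ((-((1 - q) / Real.exp x) : ℝ) : ℂ) by
      push_cast; rw [zero_sub, div_neg]] at this
    simp [-Complex.ofReal_exp, -Complex.ofReal_neg, -Complex.ofReal_div] at this
    linarith
  have hpi := Real.pi_pos
  field_simp at hre ⊢
  linarith

/-- Fubini: the Laplace transform of the profile is the Stieltjes transform of its density. -/
theorem integral_caseTwo_laplace {a z C : ℝ} (hσ : 0 < Real.sin (a * π)) (hz : 0 < z) :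
    ∫ x in Ioi (0 : ℝ), (C * ∫ s in Ioi (0 : ℝ),
      caseTwoDensity (a * π) s * Real.exp (-(x * s ^ a⁻¹))) * Real.exp (-(z * x)) =
    C * ∫ s in Ioi (0 : ℝ), caseTwoDensity (a * π) s / (s ^ a⁻¹ + z) := by
  have hexp : IntegrableOn (fun x : ℝ => Real.exp (-(z * x))) (Ioi 0) := by
    simpa only [neg_mul] using integrableOn_exp_mul_Ioi (neg_lt_zero.2 hz) 0
  have hprod : Integrable (Function.uncurry fun x s : ℝ =>
      Real.exp (-(z * x)) * (caseTwoDensity (a * π) s * Real.exp (-(x * s ^ a⁻¹))))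
      ((volume.restrict (Ioi 0)).prod (volume.restrict (Ioi 0))) := by
    refine (hexp.mul_prod (integrableOn_caseTwoDensity hσ)).mono
      (Measurable.aestronglyMeasurable ?_) ?_
    · have := measurable_caseTwoDensity (a * π)
      unfold Function.uncurry
      fun_prop
    · rw [Measure.prod_restrict]
      filter_upwards [ae_restrict_mem (measurableSet_Ioi.prod measurableSet_Ioi)] with q hq
      have h1 : 0 < q.1 := hq.1
      have h2 : 0 < q.2 := hq.2
      have h3 : Real.exp (-(q.1 * q.2 ^ a⁻¹)) ≤ 1 :=
        Real.exp_le_one_iff.2 (neg_nonpos.2 (by positivity))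
      simp only [Function.uncurry, norm_mul, Real.norm_of_nonneg (Real.exp_pos _).le]
      gcongr
      exact mul_le_of_le_one_right (norm_nonneg _) h3
  have hswap := integral_integral_swap hprod
  simp only [integral_const_mul] at hswap
  simp only [mul_assoc, integral_const_mul]
  simp only [mul_comm _ (Real.exp (-(z * _)))]
  rw [hswap]
  congr 1
  refine setIntegral_congr_fun measurableSet_Ioi fun s hs => ?_
  have hs : 0 < s := hs
  have hpos : 0 < s ^ a⁻¹ + z := by positivity
  have h := integral_exp_mul_Ioi (neg_lt_zero.2 hpos) 0
  have hfun : (fun x : ℝ => Real.exp (-(z * x)) *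
      (caseTwoDensity (a * π) s * Real.exp (-(x * s ^ a⁻¹)))) =
      fun x => caseTwoDensity (a * π) s * Real.exp (-(s ^ a⁻¹ + z) * x) := by
    funext x
    rw [mul_left_comm, ← Real.exp_add]
    ring_nf
  simp only [hfun, integral_const_mul, h, mul_zero, Real.exp_zero, neg_div_neg_eq, mul_one_div]

end LaplaceInversion

/-- The explicit inverse Laplace transform for Case 2: for `0 < p < 2`, the profile
`ψ₂(x) = (4 sin(pπ/2)/(pπ)) ∫₀^∞ (1+s cos(pπ/2))/(1+s²+2s cos(pπ/2))² e^{-x s^{2/p}} ds`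
satisfies `∫₀^∞ ψ₂(x) e^{-zx} dx = (1/z)(1 - (1+z^{p/2})^{-2})` for every `z > 0`. -/
theorem stmt7 (p : ℝ) (hp : 0 < p) (hp2 : p < 2)
    (ψ₂ : ℝ → ℝ)
    (hψ₂ : ∀ x : ℝ, 0 ≤ x →
      ψ₂ x = (4 * Real.sin (p * Real.pi / 2) / (p * Real.pi)) *
        ∫ s in Set.Ioi (0 : ℝ),
          (1 + s * Real.cos (p * Real.pi / 2))
            / (1 + s ^ 2 + 2 * s * Real.cos (p * Real.pi / 2)) ^ 2
            * Real.exp (-(x * s ^ (2 / p)))) :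
    ∀ z : ℝ, 0 < z →
      (∫ x in Set.Ioi (0 : ℝ), ψ₂ x * Real.exp (-(z * x)))
        = (1 / z) * (1 - (1 + z ^ (p / 2)) ^ (-2 : ℤ)) := by
  intro z hz
  obtain ⟨a, rfl⟩ : ∃ a, p = 2 * a := ⟨p / 2, by ring⟩
  have ha : 0 < a := by linarith
  have ha1 : a < 1 := by linarith
  have hσ : 0 < Real.sin (a * π) :=
    Real.sin_pos_of_pos_of_lt_pi (by positivity) (by nlinarith [Real.pi_pos])
  have e1 : 2 * a * π / 2 = a * π := by ring
  have e2 : 2 / (2 * a) = a⁻¹ := by field_simp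
  have e3 : 2 * a / 2 = a := by ring
  have e4 : 4 * Real.sin (a * π) / (2 * a * π) = 2 * Real.sin (a * π) / (a * π) := by
    field_simp; ring
  simp only [e1, e2, e4] at hψ₂
  rw [e3, setIntegral_congr_fun measurableSet_Ioi fun x hx => by rw [hψ₂ x (le_of_lt hx)]]
  have h := integral_caseTwo_laplace (C := 2 * Real.sin (a * π) / (a * π)) hσ hz
  rw [integral_caseTwoDensity_div ha ha1 hz] at h
  refine h.trans ?_
  rw [zpow_neg, one_div_mul_eq_div]
  norm_cast
end

section
/- Let 0 < p ≤ 1, let F(v) = (4 sin(pπ/2)/(pπ)) ∫₀^∞ (1 + s cos(pπ/2)) / (1 + s² + 2s cos(pπ/2))² · (2π s^{2/p})^{-3/2} e^{-|v|²/(2 s^{2/p})} ds for v ∈ ℝ³, and let ψ₂(x) = (4 sin(pπ/2)/(pπ)) ∫₀^∞ (1 + s cos(pπ/2)) / (1 + s² + 2s cos(pπ/2))² e^{-x s^{2/p}} ds for x ≥ 0. Then F is integrable on ℝ³ and for every k ∈ ℝ³, ∫_{ℝ³} F(v) e^{-i k·v} dv = ψ₂(|k|²/2). -/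
open Real MeasureTheory
open scoped RealInnerProductSpace

/-- The centred Maxwellian of temperature `T` on `ℝ³`. -/
noncomputable def maxwellian (T : ℝ) (v : EuclideanSpace ℝ (Fin 3)) : ℝ :=
  (2 * π * T) ^ (-(3 / 2) : ℝ) * Real.exp (-(‖v‖ ^ 2 / (2 * T)))

lemma maxwellian_nonneg {T : ℝ} (hT : 0 < T) (v : EuclideanSpace ℝ (Fin 3)) :
    0 ≤ maxwellian T v := by
  unfold maxwellian
  positivity

lemma measurable_maxwellian_uncurry :
    Measurable fun z : EuclideanSpace ℝ (Fin 3) × ℝ => maxwellian z.2 z.1 := by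
  unfold maxwellian
  fun_prop

lemma maxwellian_mul_cexp (T : ℝ) (k v : EuclideanSpace ℝ (Fin 3)) :
    (maxwellian T v : ℂ) * Complex.exp (-(Complex.I * (⟪k, v⟫ : ℝ))) =
      (((2 * π * T) ^ (-(3 / 2) : ℝ) : ℝ) : ℂ) *
        Complex.exp (-((1 / (2 * T) : ℝ) : ℂ) * (‖v‖ : ℂ) ^ 2 + -Complex.I * (⟪k, v⟫ : ℝ)) := by
  rw [maxwellian, Complex.ofReal_mul, mul_assoc, Complex.ofReal_exp, ← Complex.exp_add]
  congr 2
  push_cast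
  ring

lemma integral_maxwellian_mul_cexp {T : ℝ} (hT : 0 < T) (k : EuclideanSpace ℝ (Fin 3)) :
    ∫ v, (maxwellian T v : ℂ) * Complex.exp (-(Complex.I * (⟪k, v⟫ : ℝ))) =
      (Real.exp (-(‖k‖ ^ 2 / 2 * T)) : ℂ) := by
  have hb : 0 < (((1 / (2 * T) : ℝ)) : ℂ).re := by
    rw [Complex.ofReal_re]
    positivity
  simp_rw [maxwellian_mul_cexp]
  rw [integral_const_mul, GaussianFourier.integral_cexp_neg_mul_sq_norm_add hb, ← mul_assoc]
  have hpow : ((π : ℂ) / ((1 / (2 * T) : ℝ) : ℂ)) ^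
      ((Module.finrank ℝ (EuclideanSpace ℝ (Fin 3)) : ℂ) / 2) =
        (((2 * π * T) ^ (3 / 2 : ℝ) : ℝ) : ℂ) := by
    rw [Complex.ofReal_cpow (by positivity), finrank_euclideanSpace_fin]
    congr 1
    · push_cast
      field_simp
    · push_cast
      rfl
  rw [hpow, ← Complex.ofReal_mul, ← Real.rpow_add (by positivity), neg_add_cancel,
    Real.rpow_zero, Complex.ofReal_one, one_mul, Complex.ofReal_exp]
  congr 1
  have hT' : (T : ℂ) ≠ 0 := by exact_mod_cast hT.ne'
  push_cast
  rw [neg_sq, Complex.I_sq]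
  field_simp
  ring

lemma integrable_maxwellian {T : ℝ} (hT : 0 < T) : Integrable (maxwellian T) := by
  have hb : 0 < (((1 / (2 * T) : ℝ)) : ℂ).re := by
    rw [Complex.ofReal_re]
    positivity
  have h := ((GaussianFourier.integrable_cexp_neg_mul_sq_norm_add hb (-Complex.I)
    (0 : EuclideanSpace ℝ (Fin 3))).const_mul
      (((2 * π * T) ^ (-(3 / 2) : ℝ) : ℝ) : ℂ))
  simp_rw [← maxwellian_mul_cexp] at h
  simpa using h.re

lemma integral_maxwellian {T : ℝ} (hT : 0 < T) : ∫ v, maxwellian T v = 1 := by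
  have h := integral_maxwellian_mul_cexp hT 0
  simp only [inner_zero_left, Complex.ofReal_zero, mul_zero, neg_zero, Complex.exp_zero, mul_one,
    integral_complex_ofReal] at h
  simpa using h

section Mixture

variable {α : Type*} [MeasurableSpace α] {ν : Measure α} [SFinite ν] {w T : α → ℝ}

lemma integrable_maxwellian_mixture_prod (hw : Integrable w ν) (hT : Measurable T)
    (hpos : ∀ᵐ s ∂ν, 0 < T s) :
    Integrable (fun z : EuclideanSpace ℝ (Fin 3) × α => w z.2 * maxwellian (T z.2) z.1)
      (volume.prod ν) := by
  have hmeas : Measurable fun z : EuclideanSpace ℝ (Fin 3) × α => maxwellian (T z.2) z.1 :=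
    measurable_maxwellian_uncurry.comp (measurable_fst.prodMk (hT.comp measurable_snd))
  have hprod : AEStronglyMeasurable (fun z : EuclideanSpace ℝ (Fin 3) × α =>
      w z.2 * maxwellian (T z.2) z.1) (volume.prod ν) :=
    hw.aestronglyMeasurable.comp_snd.mul hmeas.aestronglyMeasurable
  refine (integrable_prod_iff' hprod).2 ⟨?_, hw.norm.congr ?_⟩
  · filter_upwards [hpos] with s hs
    exact (integrable_maxwellian hs).const_mul _
  · filter_upwards [hpos] with s hs
    simp_rw [norm_mul, Real.norm_of_nonneg (maxwellian_nonneg hs _)]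
    rw [integral_const_mul, integral_maxwellian hs, mul_one]

lemma integrable_maxwellian_mixture (hw : Integrable w ν) (hT : Measurable T)
    (hpos : ∀ᵐ s ∂ν, 0 < T s) :
    Integrable fun v => ∫ s, w s * maxwellian (T s) v ∂ν :=
  (integrable_maxwellian_mixture_prod hw hT hpos).integral_prod_left

lemma integral_maxwellian_mixture_mul_cexp (hw : Integrable w ν) (hT : Measurable T)
    (hpos : ∀ᵐ s ∂ν, 0 < T s) (k : EuclideanSpace ℝ (Fin 3)) :
    ∫ v, ((∫ s, w s * maxwellian (T s) v ∂ν : ℝ) : ℂ) *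
        Complex.exp (-(Complex.I * (⟪k, v⟫ : ℝ))) =
      ((∫ s, w s * Real.exp (-(‖k‖ ^ 2 / 2 * T s)) ∂ν : ℝ) : ℂ) := by
  have hint : Integrable (Function.uncurry fun (v : EuclideanSpace ℝ (Fin 3)) (s : α) =>
      ((w s * maxwellian (T s) v : ℝ) : ℂ) * Complex.exp (-(Complex.I * (⟪k, v⟫ : ℝ))))
      (volume.prod ν) := by
    refine (integrable_maxwellian_mixture_prod hw hT hpos).ofReal.mul_bdd (c := 1) ?_ ?_
    · exact Measurable.aestronglyMeasurable (by fun_prop)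
    · refine .of_forall fun z => le_of_eq ?_
      rw [Complex.norm_exp]
      simp
  simp_rw [← integral_complex_ofReal, ← integral_mul_const]
  rw [integral_integral_swap hint]
  refine integral_congr_ae ?_
  filter_upwards [hpos] with s hs
  simp_rw [Complex.ofReal_mul, mul_assoc]
  rw [integral_const_mul, integral_maxwellian_mul_cexp hs]

end Mixture

lemma integrableOn_mixture_weight {c : ℝ} (hc : 0 ≤ c) :
    IntegrableOn (fun s : ℝ => (1 + s * c) / (1 + s ^ 2 + 2 * s * c) ^ 2) (Set.Ioi 0) := by
  refine integrable_inv_one_add_sq.integrableOn.mono'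
    (Measurable.aestronglyMeasurable (by fun_prop)) ?_
  filter_upwards [ae_restrict_mem measurableSet_Ioi] with s hs
  have hs : 0 < s := hs
  have hsc : 0 ≤ s * c := by positivity
  rw [Real.norm_of_nonneg (by positivity), div_le_iff₀ (by positivity), inv_mul_eq_div,
    le_div_iff₀ (by positivity), sq (1 + s ^ 2 + 2 * s * c)]
  exact mul_le_mul (by nlinarith [sq_nonneg s]) (by nlinarith) (by positivity) (by positivity)

/-- The Case 2 self-similar distribution `F`, a mixture of Maxwellians, is integrable
and its Fourier transform is `ψ₂(|k|²/2)`. -/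
theorem stmt10 (p : ℝ) (hp : 0 < p) (hp1 : p ≤ 1)
    (F : EuclideanSpace ℝ (Fin 3) → ℝ)
    (hF : ∀ v : EuclideanSpace ℝ (Fin 3),
      F v = (4 * Real.sin (p * Real.pi / 2) / (p * Real.pi)) *
        ∫ s in Set.Ioi (0 : ℝ),
          (1 + s * Real.cos (p * Real.pi / 2))
            / (1 + s ^ 2 + 2 * s * Real.cos (p * Real.pi / 2)) ^ 2
            * ((2 * Real.pi * s ^ (2 / p)) ^ (-(3 / 2) : ℝ)
              * Real.exp (-(‖v‖ ^ 2 / (2 * s ^ (2 / p))))))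
    (ψ₂ : ℝ → ℝ)
    (hψ₂ : ∀ x : ℝ, 0 ≤ x →
      ψ₂ x = (4 * Real.sin (p * Real.pi / 2) / (p * Real.pi)) *
        ∫ s in Set.Ioi (0 : ℝ),
          (1 + s * Real.cos (p * Real.pi / 2))
            / (1 + s ^ 2 + 2 * s * Real.cos (p * Real.pi / 2)) ^ 2
            * Real.exp (-(x * s ^ (2 / p)))) :
    Integrable F ∧
    ∀ k : EuclideanSpace ℝ (Fin 3),
      (∫ v : EuclideanSpace ℝ (Fin 3),
          (F v : ℂ) * Complex.exp (-(Complex.I * (⟪k, v⟫ : ℝ))))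
        = (ψ₂ (‖k‖ ^ 2 / 2) : ℂ) := by
  have hc : 0 ≤ Real.cos (p * π / 2) :=
    Real.cos_nonneg_of_neg_pi_div_two_le_of_le (by nlinarith [Real.pi_pos])
      (by nlinarith [Real.pi_pos])
  have hw := integrableOn_mixture_weight hc
  have hT : Measurable fun s : ℝ => s ^ (2 / p) := by fun_prop
  have hpos : ∀ᵐ s ∂(volume.restrict (Set.Ioi (0 : ℝ))), 0 < s ^ (2 / p) := by
    filter_upwards [ae_restrict_mem measurableSet_Ioi] with s hs
    exact Real.rpow_pos_of_pos hs _
  obtain rfl : F = fun v => 4 * Real.sin (p * π / 2) / (p * π) * ∫ s in Set.Ioi (0 : ℝ),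
      (1 + s * Real.cos (p * π / 2)) / (1 + s ^ 2 + 2 * s * Real.cos (p * π / 2)) ^ 2 *
        maxwellian (s ^ (2 / p)) v := funext hF
  refine ⟨(integrable_maxwellian_mixture hw hT hpos).const_mul _, fun k => ?_⟩
  rw [hψ₂ _ (by positivity), Complex.ofReal_mul,
    ← integral_maxwellian_mixture_mul_cexp hw hT hpos, ← integral_const_mul]
  simp only [Complex.ofReal_mul, mul_assoc]
end

section
/- Let 0 < p < 2 and let ψ₂(x) = (4 sin(pπ/2)/(pπ)) ∫₀^∞ (1 + s cos(pπ/2)) / (1 + s² + 2s cos(pπ/2))² e^{-x s^{2/p}} ds for x ≥ 0. Then lim_{x→0⁺} (1 - ψ₂(x))/x^p = 1/Γ(p+1). -/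
open Real MeasureTheory Filter

theorem integrableOn_Ioi_zero_of_norm_le_rpow {E : Type*} [NormedAddCommGroup E] {g : ℝ → E}
    {a b C : ℝ} (ha : -1 < a) (hb : b < -1) (hg : ContinuousOn g (Set.Ioi 0))
    (hga : ∀ t, 0 < t → ‖g t‖ ≤ C * t ^ a) (hgb : ∀ t, 0 < t → ‖g t‖ ≤ C * t ^ b) :
    IntegrableOn g (Set.Ioi 0) := by
  rw [← Set.Ioc_union_Ioi_eq_Ioi (zero_le_one' ℝ)]
  have h₁ : IntegrableOn (fun t : ℝ => C * t ^ a) (Set.Ioc 0 1) :=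
    ((intervalIntegrable_iff_integrableOn_Ioc_of_le zero_le_one).mp
      (intervalIntegral.intervalIntegrable_rpow' ha)).const_mul C
  have h₂ : IntegrableOn (fun t : ℝ => C * t ^ b) (Set.Ioi 1) :=
    (integrableOn_Ioi_rpow_of_lt hb zero_lt_one).const_mul C
  refine IntegrableOn.union (h₁.mono' ?_ ?_) (h₂.mono' ?_ ?_)
  · exact (hg.mono Set.Ioc_subset_Ioi_self).aestronglyMeasurable measurableSet_Ioc
  · exact (ae_restrict_iff' measurableSet_Ioc).mpr (ae_of_all _ fun t ht => hga t ht.1)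
  · exact (hg.mono (Set.Ioi_subset_Ioi zero_le_one)).aestronglyMeasurable measurableSet_Ioi
  · exact (ae_restrict_iff' measurableSet_Ioi).mpr
      (ae_of_all _ fun t ht => hgb t (zero_lt_one.trans ht))

/-- A function on `(0, ∞)` dominated by two powers of opposite signs has limit zero at both
ends. -/
theorem tendsto_zero_of_norm_le_rpow {E : Type*} [NormedAddCommGroup E] {g : ℝ → E}
    {a b C : ℝ} (ha : 0 < a) (hb : b < 0) (hga : ∀ t, 0 < t → ‖g t‖ ≤ C * t ^ a)
    (hgb : ∀ t, 0 < t → ‖g t‖ ≤ C * t ^ b) :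
    Tendsto g (nhdsWithin 0 (Set.Ioi 0)) (nhds 0) ∧ Tendsto g atTop (nhds 0) := by
  constructor
  · have h : Tendsto (fun t : ℝ => C * t ^ a) (nhdsWithin 0 (Set.Ioi 0)) (nhds 0) := by
      have := ((Real.continuousAt_rpow_const 0 a (Or.inr ha.le)).tendsto.const_mul C)
      rw [Real.zero_rpow ha.ne', mul_zero] at this
      exact this.mono_left nhdsWithin_le_nhds
    refine squeeze_zero_norm' ?_ h
    filter_upwards [self_mem_nhdsWithin] with t ht using hga t ht
  · have h : Tendsto (fun t : ℝ => C * t ^ b) atTop (nhds 0) := by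
      simpa using (tendsto_rpow_neg_atTop (neg_pos.mpr hb)).const_mul C
    refine squeeze_zero_norm' ?_ h
    filter_upwards [eventually_gt_atTop 0] with t ht using hgb t ht

theorem integral_rpow_mul_eq_of_hasDerivAt {σ u v : ℝ} {h h' : ℝ → ℝ} (hσ : 0 < σ) (hu : σ < u)
    (hv : v < σ) (hd : ∀ r, 0 < r → HasDerivAt h (h' r) r) (hbu : ∀ r, 0 < r → |h r| ≤ r ^ u)
    (hbv : ∀ r, 0 < r → |h r| ≤ r ^ v)
    (hi : IntegrableOn (fun r => r ^ (-σ) * h' r) (Set.Ioi 0)) :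
    IntegrableOn (fun r => r ^ (-σ - 1) * h r) (Set.Ioi 0) ∧
      ∫ r in Set.Ioi (0 : ℝ), r ^ (-σ - 1) * h r
        = σ⁻¹ * ∫ r in Set.Ioi (0 : ℝ), r ^ (-σ) * h' r := by
  have hbound : ∀ τ w : ℝ, (∀ r, 0 < r → |h r| ≤ r ^ w) →
      ∀ r, 0 < r → ‖r ^ τ * h r‖ ≤ r ^ (τ + w) := by
    intro τ w hw r hr
    rw [norm_mul, Real.norm_of_nonneg (rpow_nonneg hr.le _), rpow_add hr]
    exact mul_le_mul_of_nonneg_left (hw r hr) (rpow_nonneg hr.le _)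
  have hc : ContinuousOn (fun r => r ^ (-σ - 1) * h r) (Set.Ioi 0) := fun r hr =>
    ((Real.continuousAt_rpow_const r _ (Or.inl (ne_of_gt hr))).mul
      (hd r hr).continuousAt).continuousWithinAt
  have hint : IntegrableOn (fun r => r ^ (-σ - 1) * h r) (Set.Ioi 0) := by
    refine integrableOn_Ioi_zero_of_norm_le_rpow (a := -σ - 1 + u) (b := -σ - 1 + v) (C := 1)
      (by linarith) (by linarith) hc ?_ ?_
    · simpa using hbound _ _ hbu
    · simpa using hbound _ _ hbv
  refine ⟨hint, ?_⟩
  obtain ⟨h0, htop⟩ := tendsto_zero_of_norm_le_rpow (g := fun r => r ^ (-σ) * h r)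
    (a := -σ + u) (b := -σ + v) (C := 1) (by linarith) (by linarith)
    (by simpa using hbound _ _ hbu) (by simpa using hbound _ _ hbv)
  have hderiv : ∀ r ∈ Set.Ioi (0 : ℝ), HasDerivAt (fun r => r ^ (-σ) * h r)
      (r ^ (-σ) * h' r - σ * (r ^ (-σ - 1) * h r)) r := by
    intro r hr
    have := (Real.hasDerivAt_rpow_const (p := -σ) (Or.inl (ne_of_gt hr))).mul (hd r hr)
    convert! this using 1
    ring
  have key := integral_Ioi_of_hasDerivAt_of_tendsto (a := 0) (m := 0)
    (f := fun r => r ^ (-σ) * h r) ?_ hderiv (hi.sub (hint.const_mul σ)) htop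
  · rw [integral_sub hi (hint.const_mul σ), integral_const_mul] at key
    simp only [Real.zero_rpow (neg_ne_zero.mpr hσ.ne'), zero_mul, sub_zero] at key
    field_simp
    linarith
  · rw [← continuousWithinAt_Ioi_iff_Ici]
    simpa [ContinuousWithinAt, Real.zero_rpow (neg_ne_zero.mpr hσ.ne')] using h0

theorem abs_one_sub_exp_neg_le {y : ℝ} (hy : 0 ≤ y) : |1 - exp (-y)| ≤ y := by
  rw [abs_of_nonneg (by simpa using hy)]
  linarith [one_sub_le_exp_neg y]

theorem abs_one_sub_exp_neg_le_one {y : ℝ} (hy : 0 ≤ y) : |1 - exp (-y)| ≤ 1 := by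
  rw [abs_of_nonneg (by simpa using hy)]
  linarith [exp_pos (-y)]

theorem abs_one_sub_sub_exp_neg_le {y : ℝ} (hy : 0 ≤ y) : |1 - y - exp (-y)| ≤ y := by
  rw [abs_le]
  constructor
  · have : exp (-y) ≤ 1 := by simpa using hy
    linarith
  · linarith [one_sub_le_exp_neg y]

theorem abs_one_sub_sub_exp_neg_le_sq {y : ℝ} (hy : 0 ≤ y) :
    |1 - y - exp (-y)| ≤ y ^ 2 := by
  rcases le_total y 1 with h | h
  · have := abs_exp_sub_one_sub_id_le (x := -y) (by rwa [abs_neg, abs_of_nonneg hy])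
    rw [← abs_neg]
    convert! this using 1 <;> ring_nf
  · exact (abs_one_sub_sub_exp_neg_le hy).trans (by nlinarith)

theorem hasDerivAt_exp_neg_rpow (w : ℝ) {r : ℝ} (hr : 0 < r) :
    HasDerivAt (fun r : ℝ => exp (-r ^ w)) (-(w * r ^ (w - 1) * exp (-r ^ w))) r := by
  have := (Real.hasDerivAt_rpow_const (p := w) (Or.inl hr.ne')).neg.exp
  convert! this using 1
  simp only [Pi.neg_apply]
  ring

theorem integral_rpow_mul_one_sub_exp_neg_rpow {σ w : ℝ} (hσ : 0 < σ) (hw : σ < w) :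
    IntegrableOn (fun r : ℝ => r ^ (-σ - 1) * (1 - exp (-r ^ w))) (Set.Ioi 0) ∧
      ∫ r in Set.Ioi (0 : ℝ), r ^ (-σ - 1) * (1 - exp (-r ^ w))
        = σ⁻¹ * Gamma ((w - σ) / w) := by
  have hw0 : 0 < w := hσ.trans hw
  have hEq : Set.EqOn (fun r : ℝ => w * (r ^ (w - σ - 1) * exp (-r ^ w)))
      (fun r => r ^ (-σ) * (w * r ^ (w - 1) * exp (-r ^ w))) (Set.Ioi 0) := by
    intro r hr
    have : r ^ (w - σ - 1) = r ^ (-σ) * r ^ (w - 1) := by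
      rw [← rpow_add hr]; congr 1; ring
    simp only [this]; ring
  have hI := (integrableOn_rpow_mul_exp_neg_rpow (s := w - σ - 1) (p := w)
    (by linarith) (by linarith)).const_mul w
  have key := integral_rpow_mul_eq_of_hasDerivAt (h := fun r => 1 - exp (-r ^ w))
    (h' := fun r => w * r ^ (w - 1) * exp (-r ^ w)) (u := w) (v := 0) hσ hw hσ ?_ ?_ ?_ ?_
  · refine ⟨key.1, key.2.trans ?_⟩
    rw [← setIntegral_congr_fun measurableSet_Ioi hEq, integral_const_mul,
      integral_rpow_mul_exp_neg_rpow hw0 (by linarith)]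
    rw [sub_add_cancel]
    field_simp
  · intro r hr
    simpa using (hasDerivAt_exp_neg_rpow w hr).const_sub 1
  · intro r hr
    exact abs_one_sub_exp_neg_le (rpow_nonneg hr.le _)
  · intro r hr
    simpa using abs_one_sub_exp_neg_le_one (rpow_nonneg hr.le _)
  · exact IntegrableOn.congr_fun hI hEq measurableSet_Ioi

theorem integral_rpow_mul_one_sub_sub_exp_neg_rpow {σ w : ℝ} (hw : w < σ)
    (hw2 : σ < 2 * w) :
    IntegrableOn (fun r : ℝ => r ^ (-σ - 1) * (1 - r ^ w - exp (-r ^ w))) (Set.Ioi 0) ∧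
      ∫ r in Set.Ioi (0 : ℝ), r ^ (-σ - 1) * (1 - r ^ w - exp (-r ^ w))
        = σ⁻¹ * Gamma ((w - σ) / w) := by
  have hw0 : 0 < w := by linarith
  have hEq : Set.EqOn (fun r : ℝ => -w * (r ^ (-(σ - w) - 1) * (1 - exp (-r ^ w))))
      (fun r => r ^ (-σ) * (-w * r ^ (w - 1) * (1 - exp (-r ^ w)))) (Set.Ioi 0) := by
    intro r hr
    have : r ^ (-(σ - w) - 1) = r ^ (-σ) * r ^ (w - 1) := by
      rw [← rpow_add hr]; congr 1; ring
    simp only [this]; ring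
  obtain ⟨hI, hV⟩ := integral_rpow_mul_one_sub_exp_neg_rpow (σ := σ - w) (w := w)
    (by linarith) (by linarith)
  have key := integral_rpow_mul_eq_of_hasDerivAt (σ := σ)
    (h := fun r => 1 - r ^ w - exp (-r ^ w))
    (h' := fun r => -w * r ^ (w - 1) * (1 - exp (-r ^ w))) (u := 2 * w) (v := w)
    (by linarith) hw2 hw ?_ ?_ ?_ ?_
  · refine ⟨key.1, key.2.trans ?_⟩
    rw [← setIntegral_congr_fun measurableSet_Ioi hEq, integral_const_mul, hV]
    have hG : Gamma ((w - (σ - w)) / w) = (w - σ) / w * Gamma ((w - σ) / w) := by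
      rw [← Gamma_add_one (by apply ne_of_lt; exact div_neg_of_neg_of_pos (by linarith) hw0)]
      congr 1; field_simp; ring
    rw [hG]
    have : σ - w ≠ 0 := by linarith
    field_simp
    ring
  · intro r hr
    convert! ((Real.hasDerivAt_rpow_const (p := w) (Or.inl hr.ne')).const_sub 1).sub
      (hasDerivAt_exp_neg_rpow w hr) using 1
    ring
  · intro r hr
    rw [two_mul, rpow_add hr, ← sq]
    exact abs_one_sub_sub_exp_neg_le_sq (rpow_nonneg hr.le _)
  · intro r hr
    exact abs_one_sub_sub_exp_neg_le (rpow_nonneg hr.le _)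
  · exact IntegrableOn.congr_fun (hI.const_mul (-w)) hEq measurableSet_Ioi

/-- The homogeneous kernel `(e + r c) / (e² + r² + 2 r c e)²` whose value at `e = 1`, with
`c = cos (pπ/2)`, is the weight of the profile. -/
noncomputable def profileKernel (e c r : ℝ) : ℝ :=
  (e + r * c) / (e ^ 2 + r ^ 2 + 2 * r * c * e) ^ 2

theorem sq_add_sq_add_lower_bound {c : ℝ} (hc : c ≤ 1) (e r : ℝ) :
    (1 + c) / 2 * (e + r) ^ 2 ≤ e ^ 2 + r ^ 2 + 2 * r * c * e := by
  nlinarith [mul_nonneg (sub_nonneg.mpr hc) (sq_nonneg (e - r))]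

theorem sq_add_sq_add_pos {c e r : ℝ} (hc' : -1 < c) (hc : c ≤ 1) (he : 0 ≤ e) (hr : 0 < r) :
    0 < e ^ 2 + r ^ 2 + 2 * r * c * e := by
  have h : 0 < 1 + c := by linarith
  exact lt_of_lt_of_le (by positivity) (sq_add_sq_add_lower_bound hc e r)

theorem abs_profileKernel_le {c e r : ℝ} (hc' : -1 < c) (hc : c ≤ 1) (he : 0 ≤ e) (hr : 0 < r) :
    |profileKernel e c r| ≤ 4 / (1 + c) ^ 2 * ((e + r) ^ 3)⁻¹ := by
  have h1c : 0 < 1 + c := by linarith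
  have her : 0 < e + r := by linarith
  have hnum : |e + r * c| ≤ e + r := by
    rw [abs_le]; constructor <;> nlinarith
  have hden : ((1 + c) / 2 * (e + r) ^ 2) ^ 2 ≤ (e ^ 2 + r ^ 2 + 2 * r * c * e) ^ 2 :=
    pow_le_pow_left₀ (by positivity) (sq_add_sq_add_lower_bound hc e r) 2
  rw [profileKernel, abs_div, abs_of_nonneg (sq_nonneg (_ : ℝ))]
  calc _ ≤ (e + r) / ((1 + c) / 2 * (e + r) ^ 2) ^ 2 :=
        div_le_div₀ her.le hnum (by positivity) hden
    _ = _ := by field_simp; norm_num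

theorem continuousOn_profileKernel {c e : ℝ} (hc' : -1 < c) (hc : c ≤ 1) (he : 0 ≤ e) :
    ContinuousOn (profileKernel e c) (Set.Ioi 0) := by
  unfold profileKernel
  refine ContinuousOn.div (by fun_prop) (by fun_prop) fun r hr => ?_
  exact pow_ne_zero _ (sq_add_sq_add_pos hc' hc he hr).ne'

theorem integrableOn_profileKernel_mul {c : ℝ} {a b C : ℝ} {g : ℝ → ℝ} (hc' : -1 < c)
    (hc : c ≤ 1) (ha : -1 < a) (hb : b < 2) (hg : ContinuousOn g (Set.Ioi 0))
    (hga : ∀ s, 0 < s → |g s| ≤ C * s ^ a) (hgb : ∀ s, 0 < s → |g s| ≤ C * s ^ b) :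
    IntegrableOn (fun s => profileKernel 1 c s * g s) (Set.Ioi 0) := by
  have h1c : 0 < 1 + c := by linarith
  refine integrableOn_Ioi_zero_of_norm_le_rpow (a := a) (b := b - 3) (C := 4 / (1 + c) ^ 2 * C)
    ha (by linarith) ((continuousOn_profileKernel hc' hc zero_le_one).mul hg) ?_ ?_
  · intro s hs
    rw [norm_mul, mul_assoc]
    refine mul_le_mul ?_ (hga s hs) (norm_nonneg _) (by positivity)
    refine (abs_profileKernel_le hc' hc zero_le_one hs).trans ?_
    refine mul_le_of_le_one_right (by positivity) (inv_le_one_of_one_le₀ ?_)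
    exact one_le_pow₀ (by linarith)
  · intro s hs
    have h3 : s ^ (b - 3) = (s ^ 3)⁻¹ * s ^ b := by
      rw [rpow_sub hs, div_eq_inv_mul]; norm_cast
    rw [norm_mul, h3, show 4 / (1 + c) ^ 2 * C * ((s ^ 3)⁻¹ * s ^ b)
      = 4 / (1 + c) ^ 2 * (s ^ 3)⁻¹ * (C * s ^ b) by ring]
    refine mul_le_mul ?_ (hgb s hs) (norm_nonneg _) (by positivity)
    refine (abs_profileKernel_le hc' hc zero_le_one hs).trans ?_
    gcongr
    linarith

theorem profileKernel_one_div {e : ℝ} (he : 0 < e) (c r : ℝ) :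
    profileKernel 1 c (e⁻¹ * r) = e ^ 3 * profileKernel e c r := by
  unfold profileKernel
  have : 1 ^ 2 + (e⁻¹ * r) ^ 2 + 2 * (e⁻¹ * r) * c * 1
      = (e ^ 2)⁻¹ * (e ^ 2 + r ^ 2 + 2 * r * c * e) := by field_simp
  rw [this, mul_pow]
  have h2 : 1 + e⁻¹ * r * c = e⁻¹ * (e + r * c) := by field_simp
  rw [h2, mul_div_mul_comm]
  congr 1
  field_simp

theorem integral_profileKernel_mul_comp {e : ℝ} (he : 0 < e) (c : ℝ) (h : ℝ → ℝ) :
    ∫ s in Set.Ioi (0 : ℝ), profileKernel 1 c s * h (e * s)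
      = e ^ 2 * ∫ r in Set.Ioi (0 : ℝ), profileKernel e c r * h r := by
  have := integral_comp_mul_left_Ioi (fun r => profileKernel 1 c (e⁻¹ * r) * h r) 0 he
  simp only [inv_mul_cancel_left₀ he.ne', mul_zero, smul_eq_mul] at this
  rw [this]
  simp only [profileKernel_one_div he, mul_assoc]
  rw [integral_const_mul]
  field_simp

theorem tendsto_integral_profileKernel_mul {c : ℝ} (hc' : -1 < c) (hc : c ≤ 1) {h : ℝ → ℝ}
    (hh : ContinuousOn h (Set.Ioi 0))
    (hi : IntegrableOn (fun r : ℝ => r ^ (-2 - 1 : ℝ) * h r) (Set.Ioi 0)) :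
    Tendsto (fun e => ∫ r in Set.Ioi (0 : ℝ), profileKernel e c r * h r)
      (nhdsWithin 0 (Set.Ioi 0)) (nhds (c * ∫ r in Set.Ioi (0 : ℝ), r ^ (-2 - 1 : ℝ) * h r)) := by
  have h1c : 0 < 1 + c := by linarith
  have h3 : ∀ r : ℝ, 0 < r → r ^ (-2 - 1 : ℝ) = (r ^ 3)⁻¹ := by
    intro r hr
    rw [show (-2 - 1 : ℝ) = -(3 : ℕ) by norm_num, rpow_neg hr.le, rpow_natCast]
  rw [← integral_const_mul]
  refine tendsto_integral_filter_of_dominated_convergence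
    (fun r => 4 / (1 + c) ^ 2 * ‖r ^ (-2 - 1 : ℝ) * h r‖) ?_ ?_ (hi.norm.const_mul _) ?_
  · filter_upwards [self_mem_nhdsWithin] with e he
    exact ((continuousOn_profileKernel hc' hc (le_of_lt he)).mul hh).aestronglyMeasurable
      measurableSet_Ioi
  · filter_upwards [self_mem_nhdsWithin] with e he
    refine (ae_restrict_iff' measurableSet_Ioi).mpr (ae_of_all _ fun r (hr : 0 < r) => ?_)
    have he : 0 < e := he
    rw [norm_mul, norm_mul, h3 r hr, Real.norm_of_nonneg (by positivity : 0 ≤ (r ^ 3)⁻¹),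
      ← mul_assoc]
    refine mul_le_mul_of_nonneg_right ?_ (norm_nonneg _)
    refine (abs_profileKernel_le hc' hc he.le hr).trans ?_
    gcongr
    linarith
  · refine (ae_restrict_iff' measurableSet_Ioi).mpr (ae_of_all _ fun r (hr : 0 < r) => ?_)
    have hcont : ContinuousAt (fun e => profileKernel e c r * h r) 0 := by
      refine ContinuousAt.mul ?_ continuousAt_const
      unfold profileKernel
      refine ContinuousAt.div (by fun_prop) (by fun_prop) ?_
      exact pow_ne_zero _ (sq_add_sq_add_pos hc' hc le_rfl hr).ne'
    have := hcont.tendsto.mono_left (nhdsWithin_le_nhds (s := Set.Ioi 0))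
    convert! this using 2
    rw [h3 r hr, profileKernel]
    have := hr.ne'
    field_simp
    ring

theorem integral_profileKernel {a : ℝ} (ha : 0 < a) (ha' : a < π) :
    IntegrableOn (profileKernel 1 (cos a)) (Set.Ioi 0) ∧
      ∫ s in Set.Ioi (0 : ℝ), profileKernel 1 (cos a) s = a / (2 * sin a) := by
  have hS : 0 < sin a := sin_pos_of_pos_of_lt_pi ha ha'
  have hsc := sin_sq_add_cos_sq a
  have hc : cos a ≤ 1 := cos_le_one a
  have hc' : -1 < cos a := by nlinarith [neg_one_le_cos a]
  have hint : IntegrableOn (profileKernel 1 (cos a)) (Set.Ioi 0) := by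
    simpa using integrableOn_profileKernel_mul (a := 0) (b := 0) (C := 1) (g := fun _ => 1)
      hc' hc (by norm_num) (by norm_num) continuousOn_const (by simp) (by simp)
  refine ⟨hint, ?_⟩
  have hQ : ∀ s : ℝ, 1 + s ^ 2 + 2 * s * cos a = (s + cos a) ^ 2 + sin a ^ 2 := by
    intro s; linear_combination -hsc
  have hQpos : ∀ s : ℝ, 0 < 1 + s ^ 2 + 2 * s * cos a := by
    intro s; rw [hQ]; positivity
  have hat : arctan (cos a / sin a) = π / 2 - a := by
    rw [← arctan_tan (x := π / 2 - a) (by linarith) (by linarith), tan_pi_div_two_sub,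
      tan_eq_sin_div_cos, inv_div]
  have key := integral_Ioi_of_hasDerivAt_of_tendsto' (a := 0)
    (m := 0 + 1 / (2 * sin a) * (π / 2))
    (f := fun s => s / (2 * (1 + s ^ 2 + 2 * s * cos a))
      + 1 / (2 * sin a) * arctan ((s + cos a) / sin a)) (fun s _ => ?_) hint ?_
  · rw [key]
    simp only [zero_div, zero_add, hat]
    field_simp
    ring
  · have hden : HasDerivAt (fun s : ℝ => 2 * (1 + s ^ 2 + 2 * s * cos a))
        (2 * (2 * s + 2 * cos a)) s := by
      have := (((hasDerivAt_id s).pow 2).const_add 1).add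
        (((hasDerivAt_id s).const_mul 2).mul_const (cos a))
      convert! this.const_mul 2 using 1
      simp
    have h1 := (hasDerivAt_id s).div hden (mul_pos two_pos (hQpos s)).ne'
    have h2 := ((((hasDerivAt_id s).add_const (cos a)).div_const (sin a)).arctan).const_mul
      (1 / (2 * sin a))
    convert! h1.add h2 using 1
    have hne := (hQpos s).ne'
    have e1 : 1 + ((s + cos a) / sin a) ^ 2 = (1 + s ^ 2 + 2 * s * cos a) / sin a ^ 2 := by
      rw [hQ]; field_simp; ring
    simp only [id, profileKernel, e1, one_pow, mul_one]
    field_simp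
    ring
  · refine Tendsto.add ?_ (Tendsto.const_mul _ ?_)
    · have hb : Tendsto (fun s : ℝ => (2 * (1 + cos a) / 2)⁻¹ * s⁻¹) atTop (nhds 0) := by
        simpa using tendsto_inv_atTop_zero.const_mul ((2 * (1 + cos a) / 2)⁻¹)
      refine squeeze_zero' ?_ ?_ hb
      · filter_upwards [eventually_gt_atTop 0] with s hs
        have := hQpos s
        positivity
      · filter_upwards [eventually_gt_atTop 0] with s hs
        have h1c : 0 < 1 + cos a := by linarith
        rw [← mul_inv, div_le_iff₀ (mul_pos two_pos (hQpos s))]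
        have h := sq_add_sq_add_lower_bound hc 1 s
        field_simp
        nlinarith [mul_pos h1c hs]
    · refine (tendsto_arctan_atTop.mono_right nhdsWithin_le_nhds).comp ?_
      exact (tendsto_atTop_add_const_right _ _ tendsto_id).atTop_div_const hS

theorem cos_half_mul_le_norm_one_add_mul_exp {θ s : ℝ} (hs : 0 ≤ s) (hθ : 0 ≤ cos (θ / 2)) :
    cos (θ / 2) * (1 + s) ≤ ‖1 + (s : ℂ) * Complex.exp (θ * Complex.I)‖ := by
  rw [← pow_le_pow_iff_left₀ (by positivity) (norm_nonneg _) two_ne_zero,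
    ← Complex.normSq_eq_norm_sq, mul_pow, cos_sq, mul_div_cancel₀ θ two_ne_zero,
    Complex.normSq_apply]
  have h := sq_add_sq_add_lower_bound (cos_le_one θ) 1 s
  have h1 := sin_sq_add_cos_sq θ
  simp only [Complex.add_re, Complex.add_im, Complex.one_re, Complex.one_im, Complex.re_ofReal_mul,
    Complex.im_ofReal_mul, Complex.exp_ofReal_mul_I_re, Complex.exp_ofReal_mul_I_im]
  linear_combination h - s ^ 2 * h1

theorem norm_one_add_mul_exp_pow_inv_le {θ s δ : ℝ} (n : ℕ) (hs : 0 < s) (hδ : 0 < δ)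
    (hθ : δ ≤ cos (θ / 2)) :
    ‖((1 + (s : ℂ) * Complex.exp (θ * Complex.I)) ^ n)⁻¹‖ ≤ (δ ^ n)⁻¹ * ((1 + s) ^ n)⁻¹ := by
  rw [norm_inv, norm_pow, ← mul_inv, ← mul_pow]
  gcongr
  refine le_trans ?_ (cos_half_mul_le_norm_one_add_mul_exp hs.le (hδ.le.trans hθ))
  gcongr

theorem one_add_mul_exp_ne_zero {θ s : ℝ} (hs : 0 ≤ s) (hθ : 0 < cos (θ / 2)) :
    1 + (s : ℂ) * Complex.exp (θ * Complex.I) ≠ 0 := by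
  rw [← norm_pos_iff]
  exact lt_of_lt_of_le (by positivity) (cos_half_mul_le_norm_one_add_mul_exp hs hθ.le)

theorem rpow_mul_one_add_sq_inv_le {s : ℝ} (hs : 0 < s) (v : ℝ) :
    s ^ v * ((1 + s) ^ 2)⁻¹ ≤ s ^ v ∧ s ^ v * ((1 + s) ^ 2)⁻¹ ≤ s ^ (v - 2) := by
  have hv : 0 < s ^ v := rpow_pos_of_pos hs v
  constructor
  · exact mul_le_of_le_one_right hv.le (inv_le_one_of_one_le₀ (one_le_pow₀ (by linarith)))
  · rw [rpow_sub hs, div_eq_mul_inv, rpow_two]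
    gcongr
    linarith

/-- The integrand of the rotated beta integral `∫₀^∞ s^(w-1) (1 + s e^{iθ})⁻² ds`. -/
noncomputable def rotatedBetaIntegrand (w θ s : ℝ) : ℂ :=
  ((s ^ (w - 1) : ℝ) : ℂ) * ((1 + (s : ℂ) * Complex.exp (θ * Complex.I)) ^ 2)⁻¹

theorem continuousOn_rotatedBetaIntegrand (w : ℝ) {θ : ℝ} (hθ : 0 < cos (θ / 2)) :
    ContinuousOn (rotatedBetaIntegrand w θ) (Set.Ioi 0) := by
  intro s hs
  have hs : 0 < s := hs
  refine ContinuousAt.continuousWithinAt (ContinuousAt.mul ?_ (ContinuousAt.inv₀ (by fun_prop) ?_))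
  · exact Complex.continuous_ofReal.continuousAt.comp
      (Real.continuousAt_rpow_const _ _ (Or.inl hs.ne'))
  · exact pow_ne_zero _ (one_add_mul_exp_ne_zero hs.le hθ)

theorem norm_rotatedBetaIntegrand_le (w : ℝ) {θ s δ : ℝ} (hs : 0 < s) (hδ : 0 < δ)
    (hθ : δ ≤ cos (θ / 2)) :
    ‖rotatedBetaIntegrand w θ s‖ ≤ (δ ^ 2)⁻¹ * (s ^ (w - 1) * ((1 + s) ^ 2)⁻¹) := by
  rw [rotatedBetaIntegrand, norm_mul, Complex.norm_real,
    Real.norm_of_nonneg (rpow_nonneg hs.le _), mul_left_comm]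
  exact mul_le_mul_of_nonneg_left (norm_one_add_mul_exp_pow_inv_le 2 hs hδ hθ)
    (rpow_nonneg hs.le _)

theorem integrableOn_rpow_mul_one_add_sq_inv {w : ℝ} (hw : 0 < w) (hw2 : w < 2) :
    IntegrableOn (fun s : ℝ => s ^ (w - 1) * ((1 + s) ^ 2)⁻¹) (Set.Ioi 0) := by
  have hn : ∀ s : ℝ, 0 < s → ‖s ^ (w - 1) * ((1 + s) ^ 2)⁻¹‖ = s ^ (w - 1) * ((1 + s) ^ 2)⁻¹ :=
    fun s hs => Real.norm_of_nonneg (by positivity)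
  refine integrableOn_Ioi_zero_of_norm_le_rpow (a := w - 1) (b := w - 1 - 2) (C := 1)
    (by linarith) (by linarith) ?_ ?_ ?_
  · intro s hs
    have hs : 0 < s := hs
    refine ContinuousAt.continuousWithinAt (ContinuousAt.mul ?_ (ContinuousAt.inv₀ (by fun_prop) ?_))
    · exact Real.continuousAt_rpow_const _ _ (Or.inl hs.ne')
    · positivity
  · intro s hs
    rw [hn s hs, one_mul]
    exact (rpow_mul_one_add_sq_inv_le hs _).1
  · intro s hs
    rw [hn s hs, one_mul]
    exact (rpow_mul_one_add_sq_inv_le hs _).2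

theorem integrableOn_rotatedBetaIntegrand {w θ : ℝ} (hw : 0 < w) (hw2 : w < 2)
    (hθ : 0 < cos (θ / 2)) : IntegrableOn (rotatedBetaIntegrand w θ) (Set.Ioi 0) := by
  refine ((integrableOn_rpow_mul_one_add_sq_inv hw hw2).const_mul
    ((cos (θ / 2) ^ 2)⁻¹)).mono' ?_ ?_
  · exact (continuousOn_rotatedBetaIntegrand w hθ).aestronglyMeasurable measurableSet_Ioi
  · exact (ae_restrict_iff' measurableSet_Ioi).mpr
      (ae_of_all _ fun s hs => norm_rotatedBetaIntegrand_le w hs hθ le_rfl)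

theorem hasDerivAt_integral_rotatedBetaIntegrand {w θ : ℝ} (hw : 0 < w) (hw2 : w < 2)
    (hθ : 0 < cos (θ / 2)) :
    HasDerivAt (fun θ => ∫ s in Set.Ioi (0 : ℝ), rotatedBetaIntegrand w θ s)
      (-(Complex.I * w) * ∫ s in Set.Ioi (0 : ℝ), rotatedBetaIntegrand w θ s) θ := by
  set δ := cos (θ / 2) / 2 with hδ_def
  have hδ : 0 < δ := by positivity
  have hnhds : {t : ℝ | δ < cos (t / 2)} ∈ nhds θ :=
    (isOpen_lt continuous_const (by fun_prop)).mem_nhds (by change δ < cos (θ / 2); linarith)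
  let F' : ℝ → ℝ → ℂ := fun t s => ((s ^ (w - 1) : ℝ) : ℂ) *
    (-(2 * (s * (Complex.exp (t * Complex.I) * Complex.I)))
      * ((1 + (s : ℂ) * Complex.exp (t * Complex.I)) ^ 3)⁻¹)
  have hF'cont : ContinuousOn (F' θ) (Set.Ioi 0) := by
    intro s hs
    have hs : 0 < s := hs
    refine ContinuousAt.continuousWithinAt (ContinuousAt.mul ?_
      (ContinuousAt.mul (by fun_prop) (ContinuousAt.inv₀ (by fun_prop) ?_)))
    · exact Complex.continuous_ofReal.continuousAt.comp
        (Real.continuousAt_rpow_const _ _ (Or.inl hs.ne'))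
    · exact pow_ne_zero _ (one_add_mul_exp_ne_zero hs.le hθ)
  have hF'bound : ∀ s : ℝ, 0 < s → ∀ t ∈ {t : ℝ | δ < cos (t / 2)},
      ‖F' t s‖ ≤ 2 * (δ ^ 3)⁻¹ * (s ^ (w - 1) * ((1 + s) ^ 2)⁻¹) := by
    intro s hs t ht
    have hA : ‖(-(2 * (s * (Complex.exp (t * Complex.I) * Complex.I))) : ℂ)‖ = 2 * s := by
      simp [Complex.norm_exp_ofReal_mul_I, abs_of_pos hs]
    simp only [F']
    rw [norm_mul, norm_mul, hA, Complex.norm_real, Real.norm_of_nonneg (rpow_nonneg hs.le _)]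
    have h1 := norm_one_add_mul_exp_pow_inv_le 3 hs hδ (le_of_lt ht)
    have h2 : s * ((1 + s) ^ 3)⁻¹ ≤ ((1 + s) ^ 2)⁻¹ := by
      rw [pow_succ (1 + s) 2, mul_inv, mul_left_comm]
      refine mul_le_of_le_one_right (by positivity) ?_
      rw [← div_eq_mul_inv, div_le_one (by linarith)]
      linarith
    calc _ ≤ s ^ (w - 1) * (2 * s * ((δ ^ 3)⁻¹ * ((1 + s) ^ 3)⁻¹)) := by gcongr
      _ = 2 * (δ ^ 3)⁻¹ * (s ^ (w - 1) * (s * ((1 + s) ^ 3)⁻¹)) := by ring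
      _ ≤ _ := by gcongr
  have hF := integrableOn_rotatedBetaIntegrand hw hw2 hθ
  obtain ⟨hF'int, hderiv⟩ := hasDerivAt_integral_of_dominated_loc_of_deriv_le
    (F := fun t s => rotatedBetaIntegrand w t s) (F' := F') (x₀ := θ)
    (μ := volume.restrict (Set.Ioi (0 : ℝ)))
    (bound := fun s => 2 * (δ ^ 3)⁻¹ * (s ^ (w - 1) * ((1 + s) ^ 2)⁻¹)) hnhds
    (by
      filter_upwards [hnhds] with t ht
      exact (continuousOn_rotatedBetaIntegrand w (hδ.trans ht)).aestronglyMeasurable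
        measurableSet_Ioi)
    hF (hF'cont.aestronglyMeasurable measurableSet_Ioi)
    ((ae_restrict_iff' measurableSet_Ioi).mpr (ae_of_all _ hF'bound))
    ((integrableOn_rpow_mul_one_add_sq_inv hw hw2).const_mul _)
    (by
      refine (ae_restrict_iff' measurableSet_Ioi).mpr (ae_of_all _ fun s (hs : 0 < s) t ht => ?_)
      have hne := one_add_mul_exp_ne_zero hs.le (hδ.trans ht)
      have hexp : HasDerivAt (fun t : ℝ => 1 + (s : ℂ) * Complex.exp (t * Complex.I))
          (s * (Complex.exp (t * Complex.I) * Complex.I)) t := by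
        have h0 : HasDerivAt (fun t : ℝ => (t : ℂ) * Complex.I) Complex.I t := by
          simpa using (Complex.ofRealCLM.hasDerivAt (x := t)).mul_const Complex.I
        exact (h0.cexp.const_mul _).const_add _
      have h := ((hexp.pow 2).inv (pow_ne_zero 2 hne)).const_mul ((s ^ (w - 1) : ℝ) : ℂ)
      refine h.congr_deriv ?_
      simp only [F', Pi.pow_apply]
      push_cast
      field_simp)
  have hparts : ∫ s in Set.Ioi (0 : ℝ), (w * rotatedBetaIntegrand w θ s - Complex.I * F' θ s)
      = 0 := by
    let H : ℝ → ℂ := fun s =>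
      ((s ^ w : ℝ) : ℂ) * ((1 + (s : ℂ) * Complex.exp (θ * Complex.I)) ^ 2)⁻¹
    have hH : ∀ s, 0 < s → ‖H s‖ ≤ (cos (θ / 2) ^ 2)⁻¹ * (s ^ w * ((1 + s) ^ 2)⁻¹) := by
      intro s hs
      simpa [rotatedBetaIntegrand, H] using norm_rotatedBetaIntegrand_le (w + 1) hs hθ le_rfl
    obtain ⟨h0, htop⟩ := tendsto_zero_of_norm_le_rpow (g := H) (a := w) (b := w - 2)
      (C := (cos (θ / 2) ^ 2)⁻¹) hw (by linarith)
      (fun s hs => (hH s hs).trans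
        (mul_le_mul_of_nonneg_left (rpow_mul_one_add_sq_inv_le hs w).1 (by positivity)))
      (fun s hs => (hH s hs).trans
        (mul_le_mul_of_nonneg_left (rpow_mul_one_add_sq_inv_le hs w).2 (by positivity)))
    have hH0 : H 0 = 0 := by simp [H, Real.zero_rpow hw.ne']
    have := integral_Ioi_of_hasDerivAt_of_tendsto (f := H) (a := 0) (m := 0)
      (f' := fun s => w * rotatedBetaIntegrand w θ s - Complex.I * F' θ s) ?_ ?_
      ((hF.const_mul _).sub (Integrable.const_mul hF'int _)) htop
    · rw [this, hH0, sub_zero]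
    · rw [← continuousWithinAt_Ioi_iff_Ici]
      simpa [ContinuousWithinAt, hH0] using h0
    · intro s hs
      have hs : 0 < s := hs
      have hne := one_add_mul_exp_ne_zero hs.le hθ
      have hlin : HasDerivAt (fun s : ℝ => 1 + (s : ℂ) * Complex.exp (θ * Complex.I))
          (Complex.exp (θ * Complex.I)) s := by
        simpa using ((Complex.ofRealCLM.hasDerivAt (x := s)).mul_const
          (Complex.exp (θ * Complex.I))).const_add 1
      have hpow := (Real.hasDerivAt_rpow_const (p := w) (Or.inl hs.ne')).ofReal_comp
      have h := hpow.mul ((hlin.pow 2).inv (pow_ne_zero 2 hne))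
      refine h.congr_deriv ?_
      have hsw : ((s ^ w : ℝ) : ℂ) = ((s ^ (w - 1) : ℝ) : ℂ) * s := by
        rw [← Complex.ofReal_mul, ← rpow_add_one hs.ne', sub_add_cancel]
      simp only [rotatedBetaIntegrand, F', hsw, Pi.pow_apply, Pi.inv_apply, Complex.ofReal_mul]
      field_simp
      linear_combination (-2 * ((s ^ (w - 1) : ℝ) : ℂ) * s * Complex.exp (θ * Complex.I)
        * (1 + s * Complex.exp (θ * Complex.I))) * Complex.I_sq
  refine hderiv.congr_deriv ?_
  rw [integral_sub (hF.const_mul _) (Integrable.const_mul hF'int _), integral_const_mul,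
    integral_const_mul] at hparts
  linear_combination Complex.I * hparts
    + (∫ s in Set.Ioi (0 : ℝ), F' θ s) * Complex.I_sq

theorem exp_mul_integral_rotatedBetaIntegrand {w a : ℝ} (hw : 0 < w) (hw2 : w < 2)
    (ha : 0 ≤ a) (ha' : a < π) :
    Complex.exp (Complex.I * w * a) * ∫ s in Set.Ioi (0 : ℝ), rotatedBetaIntegrand w a s
      = ∫ s in Set.Ioi (0 : ℝ), rotatedBetaIntegrand w 0 s := by
  have hcos : ∀ θ ∈ Set.Ioo (-π) π, 0 < cos (θ / 2) := fun θ hθ =>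
    cos_pos_of_mem_Ioo ⟨by linarith [hθ.1], by linarith [hθ.2]⟩
  have hd : ∀ θ ∈ Set.Ioo (-π) π, HasDerivAt (fun θ : ℝ => Complex.exp (Complex.I * w * θ) *
      ∫ s in Set.Ioi (0 : ℝ), rotatedBetaIntegrand w θ s) 0 θ := by
    intro θ hθ
    have h0 : HasDerivAt (fun t : ℝ => Complex.I * w * (t : ℂ)) (Complex.I * w) θ := by
      simpa using (Complex.ofRealCLM.hasDerivAt (x := θ)).const_mul (Complex.I * w)
    refine (h0.cexp.mul
      (hasDerivAt_integral_rotatedBetaIntegrand hw hw2 (hcos θ hθ))).congr_deriv ?_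
    ring
  have := isOpen_Ioo.is_const_of_deriv_eq_zero isPreconnected_Ioo
    (fun θ hθ => (hd θ hθ).differentiableAt.differentiableWithinAt)
    (fun θ hθ => (hd θ hθ).deriv)
    (show a ∈ Set.Ioo (-π) π from ⟨by linarith [pi_pos], ha'⟩)
    (show (0 : ℝ) ∈ Set.Ioo (-π) π from ⟨by linarith [pi_pos], pi_pos⟩)
  simpa using this

theorem integral_profileKernel_mul_rpow_eq_zero {w : ℝ} (hw : 1 < w) (hw2 : w < 2) :
    ∫ s in Set.Ioi (0 : ℝ), profileKernel 1 (cos (π / w)) s * s ^ w = 0 := by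
  have hw0 : 0 < w := by linarith
  have ha : 0 < π / w := by positivity
  have ha' : π / w < π := div_lt_self pi_pos hw
  have hcos : 0 < cos (π / w / 2) := cos_pos_of_mem_Ioo ⟨by linarith, by linarith⟩
  have hrot := exp_mul_integral_rotatedBetaIntegrand hw0 hw2 ha.le ha'
  have hexp : Complex.exp (Complex.I * w * (π / w : ℝ)) = -1 := by
    rw [← Complex.exp_pi_mul_I]
    congr 1
    have : (w : ℂ) ≠ 0 := Complex.ofReal_ne_zero.mpr hw0.ne'
    push_cast
    field_simp
  have hreal : (∫ s in Set.Ioi (0 : ℝ), rotatedBetaIntegrand w 0 s).im = 0 := by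
    have : ∀ s : ℝ, rotatedBetaIntegrand w 0 s = ((s ^ (w - 1) * ((1 + s) ^ 2)⁻¹ : ℝ) : ℂ) := by
      intro s; simp [rotatedBetaIntegrand]
    simp_rw [this]
    rw [integral_complex_ofReal, Complex.ofReal_im]
  have him : ∫ s in Set.Ioi (0 : ℝ), (rotatedBetaIntegrand w (π / w) s).im = 0 := by
    have h := Complex.imCLM.integral_comp_comm (integrableOn_rotatedBetaIntegrand hw0 hw2 hcos)
    simp only [Complex.imCLM_apply] at h
    rw [hexp, neg_one_mul] at hrot
    rwa [h, ← neg_eq_zero, ← Complex.neg_im, hrot]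
  have hS : 0 < sin (π / w) := sin_pos_of_pos_of_lt_pi ha ha'
  have hEq : Set.EqOn (fun s => (rotatedBetaIntegrand w (π / w) s).im)
      (fun s => -(2 * sin (π / w)) * (profileKernel 1 (cos (π / w)) s * s ^ w)) (Set.Ioi 0) := by
    intro s hs
    have hs : 0 < s := hs
    have hsw : s ^ w = s ^ (w - 1) * s := by rw [← rpow_add_one hs.ne', sub_add_cancel]
    have h1 := sin_sq_add_cos_sq (π / w)
    have hre : (1 + (s : ℂ) * Complex.exp ((π / w : ℝ) * Complex.I)).re = 1 + s * cos (π / w) := by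
      simp only [Complex.add_re, Complex.one_re, Complex.re_ofReal_mul,
        Complex.exp_ofReal_mul_I_re]
    have him : (1 + (s : ℂ) * Complex.exp ((π / w : ℝ) * Complex.I)).im = s * sin (π / w) := by
      simp only [Complex.add_im, Complex.one_im, Complex.im_ofReal_mul,
        Complex.exp_ofReal_mul_I_im, zero_add]
    have hQ : Complex.normSq (1 + (s : ℂ) * Complex.exp ((π / w : ℝ) * Complex.I))
        = 1 ^ 2 + s ^ 2 + 2 * s * cos (π / w) * 1 := by
      rw [Complex.normSq_apply, hre, him]
      linear_combination s ^ 2 * h1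
    simp only [rotatedBetaIntegrand, profileKernel]
    rw [Complex.im_ofReal_mul, Complex.inv_im, map_pow, hQ, sq (1 + _ * _ : ℂ), Complex.mul_im,
      hre, him, hsw]
    ring
  rw [setIntegral_congr_fun measurableSet_Ioi hEq, integral_const_mul] at him
  exact (mul_eq_zero.mp him).resolve_left (by simpa using hS.ne')

theorem tendsto_one_sub_exp_neg_mul_div (y : ℝ) :
    Tendsto (fun x : ℝ => (1 - exp (-(x * y))) / x) (nhdsWithin 0 (Set.Ioi 0)) (nhds y) := by
  have h : HasDerivAt (fun x : ℝ => 1 - exp (-(x * y))) y 0 := by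
    have := ((hasDerivAt_id (0 : ℝ)).mul_const y).neg.exp.const_sub 1
    simpa using this
  have := h.hasDerivWithinAt (s := Set.Ioi 0)
  rw [hasDerivWithinAt_iff_tendsto_slope' (by simp)] at this
  refine this.congr fun x => ?_
  simp [slope_def_field]

theorem integral_profileKernel_zero_mul_sq :
    ∫ s in Set.Ioi (0 : ℝ), profileKernel 1 0 s * s ^ 2 = π / 4 := by
  have hint : IntegrableOn (fun s => profileKernel 1 0 s * s ^ 2) (Set.Ioi 0) := by
    have h : ∀ s : ℝ, profileKernel 1 0 s * s ^ 2 = s ^ 2 / (1 + s ^ 2) ^ 2 := by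
      intro s; simp only [profileKernel]; ring_nf
    refine (integrable_inv_one_add_sq.integrableOn (s := Set.Ioi 0)).mono' ?_
      (ae_of_all _ fun s => ?_)
    · exact ((continuousOn_profileKernel (by norm_num) (by norm_num) zero_le_one).mul
        (by fun_prop)).aestronglyMeasurable measurableSet_Ioi
    · rw [h, Real.norm_of_nonneg (by positivity), div_le_iff₀ (by positivity)]
      field_simp
      linarith
  have key := integral_Ioi_of_hasDerivAt_of_tendsto' (a := 0) (m := 1 / 2 * (π / 2 - 0))
    (f := fun s => 1 / 2 * (arctan s - s / (1 + s ^ 2))) (fun s _ => ?_) hint ?_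
  · rw [key]
    simp
    ring
  · have h := ((hasDerivAt_arctan s).sub ((hasDerivAt_id s).div
      (((hasDerivAt_id s).pow 2).const_add 1)
      (by simp only [Pi.pow_apply, id]; positivity))).const_mul (1 / 2)
    refine h.congr_deriv ?_
    have : 1 + s ^ 2 ≠ 0 := by positivity
    simp only [profileKernel, Pi.pow_apply, id, mul_zero, zero_mul, add_zero, one_pow]
    push_cast
    field_simp
    ring
  · refine Tendsto.const_mul _ ((tendsto_arctan_atTop.mono_right nhdsWithin_le_nhds).sub ?_)
    refine squeeze_zero' ?_ ?_ tendsto_inv_atTop_zero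
    · filter_upwards [eventually_gt_atTop 0] with s hs
      positivity
    · filter_upwards [eventually_gt_atTop 0] with s hs
      rw [div_le_iff₀ (by positivity)]
      field_simp
      linarith

theorem tendsto_integral_profileKernel_zero_mul_one_sub_exp :
    Tendsto (fun x : ℝ => (∫ s in Set.Ioi (0 : ℝ),
      profileKernel 1 0 s * (1 - exp (-(x * s ^ 2)))) / x)
      (nhdsWithin 0 (Set.Ioi 0)) (nhds (π / 4)) := by
  have hint : IntegrableOn (fun s => profileKernel 1 0 s * s ^ 2) (Set.Ioi 0) := by
    by_contra h
    have := integral_profileKernel_zero_mul_sq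
    rw [integral_undef h] at this
    linarith [pi_pos]
  simp_rw [← integral_div]
  rw [← integral_profileKernel_zero_mul_sq]
  refine tendsto_integral_filter_of_dominated_convergence
    (fun s => ‖profileKernel 1 0 s * s ^ 2‖) ?_ ?_ hint.norm ?_
  · refine Eventually.of_forall fun x => ContinuousOn.aestronglyMeasurable ?_ measurableSet_Ioi
    exact ((continuousOn_profileKernel (by norm_num) (by norm_num) zero_le_one).mul
        (by fun_prop)).div_const _
  · filter_upwards [self_mem_nhdsWithin] with x (hx : 0 < x)
    refine ae_of_all _ fun s => ?_
    rw [mul_div_assoc, norm_mul, norm_mul]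
    refine mul_le_mul_of_nonneg_left ?_ (norm_nonneg _)
    rw [norm_div, Real.norm_of_nonneg hx.le, div_le_iff₀ hx, Real.norm_of_nonneg (sq_nonneg s),
      mul_comm (s ^ 2)]
    exact abs_one_sub_exp_neg_le (by positivity)
  · refine ae_of_all _ fun s => ?_
    simp_rw [mul_div_assoc]
    exact (tendsto_one_sub_exp_neg_mul_div (s ^ 2)).const_mul _

theorem tendsto_integral_profileKernel_mul_one_sub_exp {p : ℝ} (hp : 0 < p) (hp2 : p < 2)
    (hp1 : p ≠ 1) :
    Tendsto (fun x : ℝ => (∫ s in Set.Ioi (0 : ℝ), profileKernel 1 (cos (p * π / 2)) s *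
        (1 - exp (-(x * s ^ (2 / p))))) / x ^ p)
      (nhdsWithin 0 (Set.Ioi 0)) (nhds (cos (p * π / 2) * (2⁻¹ * Gamma (1 - p)))) := by
  have ha : 0 < p * π / 2 := by positivity
  have ha' : p * π / 2 < π := by nlinarith [pi_pos]
  have hS : 0 < sin (p * π / 2) := sin_pos_of_pos_of_lt_pi ha ha'
  have hsc := sin_sq_add_cos_sq (p * π / 2)
  set c := cos (p * π / 2) with hc_def
  have hc : c ≤ 1 := cos_le_one _
  have hc' : -1 < c := by nlinarith [neg_one_le_cos (p * π / 2)]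
  set w := 2 / p with hw_def
  have hw : 0 < w := by positivity
  have hGw : (w - 2) / w = 1 - p := by rw [hw_def]; field_simp
  have hcw : Continuous fun r : ℝ => r ^ w := Real.continuous_rpow_const hw.le
  obtain ⟨h, hh, hi, hval, hred⟩ : ∃ h : ℝ → ℝ, Continuous h ∧
      IntegrableOn (fun r : ℝ => r ^ (-2 - 1 : ℝ) * h r) (Set.Ioi 0) ∧
      ∫ r in Set.Ioi (0 : ℝ), r ^ (-2 - 1 : ℝ) * h r = 2⁻¹ * Gamma (1 - p) ∧
      ∀ x : ℝ, 0 < x → ∫ s in Set.Ioi (0 : ℝ), profileKernel 1 c s * (1 - exp (-(x * s ^ w)))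
        = ∫ s in Set.Ioi (0 : ℝ), profileKernel 1 c s * h (x ^ (p / 2) * s) := by
    have hscale : ∀ x s : ℝ, 0 < x → 0 < s → (x ^ (p / 2) * s) ^ w = x * s ^ w := by
      intro x s hx hs
      rw [mul_rpow (rpow_nonneg hx.le _) hs.le, ← rpow_mul hx.le, hw_def,
        show p / 2 * (2 / p) = 1 by field_simp, rpow_one]
    rcases lt_or_gt_of_ne hp1 with hlt | hgt
    · have hw2 : 2 < w := by rw [hw_def, lt_div_iff₀ hp]; linarith
      obtain ⟨h₁, h₂⟩ := integral_rpow_mul_one_sub_exp_neg_rpow two_pos hw2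
      refine ⟨fun r => 1 - exp (-r ^ w), by fun_prop, h₁, by rw [h₂, hGw], fun x hx => ?_⟩
      refine setIntegral_congr_fun measurableSet_Ioi fun s hs => ?_
      simp only [hscale x s hx hs]
    · have hw2 : w < 2 := by rw [hw_def, div_lt_iff₀ hp]; linarith
      have hw1 : 1 < w := by rw [hw_def, lt_div_iff₀ hp]; linarith
      obtain ⟨h₁, h₂⟩ := integral_rpow_mul_one_sub_sub_exp_neg_rpow hw2 (by linarith)
      refine ⟨fun r => 1 - r ^ w - exp (-r ^ w), by fun_prop, h₁, by rw [h₂, hGw],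
        fun x hx => ?_⟩
      have hmom : ∫ s in Set.Ioi (0 : ℝ), profileKernel 1 c s * s ^ w = 0 := by
        have := integral_profileKernel_mul_rpow_eq_zero hw1 hw2
        rwa [show π / w = p * π / 2 by rw [hw_def]; field_simp] at this
      have hn : ∀ s : ℝ, 0 < s → |s ^ w| = s ^ w := fun s hs => abs_of_pos (rpow_pos_of_pos hs w)
      have hI1 : IntegrableOn (fun s => profileKernel 1 c s * s ^ w) (Set.Ioi 0) :=
        integrableOn_profileKernel_mul (a := w) (b := w) (C := 1) hc' hc (by linarith) hw2
          hcw.continuousOn (fun s hs => by rw [hn s hs, one_mul])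
          (fun s hs => by rw [hn s hs, one_mul])
      have hI2 : IntegrableOn (fun s => profileKernel 1 c s * (1 - exp (-(x * s ^ w))))
          (Set.Ioi 0) := by
        have hb : ∀ s : ℝ, 0 < s → |1 - exp (-(x * s ^ w))| ≤ 1 * s ^ (0 : ℝ) := by
          intro s hs
          simpa using abs_one_sub_exp_neg_le_one (mul_nonneg hx.le (rpow_nonneg hs.le w))
        exact integrableOn_profileKernel_mul hc' hc (by norm_num) (by norm_num)
          (by fun_prop) hb hb
      have hEq : Set.EqOn (fun s => profileKernel 1 c s * (1 - exp (-(x * s ^ w)))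
          - x * (profileKernel 1 c s * s ^ w)) (fun s => profileKernel 1 c s *
            (1 - (x ^ (p / 2) * s) ^ w - exp (-(x ^ (p / 2) * s) ^ w))) (Set.Ioi 0) := by
        intro s hs
        simp only [hscale x s hx hs]
        ring
      rw [← setIntegral_congr_fun measurableSet_Ioi hEq, integral_sub hI2 (hI1.const_mul x),
        integral_const_mul, hmom, mul_zero, sub_zero]
  have hlim := tendsto_integral_profileKernel_mul hc' hc hh.continuousOn hi
  rw [hval] at hlim
  have hx0 : Tendsto (fun x : ℝ => x ^ (p / 2)) (nhdsWithin 0 (Set.Ioi 0))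
      (nhdsWithin 0 (Set.Ioi 0)) := by
    refine tendsto_nhdsWithin_iff.mpr ⟨?_, ?_⟩
    · have := (Real.continuousAt_rpow_const 0 (p / 2) (Or.inr (by positivity))).tendsto
      rw [Real.zero_rpow (by positivity)] at this
      exact this.mono_left nhdsWithin_le_nhds
    · filter_upwards [self_mem_nhdsWithin] with x hx using rpow_pos_of_pos hx _
  refine (hlim.comp hx0).congr' ?_
  filter_upwards [self_mem_nhdsWithin] with x (hx : 0 < x)
  have hsq : (x ^ (p / 2)) ^ 2 = x ^ p := by
    rw [← rpow_natCast, ← rpow_mul hx.le]; congr 1; push_cast; ring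
  rw [hred x hx, integral_profileKernel_mul_comp (rpow_pos_of_pos hx _), hsq,
    mul_div_cancel_left₀ _ (rpow_pos_of_pos hx p).ne']
  rfl

/-- Small-`x` behaviour of the Case 2 self-similar profile:
`(1 - ψ₂(x))/x^p → 1/Γ(p+1)` as `x → 0⁺`. -/
theorem stmt11 (p : ℝ) (hp : 0 < p) (hp2 : p < 2)
    (ψ₂ : ℝ → ℝ)
    (hψ₂ : ∀ x : ℝ, 0 ≤ x →
      ψ₂ x = (4 * Real.sin (p * Real.pi / 2) / (p * Real.pi)) *
        ∫ s in Set.Ioi (0 : ℝ),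
          (1 + s * Real.cos (p * Real.pi / 2))
            / (1 + s ^ 2 + 2 * s * Real.cos (p * Real.pi / 2)) ^ 2
            * Real.exp (-(x * s ^ (2 / p)))) :
    Tendsto (fun x : ℝ => (1 - ψ₂ x) / x ^ p) (nhdsWithin 0 (Set.Ioi 0))
      (nhds (1 / Real.Gamma (p + 1))) := by
  have ha : 0 < p * π / 2 := by positivity
  have ha' : p * π / 2 < π := by nlinarith [pi_pos]
  have hS : 0 < sin (p * π / 2) := sin_pos_of_pos_of_lt_pi ha ha'
  have hsc := sin_sq_add_cos_sq (p * π / 2)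
  have hc : cos (p * π / 2) ≤ 1 := cos_le_one _
  have hc' : -1 < cos (p * π / 2) := by nlinarith [neg_one_le_cos (p * π / 2)]
  obtain ⟨hI, hmass⟩ := integral_profileKernel ha ha'
  have hcw : Continuous fun r : ℝ => r ^ (2 / p) := Real.continuous_rpow_const (by positivity)
  have hrep : ∀ x : ℝ, 0 < x → 1 - ψ₂ x = (4 * sin (p * π / 2) / (p * π)) *
      ∫ s in Set.Ioi (0 : ℝ), profileKernel 1 (cos (p * π / 2)) s *
        (1 - exp (-(x * s ^ (2 / p)))) := by
    intro x hx
    have hb : ∀ s : ℝ, 0 < s → |exp (-(x * s ^ (2 / p)))| ≤ 1 * s ^ (0 : ℝ) := by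
      intro s hs
      have : 0 ≤ x * s ^ (2 / p) := mul_nonneg hx.le (rpow_nonneg hs.le _)
      simpa using this
    have hIe : IntegrableOn (fun s => profileKernel 1 (cos (p * π / 2)) s *
        exp (-(x * s ^ (2 / p)))) (Set.Ioi 0) :=
      integrableOn_profileKernel_mul hc' hc (by norm_num) (by norm_num) (by fun_prop) hb hb
    simp_rw [mul_sub, mul_one]
    rw [integral_sub hI hIe, hmass, hψ₂ x hx.le]
    simp only [profileKernel, one_pow, mul_one]
    rw [mul_sub]
    congr 1
    field_simp
    norm_num
  suffices hmain : ∃ L : ℝ, (4 * sin (p * π / 2) / (p * π)) * L = 1 / Gamma (p + 1) ∧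
      Tendsto (fun x : ℝ => (∫ s in Set.Ioi (0 : ℝ), profileKernel 1 (cos (p * π / 2)) s *
        (1 - exp (-(x * s ^ (2 / p))))) / x ^ p) (nhdsWithin 0 (Set.Ioi 0)) (nhds L) by
    obtain ⟨L, hL, hlim⟩ := hmain
    rw [← hL]
    refine (hlim.const_mul _).congr' ?_
    filter_upwards [self_mem_nhdsWithin] with x hx
    rw [hrep x hx]
    exact (mul_div_assoc _ _ _).symm
  rcases eq_or_ne p 1 with rfl | hp1
  · refine ⟨π / 4, ?_, ?_⟩
    · have : Gamma (1 + 1) = 1 := by rw [one_add_one_eq_two, Gamma_two]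
      rw [this, one_mul, sin_pi_div_two]
      field_simp
    · simpa using tendsto_integral_profileKernel_zero_mul_one_sub_exp
  · refine ⟨_, ?_, tendsto_integral_profileKernel_mul_one_sub_exp hp hp2 hp1⟩
    have hrefl := Real.Gamma_mul_Gamma_one_sub p
    have hG : 0 < Gamma p := Gamma_pos_of_pos hp
    have hsin : sin (π * p) = 2 * sin (p * π / 2) * cos (p * π / 2) := by
      rw [← sin_two_mul]; congr 1; ring
    have hcos : cos (p * π / 2) ≠ 0 := by
      intro h0
      rcases lt_or_gt_of_ne hp1 with hlt | hgt
      · exact (cos_pos_of_mem_Ioo ⟨by linarith [pi_pos], by nlinarith [pi_pos]⟩).ne' h0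
      · exact (cos_neg_of_pi_div_two_lt_of_lt (by nlinarith [pi_pos])
          (by linarith [pi_pos])).ne h0
    rw [hsin] at hrefl
    rw [Gamma_add_one hp.ne']
    field_simp at hrefl ⊢
    linarith
end

section
/- Let F(v) = (4/π) ∫₀^∞ e^{-|v|²/(2s²)} / ((2πs²)^{3/2} (1+s²)²) ds for v ∈ ℝ³. Then lim_{|v|→∞} |v|⁶ F(v) = 2 (2/π)^{5/2} and lim_{|v|→0} |v|² F(v) = 2^{1/2} π^{-5/2}. -/
open Real MeasureTheory Filter

open Set in
/-- The substitution `s = r / w` in the integral over Gaussian widths. -/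
lemma integral_gaussian_mixture_eq {r : ℝ} (hr : 0 < r) :
    ∫ s in Ioi (0 : ℝ), exp (-(r ^ 2 / (2 * s ^ 2)))
        / ((2 * π * s ^ 2) ^ ((3 : ℝ) / 2) * (1 + s ^ 2) ^ 2)
      = ((2 * π) ^ ((3 : ℝ) / 2))⁻¹ * r⁻¹ ^ 2 *
        ∫ w in Ioi (0 : ℝ), w ^ 5 * exp (-(1 / 2) * w ^ 2) / (r ^ 2 + w ^ 2) ^ 2 := by
  rw [← integral_comp_rpow_Ioi _ (show (-1 : ℝ) ≠ 0 by norm_num)]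
  have h := integral_comp_mul_left_Ioi (fun x : ℝ => (|(-1 : ℝ)| * x ^ ((-1 : ℝ) - 1)) •
    (exp (-(r ^ 2 / (2 * (x ^ (-1 : ℝ)) ^ 2)))
        / ((2 * π * (x ^ (-1 : ℝ)) ^ 2) ^ ((3 : ℝ) / 2) * (1 + (x ^ (-1 : ℝ)) ^ 2) ^ 2))) 0
    (inv_pos.2 hr)
  rw [mul_zero, inv_inv, smul_eq_mul] at h
  rw [← mul_right_inj' hr.ne', ← h, ← integral_const_mul, ← integral_const_mul]
  refine setIntegral_congr_fun measurableSet_Ioi fun w (hw : 0 < w) => ?_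
  have hx : 0 < r⁻¹ * w := by positivity
  have e1 : (r⁻¹ * w) ^ ((-1 : ℝ) - 1) = ((r⁻¹ * w) ^ 2)⁻¹ := by
    rw [show (-1 : ℝ) - 1 = -(2 : ℕ) by norm_num, rpow_neg hx.le, rpow_natCast]
  have e2 : (r⁻¹ * w) ^ (-1 : ℝ) = r / w := by
    rw [rpow_neg_one, mul_inv, inv_inv, div_eq_mul_inv]
  have e3 : (2 * π * (r / w) ^ 2) ^ ((3 : ℝ) / 2) = (2 * π) ^ ((3 : ℝ) / 2) * (r / w) ^ 3 := by
    rw [mul_rpow (by positivity) (by positivity), ← rpow_natCast (r / w) 2,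
      ← rpow_mul (by positivity), ← rpow_natCast (r / w) 3]
    norm_num
  have e4 : -(r ^ 2 / (2 * (r / w) ^ 2)) = -(1 / 2) * w ^ 2 := by
    field_simp
  have hc : 0 < (2 * π) ^ ((3 : ℝ) / 2) := by positivity
  simp only [e1, e2, e3, e4, smul_eq_mul, abs_neg, abs_one]
  field_simp
  ring

open Set in
lemma integrableOn_pow_mul_exp_neg_half_sq (n : ℕ) :
    IntegrableOn (fun w : ℝ => w ^ n * exp (-(1 / 2) * w ^ 2)) (Ioi 0) := by
  have h := integrableOn_rpow_mul_exp_neg_mul_sq (show (0 : ℝ) < 1 / 2 by norm_num)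
    (show (-1 : ℝ) < n by linarith [n.cast_nonneg (α := ℝ)])
  simpa only [rpow_natCast] using h

open Set in
lemma integral_pow_mul_exp_neg_half_sq (k : ℕ) :
    ∫ w in Ioi (0 : ℝ), w ^ (2 * k + 1) * exp (-(1 / 2) * w ^ 2) = 2 ^ k * k.factorial := by
  have h := _root_.integral_rpow_mul_exp_neg_mul_rpow (p := 2) (q := (2 * k + 1 : ℕ)) (b := 1 / 2)
    (by norm_num) (by linarith [(2 * k + 1).cast_nonneg (α := ℝ)]) (by norm_num)
  have e : (((2 * k + 1 : ℕ) : ℝ) + 1) / 2 = k + 1 := by push_cast; ring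
  rw [neg_div, e, Real.Gamma_nat_eq_factorial, one_div, inv_rpow (by norm_num), rpow_neg
    (by norm_num), inv_inv, rpow_add (by norm_num), rpow_natCast, rpow_one] at h
  simp only [rpow_natCast, rpow_two] at h
  simp only [one_div]
  rw [h]
  ring

open Set in
/-- Dominated convergence with Gaussian weights `w ^ n * exp (-w ^ 2 / 2)` and a factor in
`[0, 1]` converging to `1`. -/
lemma tendsto_integral_pow_mul_exp_mul {l : Filter ℝ} [l.IsCountablyGenerated]
    (n : ℕ) {φ : ℝ → ℝ → ℝ} (hm : ∀ r, Measurable (φ r))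
    (h0 : ∀ r w, 0 ≤ φ r w) (h1 : ∀ r w, φ r w ≤ 1)
    (hlim : ∀ w, 0 < w → Tendsto (fun r => φ r w) l (nhds 1)) :
    Tendsto (fun r => ∫ w in Ioi (0 : ℝ), w ^ n * exp (-(1 / 2) * w ^ 2) * φ r w) l
      (nhds (∫ w in Ioi (0 : ℝ), w ^ n * exp (-(1 / 2) * w ^ 2))) := by
  refine tendsto_integral_filter_of_dominated_convergence
    (fun w => w ^ n * exp (-(1 / 2) * w ^ 2)) ?_ ?_ (integrableOn_pow_mul_exp_neg_half_sq n) ?_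
  · refine Eventually.of_forall fun r => Measurable.aestronglyMeasurable ?_
    have := hm r
    fun_prop
  · refine Eventually.of_forall fun r => (ae_restrict_mem measurableSet_Ioi).mono ?_
    intro w (hw : 0 < w)
    rw [norm_of_nonneg (mul_nonneg (by positivity) (h0 r w))]
    exact mul_le_of_le_one_right (by positivity) (h1 r w)
  · refine (ae_restrict_mem measurableSet_Ioi).mono ?_
    intro w (hw : 0 < w)
    simpa only [mul_one] using (hlim w hw).const_mul (w ^ n * exp (-(1 / 2) * w ^ 2))

open Set in
lemma tendsto_integral_atTop :
    Tendsto (fun r : ℝ => ∫ w in Ioi (0 : ℝ),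
        w ^ 5 * exp (-(1 / 2) * w ^ 2) * (r ^ 2 / (r ^ 2 + w ^ 2)) ^ 2) atTop (nhds 8) := by
  have h := tendsto_integral_pow_mul_exp_mul (l := atTop) 5
    (φ := fun r w => (r ^ 2 / (r ^ 2 + w ^ 2)) ^ 2) (fun r => by fun_prop)
    (fun r w => by positivity)
    (fun r w => pow_le_one₀ (by positivity)
      (div_le_one_of_le₀ (by nlinarith [sq_nonneg w]) (by positivity))) fun w _ => ?_
  · have e := integral_pow_mul_exp_neg_half_sq 2
    norm_num [Nat.factorial] at e h ⊢
    rwa [e] at h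
  · have h2 : Tendsto (fun r : ℝ => w ^ 2 / r ^ 2) atTop (nhds 0) :=
      tendsto_const_nhds.div_atTop (tendsto_pow_atTop two_ne_zero)
    have h3 : Tendsto (fun r : ℝ => ((1 + w ^ 2 / r ^ 2)⁻¹) ^ 2) atTop (nhds 1) := by
      simpa using ((h2.const_add 1).inv₀ (by norm_num)).pow 2
    refine h3.congr' ?_
    filter_upwards [eventually_gt_atTop 0] with r hr
    field_simp

open Set in
lemma tendsto_integral_zero :
    Tendsto (fun r : ℝ => ∫ w in Ioi (0 : ℝ),
        w ^ 1 * exp (-(1 / 2) * w ^ 2) * (w ^ 2 / (r ^ 2 + w ^ 2)) ^ 2) (nhds 0) (nhds 1) := by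
  have h := tendsto_integral_pow_mul_exp_mul (l := nhds 0) 1
    (φ := fun r w => (w ^ 2 / (r ^ 2 + w ^ 2)) ^ 2) (fun r => by fun_prop)
    (fun r w => by positivity)
    (fun r w => pow_le_one₀ (by positivity)
      (div_le_one_of_le₀ (by nlinarith [sq_nonneg r]) (by positivity))) fun w hw => ?_
  · have e := integral_pow_mul_exp_neg_half_sq 0
    norm_num [Nat.factorial] at e h ⊢
    rwa [e] at h
  · have h2 : ContinuousAt (fun r : ℝ => (w ^ 2 / (r ^ 2 + w ^ 2)) ^ 2) 0 := by
      have : (0 : ℝ) ^ 2 + w ^ 2 ≠ 0 := by positivity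
      fun_prop (disch := assumption)
    simpa [ContinuousAt, hw.ne'] using h2

/-- Asymptotics of the `p = 1` exact self-similar distribution
`F(v) = (4/π) ∫₀^∞ e^{-|v|²/(2s²)}/((2πs²)^{3/2}(1+s²)²) ds`:
`|v|⁶ F(v) → 2 (2/π)^{5/2}` as `|v| → ∞`, and `|v|² F(v) → 2^{1/2} π^{-5/2}`
as `|v| → 0`. -/
theorem stmt14 (F : EuclideanSpace ℝ (Fin 3) → ℝ)
    (hF : ∀ v : EuclideanSpace ℝ (Fin 3),
      F v = (4 / Real.pi) *
        ∫ s in Set.Ioi (0 : ℝ),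
          Real.exp (-(‖v‖ ^ 2 / (2 * s ^ 2)))
            / ((2 * Real.pi * s ^ 2) ^ ((3 : ℝ) / 2) * (1 + s ^ 2) ^ 2)) :
    Tendsto (fun v : EuclideanSpace ℝ (Fin 3) => ‖v‖ ^ 6 * F v)
        (Filter.comap norm Filter.atTop)
        (nhds (2 * (2 / Real.pi) ^ ((5 : ℝ) / 2))) ∧
    Tendsto (fun v : EuclideanSpace ℝ (Fin 3) => ‖v‖ ^ 2 * F v)
        (nhdsWithin 0 {0}ᶜ)
        (nhds ((2 : ℝ) ^ ((1 : ℝ) / 2) * Real.pi ^ (-(5 : ℝ) / 2))) := by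
  have hc : (2 * π) ^ ((3 : ℝ) / 2) = 2 * 2 ^ ((1 : ℝ) / 2) * π ^ ((3 : ℝ) / 2) := by
    rw [mul_rpow (by norm_num) pi_pos.le, show (3 : ℝ) / 2 = 1 + 1 / 2 by norm_num,
      rpow_add two_pos, rpow_one]
  have hπ : π ^ ((5 : ℝ) / 2) = π * π ^ ((3 : ℝ) / 2) := by
    rw [show (5 : ℝ) / 2 = 1 + 3 / 2 by norm_num, rpow_add pi_pos, rpow_one]
  have h2 : (2 : ℝ) ^ ((1 : ℝ) / 2) * 2 ^ ((1 : ℝ) / 2) = 2 := by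
    rw [← rpow_add two_pos]; norm_num
  have h2' : (2 : ℝ) ^ ((5 : ℝ) / 2) = 4 * 2 ^ ((1 : ℝ) / 2) := by
    rw [show (5 : ℝ) / 2 = (2 : ℕ) + 1 / 2 by norm_num, rpow_add two_pos, rpow_natCast]
    norm_num
  have hs : 0 < (2 : ℝ) ^ ((1 : ℝ) / 2) := by positivity
  have ht : 0 < π ^ ((3 : ℝ) / 2) := by positivity
  have hp := pi_pos
  constructor
  · have h := (tendsto_integral_atTop.const_mul
      (4 / π * ((2 * π) ^ ((3 : ℝ) / 2))⁻¹)).comp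
      (tendsto_comap (f := (norm : EuclideanSpace ℝ (Fin 3) → ℝ)))
    have e : 4 / π * ((2 * π) ^ ((3 : ℝ) / 2))⁻¹ * 8 = 2 * (2 / π) ^ ((5 : ℝ) / 2) := by
      rw [div_rpow two_pos.le hp.le, hc, hπ, h2']
      field_simp
      linear_combination (-4) * h2
    rw [e] at h
    refine h.congr' ?_
    filter_upwards [preimage_mem_comap (eventually_gt_atTop 0)] with v (hv : 0 < ‖v‖)
    rw [hF, integral_gaussian_mixture_eq hv]
    have e' : ∀ w : ℝ, w ^ 5 * rexp (-(1 / 2) * w ^ 2) * (‖v‖ ^ 2 / (‖v‖ ^ 2 + w ^ 2)) ^ 2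
        = ‖v‖ ^ 4 * (w ^ 5 * rexp (-(1 / 2) * w ^ 2) / (‖v‖ ^ 2 + w ^ 2) ^ 2) :=
      fun w => by field_simp
    simp only [Function.comp_apply, e', integral_const_mul]
    field_simp
  · have h := (tendsto_integral_zero.const_mul
      (4 / π * ((2 * π) ^ ((3 : ℝ) / 2))⁻¹)).comp
      ((tendsto_norm_zero (E := EuclideanSpace ℝ (Fin 3))).mono_left
        (nhdsWithin_le_nhds (s := {0}ᶜ)))
    have e : 4 / π * ((2 * π) ^ ((3 : ℝ) / 2))⁻¹ * 1
        = (2 : ℝ) ^ ((1 : ℝ) / 2) * π ^ (-(5 : ℝ) / 2) := by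
      rw [neg_div, rpow_neg hp.le, hc, hπ]
      field_simp
      linear_combination (-2) * h2
    rw [e] at h
    refine h.congr' ?_
    filter_upwards [self_mem_nhdsWithin] with v hv
    have hv : 0 < ‖v‖ := norm_pos_iff.2 hv
    rw [hF, integral_gaussian_mixture_eq hv]
    have e' : ∀ w : ℝ, w ^ 1 * rexp (-(1 / 2) * w ^ 2) * (w ^ 2 / (‖v‖ ^ 2 + w ^ 2)) ^ 2
        = w ^ 5 * rexp (-(1 / 2) * w ^ 2) / (‖v‖ ^ 2 + w ^ 2) ^ 2 := fun w => by field_simp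
    simp only [Function.comp_apply, e']
    field_simp
end

section
/- Let d ≥ 1, μ > 0, let G, H : [0,1] → ℝ be nonnegative and integrable, and let a, b, c : [0,1] → [0,1] be measurable. Suppose F : ℝ^d → ℝ is a nonnegative integrable function with ∫_{ℝ^d} F(v) dv = 1 whose Fourier transform is radial of the form ∫_{ℝ^d} F(v) e^{-ik·v} dv = ψ(|k|²) for a function ψ : [0,∞) → ℝ satisfying, for all x ≥ 0, -μ x ψ'(x) = ∫₀¹ G(s)[ψ(a(s)x)ψ(b(s)x) - ψ(x)]ds + ∫₀¹ H(s)[ψ(c(s)x) - ψ(x)]ds. Then there exists n ∈ ℕ such that ∫_{ℝ^d} |v|^{2n} F(v) dv = ∞, i.e. F cannot have finite moments of all orders. -/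
open Real MeasureTheory
open scoped RealInnerProductSpace

/-- Every power of `1 - cos` is a finite cosine sum. -/
theorem exists_one_sub_cos_pow_eq_sum (n : ℕ) :
    ∃ (ι : Type) (_ : Fintype ι) (w ω : ι → ℝ),
      ∀ θ : ℝ, (1 - cos θ) ^ n = ∑ i, w i * cos (ω i * θ) := by
  induction n with
  | zero => exact ⟨Unit, inferInstance, fun _ => 1, fun _ => 0, by simp⟩
  | succ n ih =>
    obtain ⟨ι, _, w, ω, h⟩ := ih
    refine ⟨ι × Fin 3, inferInstance, fun p => w p.1 * ![1, -1 / 2, -1 / 2] p.2,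
      fun p => ω p.1 + ![0, 1, -1] p.2, fun θ => ?_⟩
    rw [pow_succ, h, Finset.sum_mul, Fintype.sum_prod_type]
    refine Finset.sum_congr rfl fun i _ => ?_
    rw [Fin.sum_univ_three]
    simp only [Matrix.cons_val_zero, Matrix.cons_val_one, Matrix.cons_val]
    rw [add_mul, add_mul, add_mul, cos_add, cos_add, cos_add]
    simp
    ring

/-- The cosine transform of a measure on the line. -/
noncomputable def cosTransform (ν : Measure ℝ) (r : ℝ) : ℝ := ∫ x, cos (r * x) ∂ν

section CosTransform

variable (ν : Measure ℝ) [IsProbabilityMeasure ν]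

theorem integrable_cos_mul (r : ℝ) : Integrable (fun x => cos (r * x)) ν :=
  (integrable_const (1 : ℝ)).mono' (by fun_prop)
    (.of_forall fun x => by simpa using abs_cos_le_one (r * x))

theorem abs_cosTransform_le_one (r : ℝ) : |cosTransform ν r| ≤ 1 := by
  have h := norm_integral_le_of_norm_le_const (μ := ν) (f := fun x => cos (r * x)) (C := 1)
    (.of_forall fun x => abs_cos_le_one (r * x))
  simpa [cosTransform] using h

theorem continuous_cosTransform : Continuous (cosTransform ν) :=
  continuous_of_dominated (bound := fun _ => 1) (fun r => by fun_prop)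
    (fun r => .of_forall fun x => by simpa using abs_cos_le_one (r * x))
    (integrable_const _) (.of_forall fun x => by fun_prop)

theorem differentiable_cosTransform (h2 : Integrable (fun x : ℝ => x ^ 2) ν) :
    Differentiable ℝ (cosTransform ν) := fun r => by
  have h1 : Integrable (fun x : ℝ => |x|) ν := by
    refine ((integrable_const (1 : ℝ)).add h2).mono' (by fun_prop) (.of_forall fun x => ?_)
    simp only [norm_eq_abs, abs_abs, Pi.add_apply]
    nlinarith [sq_nonneg (|x| - 1), sq_abs x]
  exact (hasDerivAt_integral_of_dominated_loc_of_deriv_le (μ := ν) (x₀ := r) (s := Set.univ)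
    (F := fun r x => cos (r * x)) (F' := fun r x => -sin (r * x) * x)
    (bound := fun x => |x|) Filter.univ_mem (.of_forall fun r => by fun_prop)
    (integrable_cos_mul ν r) (by fun_prop)
    (.of_forall fun x t _ => by
      rw [norm_mul, norm_neg, norm_eq_abs, norm_eq_abs]
      exact mul_le_of_le_one_left (abs_nonneg _) (abs_sin_le_one _))
    h1 (.of_forall fun x t _ => by
      simpa using ((hasDerivAt_id t).mul_const x).cos)).2.differentiableAt

variable {ι : Type} [Fintype ι] {w ω : ι → ℝ}

theorem sum_mul_cosTransform (t : ℝ) :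
    ∑ i, w i * cosTransform ν (ω i * t) = ∫ x, ∑ i, w i * cos (ω i * (t * x)) ∂ν := by
  rw [integral_finsetSum]
  · refine Finset.sum_congr rfl fun i _ => ?_
    rw [integral_const_mul, cosTransform]
    simp only [mul_assoc]
  · intro i _
    simpa only [mul_assoc] using (integrable_cos_mul ν (ω i * t)).const_mul (w i)

theorem sum_mul_cosTransform_nonneg (hw : ∀ θ, 0 ≤ ∑ i, w i * cos (ω i * θ)) (t : ℝ) :
    0 ≤ ∑ i, w i * cosTransform ν (ω i * t) := by
  rw [sum_mul_cosTransform]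
  exact integral_nonneg fun x => hw _

theorem sum_mul_cosTransform_mul_cosTransform_nonneg
    (hw : ∀ θ, 0 ≤ ∑ i, w i * cos (ω i * θ)) (s t : ℝ) :
    0 ≤ ∑ i, w i * (cosTransform ν (ω i * s) * cosTransform ν (ω i * t)) := by
  have h1 : ∀ y, 0 ≤ ∑ i, w i * cos (ω i * y) * cosTransform ν (ω i * t) := fun y => by
    rw [sum_mul_cosTransform]
    refine integral_nonneg fun x => ?_
    have h2 := add_nonneg (hw (y + t * x)) (hw (y - t * x))
    rw [← Finset.sum_add_distrib] at h2
    have h3 : ∑ i, w i * cos (ω i * y) * cos (ω i * (t * x)) =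
        (∑ i, (w i * cos (ω i * (y + t * x)) + w i * cos (ω i * (y - t * x)))) / 2 := by
      rw [Finset.sum_div]
      refine Finset.sum_congr rfl fun i _ => ?_
      rw [mul_add, mul_sub, cos_add, cos_sub]
      ring
    simp only [Pi.zero_apply, h3]
    positivity
  have h4 : ∑ i, w i * (cosTransform ν (ω i * s) * cosTransform ν (ω i * t)) =
      ∑ i, (w i * cosTransform ν (ω i * t)) * cosTransform ν (ω i * s) :=
    Finset.sum_congr rfl fun i _ => by ring
  rw [h4, sum_mul_cosTransform]
  refine integral_nonneg fun x => (h1 (s * x)).trans_eq ?_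
  exact Finset.sum_congr rfl fun i _ => by ring

end CosTransform

/-- A function with `h * deriv T h ≤ N * T h` that is `O(h ^ (N + 1))` at `0` is nonpositive. -/
theorem nonpos_of_mul_deriv_le {T T' : ℝ → ℝ} {C : ℝ} {N : ℕ}
    (hd : ∀ h, 0 < h → HasDerivAt T (T' h) h)
    (hle : ∀ h, 0 < h → h * T' h ≤ N * T h)
    (hC : ∀ h, 0 < h → T h ≤ C * h ^ (N + 1)) {r : ℝ} (hr : 0 < r) : T r ≤ 0 := by
  have hanti : AntitoneOn (fun h => T h / h ^ N) (Set.Ioi 0) := by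
    have hder : ∀ h ∈ Set.Ioi (0 : ℝ), HasDerivAt (fun h => T h / h ^ N)
        ((T' h * h ^ N - T h * (N * h ^ (N - 1))) / (h ^ N) ^ 2) h := fun h hh =>
      (hd h hh).div (hasDerivAt_pow N h) (pow_ne_zero _ (ne_of_gt hh))
    refine antitoneOn_of_hasDerivWithinAt_nonpos (convex_Ioi 0)
      (fun h hh => (hder h hh).continuousAt.continuousWithinAt)
      (fun h hh => (hder h (interior_subset hh)).hasDerivWithinAt) fun h hh => ?_
    rw [interior_Ioi] at hh
    have hh : 0 < h := hh
    refine div_nonpos_of_nonpos_of_nonneg ?_ (by positivity)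
    rcases N with _ | N
    · have := hle h hh
      simp only [Nat.cast_zero, zero_mul] at this
      simpa using nonpos_of_mul_nonpos_right this hh
    · have := mul_le_mul_of_nonneg_left (hle h hh) (pow_nonneg hh.le N)
      simp only [Nat.add_sub_cancel]
      rw [pow_succ]
      linarith
  have hlim : ∀ h ∈ Set.Ioo 0 r, T r / r ^ N ≤ C * h := fun h hh => by
    refine (hanti hh.1 hr hh.2.le).trans ?_
    have : 0 < h := hh.1
    simp only
    rw [div_le_iff₀ (by positivity), mul_assoc, ← pow_succ']
    exact hC h this
  have h0 : T r / r ^ N ≤ C * 0 := by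
    have hcont : Continuous fun h : ℝ => C * h := by fun_prop
    refine ge_of_tendsto ((hcont.tendsto 0).mono_left
      (nhdsWithin_le_nhds (s := Set.Ioi (0 : ℝ)))) ?_
    filter_upwards [Ioo_mem_nhdsGT hr] with h hh using hlim h hh
  rw [mul_zero] at h0
  by_contra! hpos
  exact absurd h0 (not_le.mpr (by positivity))

/-- If `cos (h * x) = 1` almost surely for every `h > 0`, the measure lives at the origin. -/
theorem ae_eq_zero_of_integral_one_sub_cos_pow_nonpos (ν : Measure ℝ) [IsProbabilityMeasure ν]
    (n : ℕ) (hn : n ≠ 0) (h : ∀ r : ℝ, 0 < r → ∫ x, (1 - cos (r * x)) ^ n ∂ν ≤ 0) :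
    ∀ᵐ x ∂ν, x = 0 := by
  have hnn : ∀ r x : ℝ, 0 ≤ (1 - cos (r * x)) ^ n := fun r x =>
    pow_nonneg (sub_nonneg.2 (cos_le_one _)) _
  have h1 : ∀ k : ℕ, ∀ᵐ x ∂ν, cos (1 / (k + 1 : ℝ) * x) = 1 := fun k => by
    have hcos : Integrable (fun x => (1 - cos (1 / (k + 1 : ℝ) * x)) ^ n) ν := by
      refine (integrable_const ((2 : ℝ) ^ n)).mono' (by fun_prop) (.of_forall fun x => ?_)
      rw [norm_eq_abs, abs_of_nonneg (hnn _ _)]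
      exact pow_le_pow_left₀ (sub_nonneg.2 (cos_le_one _))
        (by linarith [neg_one_le_cos (1 / (k + 1 : ℝ) * x)]) _
    have h0 := (integral_eq_zero_iff_of_nonneg (fun x => hnn _ x) hcos).1
      (le_antisymm (h _ (by positivity)) (integral_nonneg fun x => hnn _ x))
    filter_upwards [h0] with x hx
    have := (pow_eq_zero_iff hn).1 hx
    linarith
  filter_upwards [ae_all_iff.2 h1] with x hx
  obtain ⟨k, hk⟩ := exists_nat_gt |x|
  have hk1 : (0 : ℝ) < k + 1 := by positivity
  have hlt : |1 / (k + 1 : ℝ) * x| < 1 := by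
    rw [abs_mul, abs_of_pos (by positivity), one_div_mul_eq_div, div_lt_one hk1]
    linarith
  have hpi := pi_gt_three
  have hzero := (cos_eq_one_iff_of_lt_of_lt (by linarith [(abs_lt.1 hlt).1])
    (by linarith [(abs_lt.1 hlt).2])).1 (hx k)
  rcases mul_eq_zero.1 hzero with h2 | h2
  · exact absurd h2 (by positivity)
  · exact h2

/-- A probability measure on the line whose cosine transform satisfies the self-similar profile
equation in the radial variable, and whose moments are all finite, is concentrated at `0`. -/
theorem ae_eq_zero_of_cosTransform_profile (ν : Measure ℝ) [IsProbabilityMeasure ν]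
    {μ : ℝ} (hμ : 0 < μ) {G H a b c : ℝ → ℝ}
    (hG : ∀ s ∈ Set.Icc (0 : ℝ) 1, 0 ≤ G s) (hH : ∀ s ∈ Set.Icc (0 : ℝ) 1, 0 ≤ H s)
    (hGint : IntervalIntegrable G volume 0 1) (hHint : IntervalIntegrable H volume 0 1)
    (ha : Measurable a) (hb : Measurable b) (hc : Measurable c)
    (heq : ∀ r : ℝ, -(μ / 2) * (r * deriv (cosTransform ν) r) =
      (∫ s in (0 : ℝ)..1,
        G s * (cosTransform ν (r * a s) * cosTransform ν (r * b s) - cosTransform ν r))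
      + ∫ s in (0 : ℝ)..1, H s * (cosTransform ν (r * c s) - cosTransform ν r))
    (hmom : ∀ n : ℕ, Integrable (fun x : ℝ => x ^ (2 * n)) ν) :
    ∀ᵐ x ∂ν, x = 0 := by
  set g := cosTransform ν with hg
  set lam := (∫ s in (0 : ℝ)..1, G s) + ∫ s in (0 : ℝ)..1, H s
  have hdiff := differentiable_cosTransform ν (hmom 1)
  have hgm : Measurable g := (continuous_cosTransform ν).measurable
  have hg1 : ∀ r, |g r| ≤ 1 := abs_cosTransform_le_one ν
  have bdd : ∀ {K f : ℝ → ℝ}, IntervalIntegrable K volume 0 1 → Measurable f →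
      (∀ s, |f s| ≤ 1) → IntervalIntegrable (fun s => K s * f s) volume 0 1 := by
    intro K f hK hf hf1
    rw [intervalIntegrable_iff] at hK ⊢
    exact hK.mul_bdd (c := 1) hf.aestronglyMeasurable (.of_forall hf1)
  have hGi : ∀ r, IntervalIntegrable (fun s => G s * (g (r * a s) * g (r * b s))) volume 0 1 :=
    fun r => bdd hGint (by fun_prop) fun s => by
      rw [abs_mul]; exact mul_le_one₀ (hg1 _) (abs_nonneg _) (hg1 _)
  have hHi : ∀ r, IntervalIntegrable (fun s => H s * g (r * c s)) volume 0 1 :=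
    fun r => bdd hHint (by fun_prop) fun s => hg1 _
  have hlin : ∀ r : ℝ, μ / 2 * (r * deriv g r) = lam * g r -
      ((∫ s in (0 : ℝ)..1, G s * (g (r * a s) * g (r * b s))) +
        ∫ s in (0 : ℝ)..1, H s * g (r * c s)) := fun r => by
    have h := heq r
    simp only [mul_sub] at h
    rw [intervalIntegral.integral_sub (hGi r) (hGint.mul_const _),
      intervalIntegral.integral_sub (hHi r) (hHint.mul_const _),
      intervalIntegral.integral_mul_const, intervalIntegral.integral_mul_const] at h
    linarith
  obtain ⟨n, hn⟩ := exists_nat_gt (2 * lam / μ)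
  obtain ⟨ι, _, w, ω, hw⟩ := exists_one_sub_cos_pow_eq_sum (n + 1)
  have hwn : ∀ θ, 0 ≤ ∑ i, w i * cos (ω i * θ) := fun θ => by
    rw [← hw]; exact pow_nonneg (sub_nonneg.2 (cos_le_one _)) _
  have hT : ∀ h, ∑ i, w i * g (ω i * h) = ∫ x, (1 - cos (h * x)) ^ (n + 1) ∂ν := fun h => by
    rw [hg, sum_mul_cosTransform]; simp only [hw]
  have hT0 : ∀ h, 0 ≤ ∑ i, w i * g (ω i * h) := sum_mul_cosTransform_nonneg ν hwn
  have hgain : ∀ h, 0 ≤ ∑ i, w i * ((∫ s in (0 : ℝ)..1,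
      G s * (g (ω i * h * a s) * g (ω i * h * b s))) +
        ∫ s in (0 : ℝ)..1, H s * g (ω i * h * c s)) := fun h => by
    simp only [mul_add, Finset.sum_add_distrib, ← intervalIntegral.integral_const_mul]
    rw [← intervalIntegral.integral_finsetSum fun i _ => (hGi _).const_mul _,
      ← intervalIntegral.integral_finsetSum fun i _ => (hHi _).const_mul _]
    refine add_nonneg (intervalIntegral.integral_nonneg zero_le_one fun s hs => ?_)
      (intervalIntegral.integral_nonneg zero_le_one fun s hs => ?_)
    · refine (mul_nonneg (hG s hs) (sum_mul_cosTransform_mul_cosTransform_nonneg ν hwn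
        (h * a s) (h * b s))).trans_eq ?_
      rw [Finset.mul_sum]
      exact Finset.sum_congr rfl fun i _ => by simp only [hg, ← mul_assoc]; ring
    · refine (mul_nonneg (hH s hs) (sum_mul_cosTransform_nonneg ν hwn (h * c s))).trans_eq ?_
      rw [Finset.mul_sum]
      exact Finset.sum_congr rfl fun i _ => by simp only [hg, ← mul_assoc]; ring
  have hder : ∀ h, HasDerivAt (fun h => ∑ i, w i * g (ω i * h))
      (∑ i, w i * (deriv g (ω i * h) * ω i)) h := fun h =>
    HasDerivAt.fun_sum fun i _ => (((hdiff (ω i * h)).hasDerivAt.comp h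
      (by simpa using (hasDerivAt_id h).const_mul (ω i)))).const_mul (w i)
  have hle : ∀ h, 0 < h → h * ∑ i, w i * (deriv g (ω i * h) * ω i) ≤
      (2 * n + 1 : ℕ) * ∑ i, w i * g (ω i * h) := fun h hh => by
    have h1 : μ / 2 * (h * ∑ i, w i * (deriv g (ω i * h) * ω i)) ≤
        lam * ∑ i, w i * g (ω i * h) := by
      have h2 : μ / 2 * (h * ∑ i, w i * (deriv g (ω i * h) * ω i)) =
          lam * (∑ i, w i * g (ω i * h)) - ∑ i, w i * ((∫ s in (0 : ℝ)..1,
            G s * (g (ω i * h * a s) * g (ω i * h * b s))) +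
            ∫ s in (0 : ℝ)..1, H s * g (ω i * h * c s)) := by
        rw [Finset.mul_sum, Finset.mul_sum, Finset.mul_sum, ← Finset.sum_sub_distrib]
        refine Finset.sum_congr rfl fun i _ => ?_
        linear_combination w i * hlin (ω i * h)
      linarith [hgain h]
    have h3 : lam ≤ μ / 2 * (2 * n + 1 : ℕ) := by
      rw [div_lt_iff₀ hμ] at hn
      push_cast
      nlinarith [mul_nonneg hμ.le (Nat.cast_nonneg (α := ℝ) n)]
    have h4 := h1.trans (mul_le_mul_of_nonneg_right h3 (hT0 h))
    rw [mul_assoc] at h4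
    exact le_of_mul_le_mul_left h4 (by positivity)
  have hC : ∀ h, 0 < h → ∑ i, w i * g (ω i * h) ≤
      (∫ x, x ^ (2 * (n + 1)) ∂ν) * h ^ (2 * n + 1 + 1) := fun h _ => by
    rw [hT, ← integral_mul_const]
    refine integral_mono_of_nonneg
      (.of_forall fun x => pow_nonneg (sub_nonneg.2 (cos_le_one _)) _)
      ((hmom (n + 1)).mul_const _) (.of_forall fun x => ?_)
    have h1 : 1 - cos (h * x) ≤ (h * x) ^ 2 := by
      nlinarith [one_sub_sq_div_two_le_cos (x := h * x), sq_nonneg (h * x)]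
    refine (pow_le_pow_left₀ (sub_nonneg.2 (cos_le_one _)) h1 _).trans_eq ?_
    simp only
    ring
  refine ae_eq_zero_of_integral_one_sub_cos_pow_nonpos ν (n + 1) n.succ_ne_zero fun r hr => ?_
  rw [← hT]
  exact nonpos_of_mul_deriv_le (fun h _ => hder h) hle hC hr

/-- Corollary 8.2: a probability density `F` on `ℝ^d` whose radial Fourier transform
`ψ(|k|²)` solves the generalized self-similar profile equation with `μ > 0` cannot
have finite moments of all orders. -/
theorem stmt16 (d : ℕ) (hd : 1 ≤ d) (μ : ℝ) (hμ : 0 < μ)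
    (G H a b c : ℝ → ℝ)
    (hG : ∀ s ∈ Set.Icc (0 : ℝ) 1, 0 ≤ G s)
    (hH : ∀ s ∈ Set.Icc (0 : ℝ) 1, 0 ≤ H s)
    (hGint : IntervalIntegrable G MeasureTheory.volume 0 1)
    (hHint : IntervalIntegrable H MeasureTheory.volume 0 1)
    (ha : Measurable a) (hb : Measurable b) (hc : Measurable c)
    (ha1 : ∀ s ∈ Set.Icc (0 : ℝ) 1, a s ∈ Set.Icc (0 : ℝ) 1)
    (hb1 : ∀ s ∈ Set.Icc (0 : ℝ) 1, b s ∈ Set.Icc (0 : ℝ) 1)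
    (hc1 : ∀ s ∈ Set.Icc (0 : ℝ) 1, c s ∈ Set.Icc (0 : ℝ) 1)
    (F : EuclideanSpace ℝ (Fin d) → ℝ)
    (hFpos : ∀ v, 0 ≤ F v)
    (hFint : Integrable F)
    (hFnorm : (∫ v : EuclideanSpace ℝ (Fin d), F v) = 1)
    (ψ : ℝ → ℝ)
    (hFourier : ∀ k : EuclideanSpace ℝ (Fin d),
      (∫ v : EuclideanSpace ℝ (Fin d),
          (F v : ℂ) * Complex.exp (-(Complex.I * (⟪k, v⟫ : ℝ))))
        = (ψ (‖k‖ ^ 2) : ℂ))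
    (hψ : ∀ x : ℝ, 0 ≤ x →
      -μ * x * deriv ψ x
        = (∫ s in (0 : ℝ)..1, G s * (ψ (a s * x) * ψ (b s * x) - ψ x))
          + ∫ s in (0 : ℝ)..1, H s * (ψ (c s * x) - ψ x)) :
    ∃ n : ℕ, ¬ Integrable (fun v : EuclideanSpace ℝ (Fin d) => ‖v‖ ^ (2 * n) * F v) := by
  by_contra! hmom
  obtain ⟨e, he⟩ : ∃ e : EuclideanSpace ℝ (Fin d), ‖e‖ = 1 :=
    ⟨EuclideanSpace.single ⟨0, hd⟩ 1, by simp⟩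
  have hFae : AEMeasurable (fun v => Real.toNNReal (F v)) :=
    hFint.aestronglyMeasurable.aemeasurable.real_toNNReal
  set P : Measure (EuclideanSpace ℝ (Fin d)) :=
    volume.withDensity fun v => (Real.toNNReal (F v) : ENNReal) with hP
  have hPprob : IsProbabilityMeasure P := ⟨by
    rw [hP, withDensity_apply _ MeasurableSet.univ, Measure.restrict_univ]
    have := ofReal_integral_eq_lintegral_ofReal hFint (.of_forall hFpos)
    rw [hFnorm, ENNReal.ofReal_one] at this
    exact this.symm⟩
  have hem : Measurable fun v : EuclideanSpace ℝ (Fin d) => (⟪e, v⟫ : ℝ) := by fun_prop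
  set ν : Measure ℝ := P.map fun v => (⟪e, v⟫ : ℝ) with hν
  have hνprob : IsProbabilityMeasure ν := Measure.isProbabilityMeasure_map hem.aemeasurable
  have hψg : ∀ r : ℝ, ψ (r ^ 2) = cosTransform ν r := fun r => by
    have h1 := congrArg Complex.re (hFourier (r • e))
    rw [Complex.ofReal_re, norm_smul, he, mul_one, norm_eq_abs, sq_abs] at h1
    rw [← h1, cosTransform, hν, integral_map hem.aemeasurable (by fun_prop), hP,
      integral_withDensity_eq_integral_smul₀ hFae]
    have hcos : Integrable (fun v : EuclideanSpace ℝ (Fin d) =>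
        (F v : ℂ) * Complex.exp (-(Complex.I * (⟪r • e, v⟫ : ℝ)))) := by
      refine hFint.ofReal.mul_bdd (c := 1) (by fun_prop) (.of_forall fun v => ?_)
      rw [← mul_neg, ← Complex.ofReal_neg, mul_comm, Complex.norm_exp_ofReal_mul_I]
    refine (integral_re hcos).symm.trans (integral_congr_ae (.of_forall fun v => ?_))
    simp only [NNReal.smul_def, Real.coe_toNNReal _ (hFpos v), smul_eq_mul, real_inner_smul_left]
    rw [← mul_neg, ← Complex.ofReal_neg, mul_comm Complex.I]
    rw [RCLike.re_eq_complex_re, Complex.re_ofReal_mul, Complex.exp_ofReal_mul_I_re, cos_neg]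
  have hψsqrt : ∀ x : ℝ, 0 ≤ x → ψ x = cosTransform ν (√x) := fun x hx => by
    rw [← hψg, sq_sqrt hx]
  have hmomν : ∀ n : ℕ, Integrable (fun x : ℝ => x ^ (2 * n)) ν := fun n => by
    rw [hν, integrable_map_measure (by fun_prop) hem.aemeasurable, hP,
      integrable_withDensity_iff_integrable_smul₀ hFae]
    refine (hmom n).mono' ?_ (.of_forall fun v => ?_)
    · exact hFae.aestronglyMeasurable.smul (by fun_prop)
    · simp only [Function.comp, NNReal.smul_def, Real.coe_toNNReal _ (hFpos v), smul_eq_mul]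
      rw [norm_mul, norm_eq_abs, abs_of_nonneg (hFpos v), mul_comm, norm_pow]
      refine mul_le_mul_of_nonneg_right (pow_le_pow_left₀ (norm_nonneg _) ?_ _) (hFpos v)
      simpa [he] using norm_inner_le_norm (𝕜 := ℝ) e v
  have hderiv : ∀ r : ℝ, r * deriv (cosTransform ν) r = 2 * (r ^ 2 * deriv ψ (r ^ 2)) := fun r => by
    rcases eq_or_ne r 0 with rfl | hr
    · simp
    have hr2 : 0 < r ^ 2 := by positivity
    have hdψ : DifferentiableAt ℝ ψ (r ^ 2) := by
      refine DifferentiableAt.congr_of_eventuallyEq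
        ((differentiable_cosTransform ν (hmomν 1) _).comp (r ^ 2)
          (hasDerivAt_sqrt hr2.ne').differentiableAt) ?_
      filter_upwards [lt_mem_nhds hr2] with x hx using hψsqrt x hx.le
    have h1 : HasDerivAt (cosTransform ν) (deriv ψ (r ^ 2) * (2 * r)) r := by
      have hsq : HasDerivAt (fun r : ℝ => r ^ 2) (2 * r) r := by simpa using hasDerivAt_pow 2 r
      have hcomp := HasDerivAt.comp (h₂ := ψ) (h := fun r : ℝ => r ^ 2) r hdψ.hasDerivAt hsq
      rwa [(funext hψg : ψ ∘ (fun r => r ^ 2) = cosTransform ν)] at hcomp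
    rw [h1.deriv]
    ring
  have hscale : ∀ r t : ℝ, 0 ≤ t → ψ (t * r ^ 2) = cosTransform ν (r * √t) := fun r t ht => by
    rw [← hψg, mul_pow, sq_sqrt ht, mul_comm]
  have hzero := ae_eq_zero_of_cosTransform_profile ν hμ (a := fun s => √(a s))
    (b := fun s => √(b s)) (c := fun s => √(c s)) hG hH hGint hHint
    ha.sqrt hb.sqrt hc.sqrt (fun r => by
      rw [hderiv]
      have h1 := hψ (r ^ 2) (sq_nonneg r)
      have hIcc : Set.uIcc (0 : ℝ) 1 = Set.Icc 0 1 := Set.uIcc_of_le zero_le_one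
      calc _ = -μ * r ^ 2 * deriv ψ (r ^ 2) := by ring
        _ = _ := h1
        _ = _ := by
          congr 1 <;> refine intervalIntegral.integral_congr fun s hs => ?_ <;> rw [hIcc] at hs
          · simp only [hscale r _ (ha1 s hs).1, hscale r _ (hb1 s hs).1, hψg]
          · simp only [hscale r _ (hc1 s hs).1, hψg]) hmomν
  have hker : volume ((LinearMap.ker (innerSL ℝ e).toLinearMap :
      Submodule ℝ (EuclideanSpace ℝ (Fin d))) : Set (EuclideanSpace ℝ (Fin d))) = 0 := by
    refine Measure.addHaar_submodule _ _ fun htop => ?_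
    have h1 : e ∈ LinearMap.ker (innerSL ℝ e).toLinearMap := htop ▸ Submodule.mem_top
    simp [he] at h1
  have hPker : ∀ᵐ v ∂P, (⟪e, v⟫ : ℝ) ≠ 0 := by
    refine (withDensity_absolutelyContinuous _ _).ae_le ?_
    filter_upwards [measure_eq_zero_iff_ae_notMem.1 hker] with v hv h0
    exact hv (by simpa using h0)
  have hPzero : ∀ᵐ v ∂P, (⟪e, v⟫ : ℝ) = 0 := ae_of_ae_map hem.aemeasurable hzero
  obtain ⟨v, h1, h2⟩ := (hPker.and hPzero).exists
  exact h1 h2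
end
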